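/- Let 0 < q < p < ∞, n ≥ 1, a = (a_1,…,a_{n−1}) ∈ ℂ^{n−1}, and g analytic on 𝔻. The operator T_{g,a} = T_g^{n,0} + Σ_{k=1}^{n−1} a_k T_g^{n,k} is bounded from H^p to H^q if and only if g ∈ H^s with 1/s = 1/q − 1/p; moreover boundedness is equivalent to compactness. -/

import Mathlib

open MeasureTheory ENNReal

/-- Point `e^{iθ}` of the unit circle. -/
noncomputable def circlePt (θ : ℝ) : ℂ := Complex.exp (θ * Complex.I)

/-- Hardy space (quasi)norm `‖f‖_{H^p}` as an extended nonnegative real. -/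
noncomputable def hardyNorm (p : ℝ) (f : ℂ → ℂ) : ℝ≥0∞ :=
  (⨆ r ∈ Set.Ico (0 : ℝ) 1,
      (∫⁻ θ in Set.Ioc (0 : ℝ) (2 * Real.pi),
        (‖f (r * circlePt θ)‖₊ : ℝ≥0∞) ^ p) / ENNReal.ofReal (2 * Real.pi)) ^ (1 / p)

/-- Integration operator `I f(z) = ∫_0^z f(t) dt` (along the segment from 0 to z). -/
noncomputable def Iop (f : ℂ → ℂ) (z : ℂ) : ℂ := z * ∫ t in (0 : ℝ)..1, f (t • z)

/-- Generalized integration operator `T_g^{n,k} f = I^n (f^{(k)} g^{(n-k)})`. -/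
noncomputable def Tgnk (g : ℂ → ℂ) (n k : ℕ) (f : ℂ → ℂ) : ℂ → ℂ :=
  Iop^[n] fun z => iteratedDeriv k f z * iteratedDeriv (n - k) g z

/-- The generalized integration operator `T_{g,a} = T_g^{n,0} + Σ_{k=1}^{n-1} a_k T_g^{n,k}`. -/
noncomputable def Tga (g : ℂ → ℂ) (n : ℕ) (a : ℕ → ℂ) (f : ℂ → ℂ) (z : ℂ) : ℂ :=
  Tgnk g n 0 f z + ∑ k ∈ Finset.Icc 1 (n - 1), a k * Tgnk g n k f z

namespace HardyArea
open Set Filter Topology Metric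

/-- Lebesgue measure on a period of the circle. -/
noncomputable abbrev cm : Measure ℝ := volume.restrict (Ioc 0 (2 * Real.pi))

lemma norm_circlePt (x : ℝ) : ‖circlePt x‖ = 1 := Complex.norm_exp_ofReal_mul_I x

lemma circlePt_ne_zero (x : ℝ) : circlePt x ≠ 0 := Complex.exp_ne_zero _

lemma circlePt_eq_circleMap (r x : ℝ) : (r : ℂ) * circlePt x = circleMap 0 r x := by
  simp [circleMap, circlePt]

lemma continuous_circlePt : Continuous circlePt := by unfold circlePt; fun_prop

lemma norm_circlePt_sub_le (x y : ℝ) : ‖circlePt x - circlePt y‖ ≤ |x - y| := by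
  have h : circlePt x - circlePt y = circlePt y * (Complex.exp (Complex.I * ((x - y : ℝ) : ℂ)) - 1) := by
    simp only [circlePt, mul_sub, ← Complex.exp_add]
    push_cast
    ring_nf
  rw [h, norm_mul, norm_circlePt, one_mul]
  simpa using Real.norm_exp_I_mul_ofReal_sub_one_le (x := x - y)

lemma cm_univ : cm univ = ENNReal.ofReal (2 * Real.pi) := by
  simp [cm]

instance : IsFiniteMeasure cm := ⟨by rw [cm_univ]; exact ENNReal.ofReal_lt_top⟩

/-- Index of the dyadic cell of generation `l` that contains the angle `x`. -/
noncomputable def cell (l : ℕ) (x : ℝ) : ℤ := ⌈x * 2 ^ l / (2 * Real.pi)⌉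

lemma measurable_cell (l : ℕ) : Measurable (cell l) := by
  unfold cell
  exact Int.measurable_ceil.comp (by fun_prop)

lemma abs_sub_lt_of_cell_eq {l : ℕ} {x y : ℝ} (h : cell l x = cell l y) :
    |x - y| ≤ 2 * Real.pi * (1 / 2) ^ l := by
  have hp := Real.pi_pos
  have h1 := Int.le_ceil (x * 2 ^ l / (2 * Real.pi))
  have h2 := Int.ceil_lt_add_one (x * 2 ^ l / (2 * Real.pi))
  have h3 := Int.le_ceil (y * 2 ^ l / (2 * Real.pi))
  have h4 := Int.ceil_lt_add_one (y * 2 ^ l / (2 * Real.pi))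
  unfold cell at h
  rw [h] at h1 h2
  have h5 : |x * 2 ^ l / (2 * Real.pi) - y * 2 ^ l / (2 * Real.pi)| ≤ 1 := by
    rw [abs_le]; constructor <;> linarith
  have h6 : x * 2 ^ l / (2 * Real.pi) - y * 2 ^ l / (2 * Real.pi)
      = (x - y) * (2 ^ l / (2 * Real.pi)) := by ring
  rw [h6, abs_mul, abs_of_pos (by positivity : (0:ℝ) < 2 ^ l / (2 * Real.pi))] at h5
  calc |x - y| = |x - y| * (2 ^ l / (2 * Real.pi)) * (2 * Real.pi * (1 / 2) ^ l) := by
        rw [one_div, inv_pow]; field_simp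
    _ ≤ 1 * (2 * Real.pi * (1 / 2) ^ l) := by gcongr
    _ = _ := one_mul _

lemma cell_eq_ceil_half (l : ℕ) (x : ℝ) : cell l x = ⌈(cell (l + 1) x : ℝ) / 2⌉ := by
  unfold cell
  have h : x * 2 ^ l / (2 * Real.pi) = (x * 2 ^ (l + 1) / (2 * Real.pi)) / 2 := by ring
  rw [h]
  apply le_antisymm
  · apply Int.ceil_mono
    gcongr
    exact Int.le_ceil _
  · rw [Int.ceil_le, div_le_iff₀ two_pos]
    have := Int.le_ceil (x * 2 ^ (l + 1) / (2 * Real.pi) / 2)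
    rw [div_le_iff₀ two_pos] at this
    exact_mod_cast Int.ceil_le.2 (by exact_mod_cast this)

lemma cell_eq_of_le {l m : ℕ} (hlm : l ≤ m) {x y : ℝ} (h : cell m x = cell m y) :
    cell l x = cell l y := by
  induction m, hlm using Nat.le_induction with
  | base => exact h
  | succ m _ ih =>
    apply ih
    rw [cell_eq_ceil_half m x, cell_eq_ceil_half m y, h]

/-- The Whitney box over the dyadic cell with index `i` of generation `l`. -/
def box (κ l : ℕ) (i : ℤ) : Set ℂ :=
  {w | ∃ r φ : ℝ, cell l φ = i ∧ (1 / 2 : ℝ) ^ (l + κ) ≤ 1 - r ∧ 1 - r ≤ (1 / 2 : ℝ) ^ l ∧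
    w = r * circlePt φ}

/-- Normalised supremum of the `j`-th derivative over the Whitney box of generation `l` above `x`. -/
noncomputable def cs (κ j : ℕ) (F : ℂ → ℂ) (l : ℕ) (x : ℝ) : ℝ≥0∞ :=
  ⨆ w ∈ box κ l (cell l x), ‖iteratedDeriv j F w‖ₑ * (1 / 2) ^ (l * j)

lemma cs_congr_cell {κ j : ℕ} {F : ℂ → ℂ} {l : ℕ} {x y : ℝ} (h : cell l x = cell l y) :
    cs κ j F l x = cs κ j F l y := by
  unfold cs; rw [h]

lemma measurable_cs (κ j : ℕ) (F : ℂ → ℂ) (l : ℕ) : Measurable (cs κ j F l) :=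
  (measurable_from_top (f := fun i : ℤ =>
    ⨆ w ∈ box κ l i, ‖iteratedDeriv j F w‖ₑ * (1 / 2) ^ (l * j))).comp (measurable_cell l)

lemma le_cs {κ j : ℕ} {F : ℂ → ℂ} {l : ℕ} {x : ℝ} {w : ℂ} (hw : w ∈ box κ l (cell l x)) :
    ‖iteratedDeriv j F w‖ₑ * (1 / 2) ^ (l * j) ≤ cs κ j F l x :=
  le_iSup₂ (f := fun w _ => ‖iteratedDeriv j F w‖ₑ * (1 / 2) ^ (l * j)) w hw

lemma box_subset_ball {κ l : ℕ} {i : ℤ} : box κ l i ⊆ ball 0 1 := by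
  rintro w ⟨r, φ, -, h1, h2, rfl⟩
  have h3 : (0 : ℝ) < (1 / 2) ^ (l + κ) := by positivity
  have h4 : ((1 : ℝ) / 2) ^ l ≤ 1 := pow_le_one₀ (by norm_num) (by norm_num)
  simp only [mem_ball, dist_zero_right, norm_mul, norm_circlePt, mul_one, Complex.norm_real,
    Real.norm_eq_abs]
  rw [abs_of_nonneg (by linarith)]
  linarith

lemma norm_of_mem_box {κ l : ℕ} {i : ℤ} {w : ℂ} (hw : w ∈ box κ l i) :
    (1 / 2 : ℝ) ^ (l + κ) ≤ 1 - ‖w‖ ∧ 1 - ‖w‖ ≤ (1 / 2 : ℝ) ^ l := by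
  obtain ⟨r, φ, -, h1, h2, rfl⟩ := hw
  have h4 : ((1 : ℝ) / 2) ^ l ≤ 1 := pow_le_one₀ (by norm_num) (by norm_num)
  simp only [norm_mul, norm_circlePt, mul_one, Complex.norm_real, Real.norm_eq_abs]
  rw [abs_of_nonneg (by linarith)]
  exact ⟨h1, h2⟩

/-- The centre of the box of generation `l` above `x`. -/
noncomputable def ctr (l : ℕ) (x : ℝ) : ℂ := ((1 - (1 / 2) ^ l : ℝ) : ℂ) * circlePt x

lemma norm_ctr (l : ℕ) (x : ℝ) : ‖ctr l x‖ = 1 - (1 / 2) ^ l := by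
  have h4 : ((1 : ℝ) / 2) ^ l ≤ 1 := pow_le_one₀ (by norm_num) (by norm_num)
  rw [ctr, norm_mul, norm_circlePt, mul_one, Complex.norm_real, Real.norm_eq_abs,
    abs_of_nonneg (by linarith)]

lemma continuous_ctr (l : ℕ) : Continuous (ctr l) := by
  unfold ctr; have := continuous_circlePt; fun_prop

lemma norm_sub_ctr_le {κ l : ℕ} {x : ℝ} {w : ℂ} (hw : w ∈ box κ l (cell l x)) :
    ‖w - ctr l x‖ ≤ 8 * (1 / 2) ^ l := by
  obtain ⟨r, φ, h0, h1, h2, rfl⟩ := hw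
  have h4 : ((1 : ℝ) / 2) ^ l ≤ 1 := pow_le_one₀ (by norm_num) (by norm_num)
  have h3 : (0 : ℝ) < (1 / 2) ^ (l + κ) := by positivity
  have e : (r : ℂ) * circlePt φ - ctr l x = (r : ℂ) * (circlePt φ - circlePt x)
      + ((r - (1 - (1 / 2) ^ l) : ℝ) : ℂ) * circlePt x := by
    unfold ctr; push_cast; ring
  rw [e]
  refine (norm_add_le _ _).trans ?_
  rw [norm_mul, norm_mul, norm_circlePt, Complex.norm_real, Complex.norm_real, Real.norm_eq_abs,
    Real.norm_eq_abs, mul_one, abs_of_nonneg (by linarith : 0 ≤ r),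
    abs_of_nonneg (by linarith : 0 ≤ r - (1 - (1 / 2) ^ l))]
  have h5 := (norm_circlePt_sub_le φ x).trans (abs_sub_lt_of_cell_eq h0)
  have h6 : r * ‖circlePt φ - circlePt x‖ ≤ 1 * (2 * Real.pi * (1 / 2) ^ l) := by
    gcongr; linarith
  have hpi := Real.pi_lt_d2
  have h7 : (2 * Real.pi * (1 / 2) ^ l) ≤ 7 * (1 / 2 : ℝ) ^ l := by
    gcongr; linarith
  linarith

lemma exists_mem_box {w : ℂ} (hw : w ∈ ball (0 : ℂ) 1) {κ : ℕ} (hκ : 1 ≤ κ) :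
    ∃ l : ℕ, ∃ x ∈ Ioc 0 (2 * Real.pi), w = ‖w‖ * circlePt x ∧ w ∈ box κ l (cell l x) := by
  have hw' : ‖w‖ < 1 := by simpa using hw
  obtain ⟨l, h1, h2⟩ : ∃ l : ℕ, (1 / 2 : ℝ) ^ (l + 1) < 1 - ‖w‖ ∧ 1 - ‖w‖ ≤ (1 / 2) ^ l :=
    exists_nat_pow_near_of_lt_one (by linarith) (by linarith [norm_nonneg w])
      (by norm_num) (by norm_num)
  obtain ⟨x, hx, hwx⟩ : ∃ x ∈ Ioc 0 (2 * Real.pi), w = ‖w‖ * circlePt x := by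
    refine ⟨toIocMod Real.two_pi_pos 0 w.arg, ?_, ?_⟩
    · simpa using toIocMod_mem_Ioc Real.two_pi_pos 0 w.arg
    · have : circlePt (toIocMod Real.two_pi_pos 0 w.arg) = Complex.exp (w.arg * Complex.I) := by
        unfold circlePt toIocMod
        have := Complex.exp_periodic.int_mul (toIocDiv Real.two_pi_pos 0 w.arg) |>.sub_eq
          (w.arg * Complex.I)
        rw [← this]
        congr 1
        push_cast [zsmul_eq_mul]
        ring
      rw [this, Complex.norm_mul_exp_arg_mul_I]
  refine ⟨l, x, hx, hwx, ‖w‖, x, rfl, le_trans ?_ h1.le, h2, hwx⟩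
  exact pow_le_pow_of_le_one (by norm_num) (by norm_num) (by omega)

/-- The Poisson kernel of the unit disc, normalised to have integral one. -/
noncomputable def pk (w : ℂ) (y : ℝ) : ℝ :=
  (1 - ‖w‖ ^ 2) / ‖circlePt y - w‖ ^ 2 / (2 * Real.pi)

/-- The Poisson kernel as an extended nonnegative real. -/
noncomputable def pke (w : ℂ) (y : ℝ) : ℝ≥0∞ := ENNReal.ofReal (pk w y)

/-- Functions holomorphic on a neighbourhood of the closed unit disc. -/
def AN (F : ℂ → ℂ) : Prop := ∃ R > 1, DifferentiableOn ℂ F (ball 0 R)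

lemma AN.diffOn {F : ℂ → ℂ} (h : AN F) : DifferentiableOn ℂ F (ball 0 1) := by
  obtain ⟨R, hR, hF⟩ := h
  exact hF.mono (ball_subset_ball hR.le)

lemma AN.continuousOn {F : ℂ → ℂ} (h : AN F) : ContinuousOn F (closedBall 0 1) := by
  obtain ⟨R, hR, hF⟩ := h
  exact hF.continuousOn.mono (closedBall_subset_ball hR)

lemma AN.diffContOnCl {F : ℂ → ℂ} (h : AN F) : DiffContOnCl ℂ F (ball 0 1) :=
  ⟨h.diffOn, by rw [closure_ball _ one_ne_zero]; exact h.continuousOn⟩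

lemma circlePt_mem_closedBall (y : ℝ) : circlePt y ∈ closedBall (0 : ℂ) 1 := by
  simp [norm_circlePt]

lemma smul_circlePt_mem_ball {r : ℝ} (h0 : 0 ≤ r) (h1 : r < 1) (y : ℝ) :
    (r : ℂ) * circlePt y ∈ ball (0 : ℂ) 1 := by
  simp [norm_circlePt, abs_of_nonneg h0, h1]

lemma AN.continuous_circle {F : ℂ → ℂ} (h : AN F) : Continuous fun y => F (circlePt y) :=
  h.continuousOn.comp_continuous continuous_circlePt circlePt_mem_closedBall

lemma continuous_slice {F : ℂ → ℂ} (h : ContinuousOn F (ball 0 1)) {r : ℝ} (h0 : 0 ≤ r)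
    (h1 : r < 1) : Continuous fun y => F (r * circlePt y) :=
  h.comp_continuous (by have := continuous_circlePt; fun_prop) (smul_circlePt_mem_ball h0 h1)

lemma circlePt_sub_ne_zero {w : ℂ} (hw : w ∈ ball (0 : ℂ) 1) (y : ℝ) : circlePt y - w ≠ 0 := by
  intro h
  rw [sub_eq_zero] at h
  rw [← h] at hw
  simp [norm_circlePt] at hw

lemma one_sub_le_norm_circlePt_sub (w : ℂ) (y : ℝ) : 1 - ‖w‖ ≤ ‖circlePt y - w‖ := by
  have := norm_sub_norm_le (circlePt y) w
  rwa [norm_circlePt] at this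

lemma pk_nonneg {w : ℂ} (hw : w ∈ ball (0 : ℂ) 1) (y : ℝ) : 0 ≤ pk w y := by
  have hw' : ‖w‖ < 1 := by simpa using hw
  have : 0 ≤ 1 - ‖w‖ ^ 2 := by nlinarith [norm_nonneg w]
  have := Real.pi_pos
  unfold pk; positivity

lemma continuous_pk {w : ℂ} (hw : w ∈ ball (0 : ℂ) 1) : Continuous (pk w) := by
  unfold pk
  refine Continuous.div_const (Continuous.div continuous_const ?_ ?_) _
  · have := continuous_circlePt; fun_prop
  · intro y; simpa using circlePt_sub_ne_zero hw y

lemma measurable_pk : Measurable fun z : ℂ × ℝ => pk z.1 z.2 := by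
  unfold pk
  have := continuous_circlePt.measurable
  fun_prop

lemma measurable_pke : Measurable fun z : ℂ × ℝ => pke z.1 z.2 :=
  measurable_pk.ennreal_ofReal

lemma pk_eq_poissonKernel (w : ℂ) (y : ℝ) :
    pk w y = poissonKernel 0 w (circleMap 0 1 y) / (2 * Real.pi) := by
  have : circleMap 0 1 y = circlePt y := by rw [← circlePt_eq_circleMap]; simp
  simp [pk, poissonKernel_def, this, norm_circlePt]

lemma poisson_formula {F : ℂ → ℂ} (h : AN F) {w : ℂ} (hw : w ∈ ball (0 : ℂ) 1) :
    F w = ∫ y, (pk w y : ℂ) * F (circlePt y) ∂cm := by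
  rw [← h.diffContOnCl.circleAverage_poissonKernel_smul hw, Real.circleAverage,
    intervalIntegral.integral_of_le Real.two_pi_pos.le, ← integral_smul]
  congr 1 with y
  have e : circleMap 0 1 y = circlePt y := by rw [← circlePt_eq_circleMap]; simp
  rw [pk_eq_poissonKernel, e]
  simp only [Pi.smul_apply', Complex.real_smul]
  push_cast
  ring

lemma integrable_of_continuous {E : Type*} [NormedAddCommGroup E] {f : ℝ → E} (h : Continuous f) :
    Integrable f cm :=
  (h.integrableOn_Icc (μ := volume) (a := 0) (b := 2 * Real.pi)).mono_set Ioc_subset_Icc_self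

lemma integral_pk {w : ℂ} (hw : w ∈ ball (0 : ℂ) 1) : ∫ y, pk w y ∂cm = 1 := by
  have h := poisson_formula (F := fun _ => 1) ⟨2, by norm_num, by fun_prop⟩ hw
  simp only [mul_one] at h
  rw [integral_complex_ofReal] at h
  exact_mod_cast h.symm

lemma lintegral_pke {w : ℂ} (hw : w ∈ ball (0 : ℂ) 1) : ∫⁻ y, pke w y ∂cm = 1 := by
  unfold pke
  rw [← ofReal_integral_eq_lintegral_ofReal (integrable_of_continuous (continuous_pk hw))
    (ae_of_all _ (pk_nonneg hw)), integral_pk hw, ENNReal.ofReal_one]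

lemma rpow_lintegral_le {α : Type*} [MeasurableSpace α] {μ : Measure α} [IsProbabilityMeasure μ]
    {f : α → ℝ≥0∞} (hf : AEMeasurable f μ) {p : ℝ} (hp : 1 ≤ p) :
    (∫⁻ a, f a ∂μ) ^ p ≤ ∫⁻ a, f a ^ p ∂μ := by
  have hp0 : 0 < p := by linarith
  rcases eq_or_lt_of_le hp with rfl | h1
  · simp
  have hpq := Real.HolderConjugate.conjExponent h1
  have := ENNReal.lintegral_mul_le_Lp_mul_Lq μ hpq hf (aemeasurable_const (b := (1 : ℝ≥0∞)))
  simp only [Pi.mul_apply, mul_one, one_rpow, lintegral_const, measure_univ] at this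
  calc (∫⁻ a, f a ∂μ) ^ p ≤ ((∫⁻ a, f a ^ p ∂μ) ^ (1 / p)) ^ p := by gcongr
    _ = _ := by rw [← ENNReal.rpow_mul, one_div_mul_cancel hp0.ne', ENNReal.rpow_one]

lemma measurable_pke_left (w : ℂ) : Measurable (pke w) :=
  measurable_pke.of_uncurry_left (x := w) (f := pke)

lemma jensen_pke {w : ℂ} (hw : w ∈ ball (0 : ℂ) 1) {φ : ℝ → ℝ≥0∞} (hφ : Measurable φ) {p : ℝ}
    (hp : 1 ≤ p) : (∫⁻ y, pke w y * φ y ∂cm) ^ p ≤ ∫⁻ y, pke w y * φ y ^ p ∂cm := by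
  have hm := measurable_pke_left w
  have hP : IsProbabilityMeasure (cm.withDensity (pke w)) :=
    ⟨by rw [withDensity_apply _ MeasurableSet.univ, Measure.restrict_univ, lintegral_pke hw]⟩
  have := rpow_lintegral_le (μ := cm.withDensity (pke w)) hφ.aemeasurable hp
  rwa [lintegral_withDensity_eq_lintegral_mul _ hm hφ,
    lintegral_withDensity_eq_lintegral_mul _ hm (hφ.pow_const p)] at this

lemma enorm_pk {w : ℂ} (hw : w ∈ ball (0 : ℂ) 1) (y : ℝ) : ‖(pk w y : ℂ)‖ₑ = pke w y := by
  rw [pke, ← ofReal_norm, Complex.norm_real, Real.norm_of_nonneg (pk_nonneg hw y)]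

lemma poisson_le {F : ℂ → ℂ} (h : AN F) {w : ℂ} (hw : w ∈ ball (0 : ℂ) 1) {p : ℝ} (hp : 1 ≤ p) :
    ‖F w‖ₑ ^ p ≤ ∫⁻ y, pke w y * ‖F (circlePt y)‖ₑ ^ p ∂cm := by
  refine le_trans ?_ (jensen_pke hw h.continuous_circle.enorm.measurable hp)
  gcongr
  rw [poisson_formula h hw]
  refine (enorm_integral_le_lintegral_enorm _).trans_eq ?_
  simp_rw [enorm_mul, enorm_pk hw]

lemma pk_le_mul {w z : ℂ} (hw : w ∈ ball (0 : ℂ) 1) (hz : z ∈ ball (0 : ℂ) 1) {A B : ℝ}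
    (h1 : ‖w - z‖ ≤ A * (1 - ‖z‖)) (h2 : 1 - ‖z‖ ≤ B * (1 - ‖w‖)) (hA : 0 ≤ A) (hB : 0 ≤ B)
    (y : ℝ) : pk w y ≤ 2 * (1 + A) * (1 + A * B) ^ 2 * pk z y := by
  have hw' : ‖w‖ < 1 := by simpa using hw
  have hz' : ‖z‖ < 1 := by simpa using hz
  have hpi := Real.pi_pos
  have hez := norm_pos_iff.2 (circlePt_sub_ne_zero hz y)
  have hew := norm_pos_iff.2 (circlePt_sub_ne_zero hw y)
  have h3 : ‖circlePt y - z‖ ≤ (1 + A * B) * ‖circlePt y - w‖ := by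
    have e1 : ‖circlePt y - z‖ ≤ ‖circlePt y - w‖ + ‖w - z‖ := norm_sub_le_norm_sub_add_norm_sub ..
    have e2 := one_sub_le_norm_circlePt_sub w y
    have e3 : A * (1 - ‖z‖) ≤ A * (B * (1 - ‖w‖)) := by gcongr
    have e4 : A * B * (1 - ‖w‖) ≤ A * B * ‖circlePt y - w‖ := by gcongr
    linarith
  have h4 : 1 - ‖w‖ ≤ (1 + A) * (1 - ‖z‖) := by
    have : ‖z‖ - ‖w‖ ≤ ‖w - z‖ := by rw [norm_sub_rev]; exact norm_sub_norm_le _ _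
    linarith
  unfold pk
  rw [div_div, div_div, ← mul_div_assoc, div_le_div_iff₀ (by positivity) (by positivity)]
  have h5 : 1 - ‖w‖ ^ 2 ≤ 2 * (1 - ‖w‖) := by nlinarith [norm_nonneg w]
  have h6 : 1 - ‖z‖ ≤ 1 - ‖z‖ ^ 2 := by nlinarith [norm_nonneg z]
  have h7 : 1 - ‖w‖ ^ 2 ≤ 2 * (1 + A) * (1 - ‖z‖ ^ 2) := by nlinarith
  have h8 : ‖circlePt y - z‖ ^ 2 ≤ (1 + A * B) ^ 2 * ‖circlePt y - w‖ ^ 2 := by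
    rw [← mul_pow]; gcongr
  have h9 : 0 ≤ 1 - ‖z‖ ^ 2 := by nlinarith [norm_nonneg z]
  calc (1 - ‖w‖ ^ 2) * (‖circlePt y - z‖ ^ 2 * (2 * Real.pi))
      ≤ (2 * (1 + A) * (1 - ‖z‖ ^ 2)) * ((1 + A * B) ^ 2 * ‖circlePt y - w‖ ^ 2 * (2 * Real.pi)) := by
        gcongr
    _ = _ := by ring

lemma pke_le_mul {w z : ℂ} (hw : w ∈ ball (0 : ℂ) 1) (hz : z ∈ ball (0 : ℂ) 1) {A B : ℝ}
    (h1 : ‖w - z‖ ≤ A * (1 - ‖z‖)) (h2 : 1 - ‖z‖ ≤ B * (1 - ‖w‖)) (hA : 0 ≤ A) (hB : 0 ≤ B)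
    (y : ℝ) : pke w y ≤ ENNReal.ofReal (2 * (1 + A) * (1 + A * B) ^ 2) * pke z y := by
  unfold pke
  rw [← ENNReal.ofReal_mul (by positivity)]
  exact ENNReal.ofReal_le_ofReal (pk_le_mul hw hz h1 h2 hA hB y)

lemma pk_symm (r x y : ℝ) : pk (r * circlePt x) y = pk (r * circlePt y) x := by
  have h : ‖circlePt y - r * circlePt x‖ = ‖circlePt x - r * circlePt y‖ := by
    have e : circlePt x - r * circlePt y
        = circlePt x * circlePt y * (starRingEnd ℂ) (circlePt y - r * circlePt x) := by
      have hc : ∀ t, circlePt t * (starRingEnd ℂ) (circlePt t) = 1 := fun t => by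
        rw [Complex.mul_conj, Complex.normSq_eq_norm_sq, norm_circlePt]; simp
      simp only [map_sub, map_mul, Complex.conj_ofReal]
      linear_combination (-(circlePt x)) * hc y + r * circlePt y * hc x
    rw [e, norm_mul, norm_mul, norm_circlePt, norm_circlePt, RCLike.norm_conj]
    ring
  unfold pk
  rw [h]
  simp [norm_circlePt]

lemma ctr_mem_ball (l : ℕ) (x : ℝ) : ctr l x ∈ ball (0 : ℂ) 1 := by
  have : (0 : ℝ) < (1 / 2) ^ l := by positivity
  rw [mem_ball_zero_iff, norm_ctr]; linarith

lemma pke_ctr_symm (l : ℕ) (x y : ℝ) : pke (ctr l x) y = pke (ctr l y) x := by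
  unfold pke ctr; rw [pk_symm]

lemma cell_eq_iff {l : ℕ} {y : ℝ} {i : ℤ} :
    cell l y = i ↔ y ∈ Ioc ((i - 1 : ℝ) * (2 * Real.pi * (1 / 2) ^ l)) (i * (2 * Real.pi * (1 / 2) ^ l)) := by
  have hpi := Real.pi_pos
  have h : y * 2 ^ l / (2 * Real.pi) = y / (2 * Real.pi * (1 / 2) ^ l) := by
    rw [one_div, inv_pow]; field_simp
  rw [cell, Int.ceil_eq_iff, h, lt_div_iff₀ (by positivity), div_le_iff₀ (by positivity)]
  rfl

lemma cell_subset_Ioc {l : ℕ} {x : ℝ} (hx : x ∈ Ioc 0 (2 * Real.pi)) :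
    {y | cell l y = cell l x} ⊆ Ioc 0 (2 * Real.pi) := by
  have hpi := Real.pi_pos
  intro y hy
  have h0 : ∀ m, cell m x = cell m y → cell 0 x = cell 0 y := fun m => cell_eq_of_le (Nat.zero_le _)
  have h1 := h0 l (Eq.symm hy)
  have h2 : cell 0 x = 1 := by rw [cell_eq_iff]; simpa using hx
  rw [h2] at h1
  simpa using (cell_eq_iff.1 h1.symm)

lemma volume_cell (l : ℕ) (i : ℤ) :
    volume {y | cell l y = i} = ENNReal.ofReal (2 * Real.pi * (1 / 2) ^ l) := by
  have : {y | cell l y = i} = Ioc ((i - 1 : ℝ) * (2 * Real.pi * (1 / 2) ^ l))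
      (i * (2 * Real.pi * (1 / 2) ^ l)) := by ext y; exact cell_eq_iff
  rw [this, Real.volume_Ioc]
  congr 1; ring

lemma measurableSet_cell (l : ℕ) (i : ℤ) : MeasurableSet {y | cell l y = i} :=
  measurable_cell l (measurableSet_singleton i)

lemma cm_cell {l : ℕ} {x : ℝ} (hx : x ∈ Ioc 0 (2 * Real.pi)) :
    cm {y | cell l y = cell l x} = ENNReal.ofReal (2 * Real.pi * (1 / 2) ^ l) := by
  rw [cm, Measure.restrict_apply (measurableSet_cell _ _), inter_eq_left.2 (cell_subset_Ioc hx),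
    volume_cell]

lemma norm_circlePt_sub_le_of_mem_box {κ l : ℕ} {y : ℝ} {w : ℂ} (hw : w ∈ box κ l (cell l y)) :
    ‖circlePt y - w‖ ≤ 8 * (1 / 2) ^ l := by
  obtain ⟨r, φ, h0, h1, h2, rfl⟩ := hw
  have h3 : (0 : ℝ) < (1 / 2) ^ (l + κ) := by positivity
  have e : circlePt y - (r : ℂ) * circlePt φ = (circlePt y - circlePt φ)
      + ((1 - r : ℝ) : ℂ) * circlePt φ := by push_cast; ring
  rw [e]
  refine (norm_add_le _ _).trans ?_
  rw [norm_mul, norm_circlePt, Complex.norm_real, mul_one, Real.norm_of_nonneg (by linarith)]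
  have h5 := (norm_circlePt_sub_le y φ).trans (abs_sub_lt_of_cell_eq h0.symm)
  have hpi := Real.pi_lt_d2
  have h7 : (2 * Real.pi * (1 / 2) ^ l) ≤ 7 * (1 / 2 : ℝ) ^ l := by
    gcongr; linarith
  linarith

lemma le_lintegral_pke {κ l : ℕ} {x : ℝ} (hx : x ∈ Ioc 0 (2 * Real.pi)) {w : ℂ}
    (hw : w ∈ box κ l (cell l x)) {φ : ℝ → ℝ≥0∞} {m : ℝ≥0∞}
    (hm : ∀ y, cell l y = cell l x → m ≤ φ y) :
    (1 / 2) ^ κ / 64 * m ≤ ∫⁻ y, pke w y * φ y ∂cm := by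
  have hpi := Real.pi_pos
  have hn := norm_of_mem_box hw
  have key : ∀ y ∈ {y | cell l y = cell l x},
      ENNReal.ofReal ((1 / 2) ^ κ / 64 / (2 * Real.pi * (1 / 2) ^ l)) * m ≤ pke w y * φ y := by
    intro y hy
    refine mul_le_mul' (ENNReal.ofReal_le_ofReal ?_) (hm y hy)
    have h1 : ‖circlePt y - w‖ ≤ 8 * (1 / 2) ^ l :=
      norm_circlePt_sub_le_of_mem_box (by rw [show cell l y = cell l x from hy]; exact hw)
    have h0 : 0 < ‖circlePt y - w‖ := norm_pos_iff.2 (circlePt_sub_ne_zero (box_subset_ball hw) y)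
    have h2 : (1 / 2 : ℝ) ^ (l + κ) ≤ 1 - ‖w‖ ^ 2 := by
      have : ‖w‖ < 1 := by simpa using box_subset_ball hw
      nlinarith [norm_nonneg w]
    unfold pk
    calc (1 / 2 : ℝ) ^ κ / 64 / (2 * Real.pi * (1 / 2) ^ l)
        = (1 / 2) ^ (l + κ) / (8 * (1 / 2) ^ l) ^ 2 / (2 * Real.pi) := by
          rw [pow_add, mul_pow]
          have : (0 : ℝ) < (1 / 2) ^ l := by positivity
          field_simp
          norm_num
      _ ≤ _ := by
          have : (0 : ℝ) ≤ 1 - ‖w‖ ^ 2 := le_trans (by positivity) h2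
          gcongr
  calc (1 / 2) ^ κ / 64 * m
      = ∫⁻ _ in {y | cell l y = cell l x},
          ENNReal.ofReal ((1 / 2) ^ κ / 64 / (2 * Real.pi * (1 / 2) ^ l)) * m ∂cm := by
        rw [lintegral_const, Measure.restrict_apply_univ, cm_cell hx, mul_right_comm,
          ← ENNReal.ofReal_mul (by positivity), div_mul_cancel₀ _ (by positivity),
          ENNReal.ofReal_div_of_pos (by norm_num), ENNReal.ofReal_pow (by norm_num)]
        congr 3
        · rw [ENNReal.ofReal_div_of_pos (by norm_num)]; simp
        · simp
    _ ≤ ∫⁻ y in {y | cell l y = cell l x}, pke w y * φ y ∂cm :=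
        setLIntegral_mono' (measurableSet_cell _ _) key
    _ ≤ _ := setLIntegral_le_lintegral _ _

lemma lintegral_mul_le_sqrt {α : Type*} [MeasurableSpace α] (μ : Measure α) {f g : α → ℝ≥0∞}
    (hf : AEMeasurable f μ) (hg : AEMeasurable g μ) :
    ∫⁻ x, f x * g x ∂μ ≤ (∫⁻ x, f x ^ 2 ∂μ) ^ (1 / 2 : ℝ) * (∫⁻ x, g x ^ 2 ∂μ) ^ (1 / 2 : ℝ) := by
  have := ENNReal.lintegral_mul_le_Lp_mul_Lq μ (p := 2) (q := 2)
    (Real.HolderConjugate.two_two) hf hg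
  simpa only [Pi.mul_apply, ENNReal.rpow_two] using this

lemma sq_lintegral_mul_le {α : Type*} [MeasurableSpace α] (μ : Measure α) {f g : α → ℝ≥0∞}
    (hf : AEMeasurable f μ) (hg : AEMeasurable g μ) :
    (∫⁻ x, f x * g x ∂μ) ^ 2 ≤ (∫⁻ x, f x ^ 2 ∂μ) * ∫⁻ x, g x ^ 2 ∂μ := by
  calc (∫⁻ x, f x * g x ∂μ) ^ 2
      ≤ ((∫⁻ x, f x ^ 2 ∂μ) ^ (1 / 2 : ℝ) * (∫⁻ x, g x ^ 2 ∂μ) ^ (1 / 2 : ℝ)) ^ 2 := by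
        gcongr; exact lintegral_mul_le_sqrt μ hf hg
    _ = _ := by
        rw [mul_pow, ← ENNReal.rpow_two, ← ENNReal.rpow_two, ← ENNReal.rpow_mul,
          ← ENNReal.rpow_mul]; norm_num

section kernel
variable {α : Type*} [MeasurableSpace α] {μ : Measure α} [IsFiniteMeasure μ]
  {k : α → α → ℝ≥0∞} {C : ℝ≥0∞}

lemma kernel_improve (hk : Measurable (Function.uncurry k))
    (hC : ∀ x x', ∫⁻ y, k x y * k x' y ∂μ ≤ C * (k x x' + k x' x)) {K : ℝ≥0∞}
    (hK : K ≠ ∞) (hval : ∀ φ : α → ℝ≥0∞, Measurable φ →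
      ∫⁻ x, (∫⁻ y, k x y * φ y ∂μ) ^ 2 ∂μ ≤ K * ∫⁻ x, φ x ^ 2 ∂μ)
    {φ : α → ℝ≥0∞} (hφ : Measurable φ) (hI : ∫⁻ x, φ x ^ 2 ∂μ ≠ ∞) :
    (∫⁻ x, (∫⁻ y, k x y * φ y ∂μ) ^ 2 ∂μ) ^ 2 ≤ 4 * C ^ 2 * K * (∫⁻ x, φ x ^ 2 ∂μ) ^ 2 := by
  have hA : ∀ φ : α → ℝ≥0∞, Measurable φ → Measurable fun x => ∫⁻ y, k x y * φ y ∂μ := by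
    intro φ hφ
    exact (hk.fun_mul (hφ.comp measurable_snd)).lintegral_prod_right
  set ψ := fun x => ∫⁻ y, k x y * φ y ∂μ with hψ
  have hψm : Measurable ψ := hA φ hφ
  set a := ∫⁻ x, ψ x ^ 2 ∂μ with ha
  set I := ∫⁻ x, φ x ^ 2 ∂μ with hIdef
  have ha_fin : a ≠ ∞ := ne_top_of_le_ne_top (ENNReal.mul_ne_top hK hI) (hval φ hφ)
  set θ := fun y => ∫⁻ x, k x y * ψ x ∂μ with hθ
  have hθm : Measurable θ := ((hk.comp measurable_swap).fun_mul (hψm.comp measurable_snd)).lintegral_prod_right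
  have h1 : a = ∫⁻ y, φ y * θ y ∂μ := by
    calc a = ∫⁻ x, ∫⁻ y, k x y * φ y * ψ x ∂μ ∂μ := by
          refine lintegral_congr fun x => ?_
          rw [lintegral_mul_const _ ((hk.of_uncurry_left).fun_mul hφ), sq]
      _ = ∫⁻ y, ∫⁻ x, k x y * φ y * ψ x ∂μ ∂μ := lintegral_lintegral_swap
          ((hk.fun_mul (hφ.comp measurable_snd)).fun_mul (hψm.comp measurable_fst)).aemeasurable
      _ = _ := by
          refine lintegral_congr fun y => ?_
          rw [← lintegral_const_mul _ ((hk.of_uncurry_right).fun_mul hψm)]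
          refine lintegral_congr fun x => ?_
          ring
  have h2 : ∫⁻ y, θ y ^ 2 ∂μ ≤ 2 * C * ∫⁻ x, ψ x * (∫⁻ y, k x y * ψ y ∂μ) ∂μ := by
    have e1 : ∀ y, θ y ^ 2 = ∫⁻ x, ∫⁻ x', k x y * ψ x * (k x' y * ψ x') ∂μ ∂μ := by
      intro y
      rw [sq, hθ]
      dsimp only
      rw [← lintegral_mul_const _ ((hk.of_uncurry_right).fun_mul hψm)]
      refine lintegral_congr fun x => ?_
      rw [← lintegral_const_mul _ ((hk.of_uncurry_right).fun_mul hψm)]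
    have m3 : Measurable fun p : (α × α) × α => k p.1.2 p.1.1 * ψ p.1.2 * (k p.2 p.1.1 * ψ p.2) := by
      have q1 : Measurable fun p : (α × α) × α => k p.1.2 p.1.1 :=
        hk.comp (measurable_fst.snd.prodMk measurable_fst.fst)
      have q2 : Measurable fun p : (α × α) × α => k p.2 p.1.1 :=
        hk.comp (measurable_snd.prodMk measurable_fst.fst)
      have q3 : Measurable fun p : (α × α) × α => ψ p.1.2 := hψm.comp measurable_fst.snd
      have q4 : Measurable fun p : (α × α) × α => ψ p.2 := hψm.comp measurable_snd
      exact (q1.fun_mul q3).fun_mul (q2.fun_mul q4)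
    calc ∫⁻ y, θ y ^ 2 ∂μ = ∫⁻ y, ∫⁻ x, ∫⁻ x', k x y * ψ x * (k x' y * ψ x') ∂μ ∂μ ∂μ :=
          lintegral_congr e1
      _ = ∫⁻ x, ∫⁻ y, ∫⁻ x', k x y * ψ x * (k x' y * ψ x') ∂μ ∂μ ∂μ :=
          lintegral_lintegral_swap m3.lintegral_prod_right.aemeasurable
      _ = ∫⁻ x, ∫⁻ x', ∫⁻ y, k x y * ψ x * (k x' y * ψ x') ∂μ ∂μ ∂μ := by
          refine lintegral_congr fun x => lintegral_lintegral_swap ?_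
          exact (m3.comp ((measurable_fst.prodMk measurable_const).prodMk measurable_snd)).aemeasurable
      _ ≤ ∫⁻ x, ∫⁻ x', C * (ψ x * (k x x' * ψ x') + ψ x' * (k x' x * ψ x)) ∂μ ∂μ := by
          refine lintegral_mono fun x => lintegral_mono fun x' => ?_
          have : ∀ y, k x y * ψ x * (k x' y * ψ x') = (ψ x * ψ x') * (k x y * k x' y) :=
            fun y => by ring
          simp_rw [this]
          rw [lintegral_const_mul _ ((hk.of_uncurry_left).fun_mul (hk.of_uncurry_left))]
          refine (mul_le_mul_right (hC x x') _).trans_eq ?_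
          ring
      _ = C * (∫⁻ x, ∫⁻ x', ψ x * (k x x' * ψ x') ∂μ ∂μ
            + ∫⁻ x, ∫⁻ x', ψ x' * (k x' x * ψ x) ∂μ ∂μ) := by
          have n1 : Measurable fun p : α × α => ψ p.1 * (k p.1 p.2 * ψ p.2) :=
            (hψm.comp measurable_fst).fun_mul (hk.fun_mul (hψm.comp measurable_snd))
          have n2 : Measurable fun p : α × α => ψ p.2 * (k p.2 p.1 * ψ p.1) :=
            n1.comp measurable_swap
          rw [← lintegral_add_left n1.lintegral_prod_right]
          rw [← lintegral_const_mul _ (n1.lintegral_prod_right.fun_add n2.lintegral_prod_right)]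
          refine lintegral_congr fun x => ?_
          have n3 : Measurable fun x' => ψ x * (k x x' * ψ x') := n1.of_uncurry_left (x := x) (f := fun a b => ψ a * (k a b * ψ b))
          have n4 : Measurable fun x' => ψ x' * (k x' x * ψ x) := n2.of_uncurry_left (x := x) (f := fun a b => ψ b * (k b a * ψ a))
          rw [← lintegral_add_left n3, ← lintegral_const_mul _ (n3.fun_add n4)]
      _ = 2 * C * ∫⁻ x, ψ x * (∫⁻ y, k x y * ψ y ∂μ) ∂μ := by
          have n1 : Measurable fun p : α × α => ψ p.2 * (k p.2 p.1 * ψ p.1) :=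
            (hψm.comp measurable_snd).fun_mul ((hk.comp measurable_swap).fun_mul (hψm.comp measurable_fst))
          rw [lintegral_lintegral_swap (f := fun x x' => ψ x' * (k x' x * ψ x)) n1.aemeasurable]
          rw [← two_mul, ← mul_assoc, mul_comm C 2]
          congr 1
          refine lintegral_congr fun x => ?_
          rw [← lintegral_const_mul _ ((hk.of_uncurry_left).fun_mul hψm)]
  have h3 : (∫⁻ y, θ y ^ 2 ∂μ) ^ 2 ≤ 4 * C ^ 2 * K * a ^ 2 := by
    calc (∫⁻ y, θ y ^ 2 ∂μ) ^ 2
        ≤ (2 * C * ∫⁻ x, ψ x * (∫⁻ y, k x y * ψ y ∂μ) ∂μ) ^ 2 := by gcongr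
      _ = 4 * C ^ 2 * (∫⁻ x, ψ x * (∫⁻ y, k x y * ψ y ∂μ) ∂μ) ^ 2 := by ring
      _ ≤ 4 * C ^ 2 * (a * ∫⁻ x, (∫⁻ y, k x y * ψ y ∂μ) ^ 2 ∂μ) := by
          gcongr; exact sq_lintegral_mul_le μ hψm.aemeasurable (hA ψ hψm).aemeasurable
      _ ≤ 4 * C ^ 2 * (a * (K * a)) := by gcongr; exact hval ψ hψm
      _ = _ := by ring
  rcases eq_or_ne a 0 with h0 | h0
  · rw [h0]; simp
  · have h4 : a ^ 2 * a ^ 2 ≤ 4 * C ^ 2 * K * I ^ 2 * a ^ 2 := by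
      calc a ^ 2 * a ^ 2 = ((∫⁻ y, φ y * θ y ∂μ) ^ 2) ^ 2 := by rw [← h1]; ring
        _ ≤ (I * ∫⁻ y, θ y ^ 2 ∂μ) ^ 2 := by
            gcongr; exact sq_lintegral_mul_le μ hφ.aemeasurable hθm.aemeasurable
        _ = I ^ 2 * (∫⁻ y, θ y ^ 2 ∂μ) ^ 2 := by ring
        _ ≤ I ^ 2 * (4 * C ^ 2 * K * a ^ 2) := by gcongr
        _ = _ := by ring
    exact (ENNReal.mul_le_mul_iff_left (pow_ne_zero 2 h0) (ENNReal.pow_ne_top ha_fin)).1 h4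

lemma kernel_bound (hk : Measurable (Function.uncurry k)) (hC0 : C ≠ 0)
    (hC : ∀ x x', ∫⁻ y, k x y * k x' y ∂μ ≤ C * (k x x' + k x' x)) {B : ℝ≥0∞}
    (hB : B ≠ ∞) (hkB : ∀ x y, k x y ≤ B) {φ : α → ℝ≥0∞} (hφ : Measurable φ) :
    ∫⁻ x, (∫⁻ y, k x y * φ y ∂μ) ^ 2 ∂μ ≤ 4 * C ^ 2 * ∫⁻ x, φ x ^ 2 ∂μ := by
  set V : Set ℝ≥0∞ := {K | ∀ φ : α → ℝ≥0∞, Measurable φ →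
      ∫⁻ x, (∫⁻ y, k x y * φ y ∂μ) ^ 2 ∂μ ≤ K * ∫⁻ x, φ x ^ 2 ∂μ} with hV
  have hK0 : B ^ 2 * μ univ ^ 2 ∈ V := by
    intro φ hφ
    calc ∫⁻ x, (∫⁻ y, k x y * φ y ∂μ) ^ 2 ∂μ
        ≤ ∫⁻ x, (B ^ 2 * μ univ * ∫⁻ y, φ y ^ 2 ∂μ) ∂μ := by
          refine lintegral_mono fun x => ?_
          refine (sq_lintegral_mul_le μ (hk.of_uncurry_left).aemeasurable hφ.aemeasurable).trans ?_
          gcongr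
          calc ∫⁻ y, k x y ^ 2 ∂μ ≤ ∫⁻ _, B ^ 2 ∂μ := by
                refine lintegral_mono fun y => ?_
                have := hkB x y
                gcongr
            _ = _ := by simp
      _ = _ := by rw [lintegral_const]; ring
  have hval : sInf V ∈ V := by
    intro φ hφ
    rcases eq_or_ne (∫⁻ x, φ x ^ 2 ∂μ) 0 with h0 | h0
    · have := hK0 φ hφ
      rw [h0, mul_zero] at this ⊢
      exact this
    rcases eq_or_ne (∫⁻ x, φ x ^ 2 ∂μ) ∞ with h1 | h1
    · rcases eq_or_ne (sInf V) 0 with h2 | h2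
      · rw [h2, zero_mul]
        have mono : ∫⁻ x, (∫⁻ y, k x y * φ y ∂μ) ^ 2 ∂μ
            = ⨆ n : ℕ, ∫⁻ x, (∫⁻ y, k x y * min (φ y) n ∂μ) ^ 2 ∂μ := by
          rw [← lintegral_iSup]
          · refine lintegral_congr fun x => ?_
            have e : ∫⁻ y, k x y * φ y ∂μ = ⨆ n : ℕ, ∫⁻ y, k x y * min (φ y) n ∂μ := by
              rw [← lintegral_iSup]
              · refine lintegral_congr fun y => ?_
                rw [← ENNReal.mul_iSup]
                congr 1
                change φ y = ⨆ n : ℕ, φ y ⊓ (n : ℝ≥0∞)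
                rw [← inf_iSup_eq, ENNReal.iSup_natCast, inf_top_eq]
              · intro n; exact (hk.of_uncurry_left).fun_mul (hφ.min measurable_const)
              · intro n m h y; dsimp only; gcongr
            rw [e]
            exact (Monotone.map_iSup_of_continuousAt (f := fun t : ℝ≥0∞ => t ^ 2)
              (ENNReal.continuous_pow 2).continuousAt (fun a b h => by dsimp only; gcongr) (by simp))
          · intro n
            exact ((hk.fun_mul ((hφ.min measurable_const).comp measurable_snd)).lintegral_prod_right).pow_const 2
          · intro n m h x; dsimp only; gcongr
        rw [mono, nonpos_iff_eq_zero, iSup_eq_zero]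
        intro n
        have hfin : ∫⁻ x, (min (φ x) n) ^ 2 ∂μ ≠ ∞ := by
          refine ne_top_of_le_ne_top (b := ∫⁻ _, (n : ℝ≥0∞) ^ 2 ∂μ) ?_ ?_
          · rw [lintegral_const]; exact ENNReal.mul_ne_top (by simp) (measure_ne_top _ _)
          · refine lintegral_mono fun x => ?_
            have := min_le_right (φ x) n
            gcongr
        by_contra hne
        have hpos : 0 < (∫⁻ x, (∫⁻ y, k x y * min (φ y) n ∂μ) ^ 2 ∂μ) / ∫⁻ x, (min (φ x) n) ^ 2 ∂μ :=
          ENNReal.div_pos hne hfin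
        have : (∫⁻ x, (∫⁻ y, k x y * min (φ y) n ∂μ) ^ 2 ∂μ) / ∫⁻ x, (min (φ x) n) ^ 2 ∂μ ≤ sInf V :=
          le_sInf fun K hK => ENNReal.div_le_of_le_mul (hK _ (hφ.min measurable_const))
        rw [h2] at this
        exact absurd this (not_le.2 hpos)
      · rw [h1, ENNReal.mul_top h2]; exact le_top
    · have : (∫⁻ x, (∫⁻ y, k x y * φ y ∂μ) ^ 2 ∂μ) / (∫⁻ x, φ x ^ 2 ∂μ) ≤ sInf V :=
        le_sInf fun K hK => ENNReal.div_le_of_le_mul (hK φ hφ)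
      rwa [ENNReal.div_le_iff h0 h1] at this
  have hKt : sInf V ≠ ∞ := ne_top_of_le_ne_top
    (ENNReal.mul_ne_top (ENNReal.pow_ne_top hB) (ENNReal.pow_ne_top (measure_ne_top _ _))) (sInf_le hK0)
  rcases eq_or_ne (∫⁻ x, φ x ^ 2 ∂μ) ∞ with h1 | h1
  · rw [h1, ENNReal.mul_top (by simpa using hC0)]; exact le_top
  have hroot : (4 * C ^ 2 * sInf V) ^ (1 / 2 : ℝ) ∈ V := by
    intro φ hφ
    rcases eq_or_ne (∫⁻ x, φ x ^ 2 ∂μ) ∞ with h1 | h1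
    · rcases eq_or_ne (sInf V) 0 with h2 | h2
      · refine (hval φ hφ).trans ?_
        rw [h2]; simp
      · rw [h1, ENNReal.mul_top]; · exact le_top
        have : 4 * C ^ 2 * sInf V ≠ 0 := by
          simp [h2, hC0]
        simp only [ne_eq, ENNReal.rpow_eq_zero_iff]
        simp [this]
    · have := kernel_improve hk hC hKt hval hφ h1
      calc ∫⁻ x, (∫⁻ y, k x y * φ y ∂μ) ^ 2 ∂μ
          = ((∫⁻ x, (∫⁻ y, k x y * φ y ∂μ) ^ 2 ∂μ) ^ 2) ^ (1 / 2 : ℝ) := by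
            rw [← ENNReal.rpow_two, ← ENNReal.rpow_mul]; norm_num
        _ ≤ (4 * C ^ 2 * sInf V * (∫⁻ x, φ x ^ 2 ∂μ) ^ 2) ^ (1 / 2 : ℝ) := by gcongr
        _ = _ := by
            rw [ENNReal.mul_rpow_of_nonneg _ _ (by norm_num)]
            rw [← ENNReal.rpow_two (∫⁻ x, φ x ^ 2 ∂μ), ← ENNReal.rpow_mul]; norm_num
  have hle : sInf V ≤ 4 * C ^ 2 := by
    have h2 := sInf_le hroot
    rcases eq_or_ne (sInf V) 0 with h0 | h0
    · rw [h0]; exact zero_le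
    · have h3 : sInf V * sInf V ≤ 4 * C ^ 2 * sInf V := by
        calc sInf V * sInf V = (sInf V) ^ (2 : ℝ) := by rw [ENNReal.rpow_two, sq]
          _ ≤ ((4 * C ^ 2 * sInf V) ^ (1 / 2 : ℝ)) ^ (2 : ℝ) := by gcongr
          _ = _ := by rw [← ENNReal.rpow_mul]; norm_num
      exact (ENNReal.mul_le_mul_iff_left h0 hKt).1 h3
  exact (hval φ hφ).trans (by gcongr)

end kernel

lemma pk_mul_pk_le {l m : ℕ} (h : l ≤ m) (x x' y : ℝ) :
    pk (ctr l x) y * pk (ctr m x') y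
      ≤ pk (ctr l x) x' * (8 * pk (ctr l x) y + 2 * pk (ctr m x') y) := by
  have hpi := Real.pi_pos
  have ha := ctr_mem_ball l x
  have hb := ctr_mem_ball m x'
  have hna := norm_ctr l x
  have hnb := norm_ctr m x'
  have hpow : ((1 : ℝ) / 2) ^ m ≤ (1 / 2) ^ l :=
    pow_le_pow_of_le_one (by norm_num) (by norm_num) h
  have hpow1 : ((1 : ℝ) / 2) ^ l ≤ 1 := pow_le_one₀ (by norm_num) (by norm_num)
  have hpow0 : (0 : ℝ) < (1 / 2) ^ m := by positivity
  set a := ctr l x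
  set b := ctr m x'
  have da : 0 < ‖circlePt y - a‖ := norm_pos_iff.2 (circlePt_sub_ne_zero ha y)
  have db : 0 < ‖circlePt y - b‖ := norm_pos_iff.2 (circlePt_sub_ne_zero hb y)
  have dx : 0 < ‖circlePt x' - a‖ := norm_pos_iff.2 (circlePt_sub_ne_zero ha x')
  have hxb : ‖circlePt x' - b‖ ≤ ‖circlePt y - b‖ := by
    refine le_trans (le_of_eq ?_) (one_sub_le_norm_circlePt_sub b y)
    have e : circlePt x' - b = ((1 / 2) ^ m : ℝ) * circlePt x' := by
      simp only [b, ctr]; push_cast; ring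
    rw [e, norm_mul, norm_circlePt, mul_one, Complex.norm_real, Real.norm_of_nonneg hpow0.le, hnb]
    ring
  have key : ‖circlePt x' - a‖ ^ 2 ≤ 8 * ‖circlePt y - b‖ ^ 2 + 2 * ‖circlePt y - a‖ ^ 2 := by
    have h1 : ‖circlePt x' - a‖ ≤ ‖circlePt x' - b‖ + ‖circlePt y - b‖ + ‖circlePt y - a‖ := by
      have e : circlePt x' - a = (circlePt x' - b) - (circlePt y - b) + (circlePt y - a) := by ring
      rw [e]
      refine (norm_add_le _ _).trans ?_
      gcongr
      exact norm_sub_le _ _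
    have h2 : ‖circlePt x' - a‖ ≤ 2 * ‖circlePt y - b‖ + ‖circlePt y - a‖ := by linarith
    calc ‖circlePt x' - a‖ ^ 2 ≤ (2 * ‖circlePt y - b‖ + ‖circlePt y - a‖) ^ 2 := by gcongr
      _ ≤ _ := by nlinarith [sq_nonneg (2 * ‖circlePt y - b‖ - ‖circlePt y - a‖)]
  have hA : 0 ≤ 1 - ‖a‖ ^ 2 := by rw [hna]; nlinarith
  have hB : 0 ≤ 1 - ‖b‖ ^ 2 := by rw [hnb]; nlinarith
  have hAB : 1 - ‖b‖ ^ 2 ≤ 1 - ‖a‖ ^ 2 := by rw [hna, hnb]; nlinarith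
  unfold pk
  set A := 1 - ‖a‖ ^ 2
  set B := 1 - ‖b‖ ^ 2
  set u := ‖circlePt y - a‖
  set v := ‖circlePt y - b‖
  set d := ‖circlePt x' - a‖
  have e1 : A / u ^ 2 / (2 * Real.pi) * (B / v ^ 2 / (2 * Real.pi))
      = A * B * d ^ 2 / (u ^ 2 * v ^ 2 * d ^ 2 * (2 * Real.pi) ^ 2) := by
    field_simp
  have e2 : A / d ^ 2 / (2 * Real.pi) * (8 * (A / u ^ 2 / (2 * Real.pi)) +
      2 * (B / v ^ 2 / (2 * Real.pi))) =
      A * (8 * A * v ^ 2 + 2 * B * u ^ 2) / (u ^ 2 * v ^ 2 * d ^ 2 * (2 * Real.pi) ^ 2) := by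
    field_simp
  rw [e1, e2, mul_assoc]
  gcongr
  calc B * d ^ 2 ≤ B * (8 * v ^ 2 + 2 * u ^ 2) := by gcongr
    _ = 8 * B * v ^ 2 + 2 * B * u ^ 2 := by ring
    _ ≤ _ := by gcongr

lemma lintegral_pke_mul_pke_le {l m : ℕ} (h : l ≤ m) (x x' : ℝ) :
    ∫⁻ y, pke (ctr l x) y * pke (ctr m x') y ∂cm ≤ 10 * pke (ctr l x) x' := by
  have ha := ctr_mem_ball l x
  have hb := ctr_mem_ball m x'
  calc ∫⁻ y, pke (ctr l x) y * pke (ctr m x') y ∂cm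
      ≤ ∫⁻ y, pke (ctr l x) x' * (8 * pke (ctr l x) y + 2 * pke (ctr m x') y) ∂cm := by
        refine lintegral_mono fun y => ?_
        have h8 : (8 : ℝ≥0∞) = ENNReal.ofReal 8 := by simp
        have h2 : (2 : ℝ≥0∞) = ENNReal.ofReal 2 := by simp
        unfold pke
        rw [h8, h2, ← ENNReal.ofReal_mul (pk_nonneg ha _), ← ENNReal.ofReal_mul (by norm_num),
          ← ENNReal.ofReal_mul (by norm_num), ← ENNReal.ofReal_add
            (mul_nonneg (by norm_num) (pk_nonneg ha _)) (mul_nonneg (by norm_num) (pk_nonneg hb _)),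
          ← ENNReal.ofReal_mul (pk_nonneg ha _)]
        exact ENNReal.ofReal_le_ofReal (pk_mul_pk_le h x x' y)
    _ = _ := by
        rw [lintegral_const_mul _ (((measurable_pke_left _).const_mul _).fun_add
            ((measurable_pke_left _).const_mul _)),
          lintegral_add_left ((measurable_pke_left _).const_mul _),
          lintegral_const_mul _ (measurable_pke_left _),
          lintegral_const_mul _ (measurable_pke_left _), lintegral_pke ha, lintegral_pke hb]
        ring_nf

lemma exists_measurable_argmax {α : Type*} [MeasurableSpace α] (a : ℕ → α → ℝ≥0∞)
    (ha : ∀ l, Measurable (a l)) (L : ℕ) :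
    ∃ s : α → ℕ, Measurable s ∧ (∀ x, s x ≤ L) ∧ ∀ x, ∀ l ≤ L, a l x ≤ a (s x) x := by
  induction L with
  | zero => exact ⟨fun _ => 0, measurable_const, fun _ => le_rfl, fun x l hl => by
      rw [Nat.le_zero.1 hl]⟩
  | succ L ih =>
    obtain ⟨s, h1, h2, h3⟩ := ih
    have hm : Measurable fun x => a (s x) x :=
      (measurable_from_prod_countable_right (f := fun z : ℕ × α => a z.1 z.2) ha).comp
        (h1.prodMk measurable_id)
    classical
    refine ⟨fun x => if a (s x) x < a (L + 1) x then L + 1 else s x,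
      Measurable.ite (measurableSet_lt hm (ha _)) measurable_const h1, fun x => ?_,
      fun x l hl => ?_⟩
    · dsimp only; split_ifs
      · exact le_rfl
      · exact (h2 x).trans (Nat.le_succ L)
    · dsimp only; split_ifs with h
      · rcases Nat.le_succ_iff.1 hl with hl | rfl
        · exact (h3 x l hl).trans h.le
        · exact le_rfl
      · rcases Nat.le_succ_iff.1 hl with hl | rfl
        · exact h3 x l hl
        · exact not_lt.1 h

lemma pke_ctr_le {l L : ℕ} (h : l ≤ L) (x y : ℝ) :
    pke (ctr l x) y ≤ ENNReal.ofReal (2 ^ (2 * L)) := by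
  refine ENNReal.ofReal_le_ofReal ?_
  have h1 := one_sub_le_norm_circlePt_sub (ctr l x) y
  rw [norm_ctr] at h1
  have h2 : ((1 : ℝ) / 2) ^ L ≤ (1 / 2) ^ l := pow_le_pow_of_le_one (by norm_num) (by norm_num) h
  have h3 : (0 : ℝ) < (1 / 2) ^ L := by positivity
  have hpi := Real.pi_gt_three
  have h5 : (0 : ℝ) ≤ ‖ctr l x‖ ^ 2 := by positivity
  unfold pk
  calc (1 - ‖ctr l x‖ ^ 2) / ‖circlePt y - ctr l x‖ ^ 2 / (2 * Real.pi)
      ≤ 1 / ((1 / 2) ^ L) ^ 2 / 1 := by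
        gcongr
        · linarith
        · linarith
        · linarith
    _ = 2 ^ (2 * L) := by
        rw [← pow_mul, mul_comm]; simp

/-- The radial dyadic maximal function of Poisson means. -/
noncomputable def pmax (φ : ℝ → ℝ≥0∞) (x : ℝ) : ℝ≥0∞ :=
  ⨆ l : ℕ, ∫⁻ y, pke (ctr l x) y * φ y ∂cm

section Maximal

attribute [local irreducible] pke ctr

lemma measurable_pke_ctr (l : ℕ) : Measurable fun z : ℝ × ℝ => pke (ctr l z.1) z.2 := by
  have h : Measurable fun z : ℝ × ℝ => (ctr l z.1, z.2) :=
    ((continuous_ctr l).measurable.comp measurable_fst).prodMk measurable_snd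
  exact Measurable.fun_comp (g := fun z : ℂ × ℝ => pke z.1 z.2) measurable_pke h

lemma measurable_pmean {φ : ℝ → ℝ≥0∞} (hφ : Measurable φ) (l : ℕ) :
    Measurable fun x => ∫⁻ y, pke (ctr l x) y * φ y ∂cm :=
  ((measurable_pke_ctr l).fun_mul (hφ.comp measurable_snd)).lintegral_prod_right

lemma measurable_pmax {φ : ℝ → ℝ≥0∞} (hφ : Measurable φ) : Measurable (pmax φ) :=
  Measurable.iSup (measurable_pmean hφ)

/-- The dyadic Poisson maximal function is bounded on `L²`. -/
lemma lintegral_pmax_sq_le {φ : ℝ → ℝ≥0∞} (hφ : Measurable φ) :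
    ∫⁻ x, pmax φ x ^ 2 ∂cm ≤ 400 * ∫⁻ x, φ x ^ 2 ∂cm := by
  set a : ℕ → ℝ → ℝ≥0∞ := fun l x => ∫⁻ y, pke (ctr l x) y * φ y ∂cm with ha
  have ham : ∀ l, Measurable (a l) := measurable_pmean hφ
  have step : ∀ L : ℕ, ∫⁻ x, (⨆ l ≤ L, a l x) ^ 2 ∂cm ≤ 400 * ∫⁻ x, φ x ^ 2 ∂cm := by
    intro L
    obtain ⟨s, h1, h2, h3⟩ := exists_measurable_argmax a ham L
    set k : ℝ → ℝ → ℝ≥0∞ := fun x y => pke (ctr (s x) x) y with hk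
    have hkm : Measurable (Function.uncurry k) := by
      have h4 : Measurable fun z : ℕ × (ℝ × ℝ) => pke (ctr z.1 z.2.1) z.2.2 :=
        measurable_from_prod_countable_right measurable_pke_ctr
      have h5 : Measurable fun z : ℝ × ℝ => (s z.1, z) :=
        (h1.comp measurable_fst).prodMk measurable_id
      exact Measurable.fun_comp (g := fun z : ℕ × (ℝ × ℝ) => pke (ctr z.1 z.2.1) z.2.2) h4 h5
    have hC : ∀ x x', ∫⁻ y, k x y * k x' y ∂cm ≤ 10 * (k x x' + k x' x) := by
      intro x x'
      rcases le_total (s x) (s x') with h | h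
      · refine (lintegral_pke_mul_pke_le h x x').trans ?_
        gcongr
        exact le_self_add
      · simp_rw [mul_comm (k x _)]
        refine (lintegral_pke_mul_pke_le h x' x).trans ?_
        gcongr
        exact le_add_self
    have hb := kernel_bound (μ := cm) hkm (C := 10) (by norm_num) hC
      (B := ENNReal.ofReal (2 ^ (2 * L))) ENNReal.ofReal_ne_top
      (fun x y => pke_ctr_le (h2 x) x y) hφ
    have e : (4 : ℝ≥0∞) * 10 ^ 2 = 400 := by norm_num
    rw [e] at hb
    refine le_trans (lintegral_mono fun x => ?_) hb
    dsimp only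
    gcongr
    exact iSup₂_le (h3 x)
  have mono : ∫⁻ x, pmax φ x ^ 2 ∂cm = ⨆ L : ℕ, ∫⁻ x, (⨆ l ≤ L, a l x) ^ 2 ∂cm := by
    rw [← lintegral_iSup]
    · refine lintegral_congr fun x => ?_
      have e : pmax φ x = ⨆ L : ℕ, ⨆ l ≤ L, a l x := by
        refine le_antisymm (iSup_le fun l => ?_) (iSup_le fun L => iSup₂_le fun l _ => ?_)
        · exact le_iSup_of_le l (le_iSup₂_of_le l le_rfl le_rfl)
        · exact le_iSup (fun l => a l x) l
      rw [e]
      exact Monotone.map_iSup_of_continuousAt (f := fun t : ℝ≥0∞ => t ^ 2)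
        (ENNReal.continuous_pow 2).continuousAt (fun a b h => by dsimp only; gcongr) (by simp)
    · intro L
      exact (Measurable.iSup fun l => Measurable.iSup fun _ => ham l).pow_const 2
    · intro L M h x
      have : (⨆ l ≤ L, a l x) ≤ ⨆ l ≤ M, a l x :=
        iSup₂_le fun l hl => le_iSup₂_of_le l (hl.trans h) le_rfl
      exact pow_le_pow_left' this 2
  rw [mono]
  exact iSup_le step

end Maximal

lemma iteratedDeriv_dilate (j : ℕ) (F : ℂ → ℂ) (c : ℂ) :
    iteratedDeriv j (fun z => F (c * z)) = fun z => c ^ j * iteratedDeriv j F (c * z) := by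
  induction j with
  | zero => simp
  | succ j ih =>
    rw [iteratedDeriv_succ, ih]
    ext z
    rw [deriv_const_mul_field, deriv_comp_mul_left c (iteratedDeriv j F) z, iteratedDeriv_succ,
      smul_eq_mul, pow_succ, mul_assoc]

lemma differentiableOn_iteratedDeriv {F : ℂ → ℂ} {s : Set ℂ} (hs : IsOpen s)
    (h : DifferentiableOn ℂ F s) (j : ℕ) : DifferentiableOn ℂ (iteratedDeriv j F) s := by
  induction j with
  | zero => simpa
  | succ j ih => rw [iteratedDeriv_succ]; exact ih.deriv hs

lemma AN.iteratedDeriv {F : ℂ → ℂ} (h : AN F) (j : ℕ) : AN (iteratedDeriv j F) := by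
  obtain ⟨R, hR, hF⟩ := h
  exact ⟨R, hR, differentiableOn_iteratedDeriv isOpen_ball hF j⟩

lemma AN_dilate {F : ℂ → ℂ} (h : DifferentiableOn ℂ F (ball 0 1)) {ρ : ℝ} (h0 : 0 < ρ)
    (h1 : ρ < 1) : AN fun z => F (ρ * z) := by
  refine ⟨ρ⁻¹, (one_lt_inv₀ h0).2 h1, h.comp (by fun_prop) fun z hz => ?_⟩
  rw [mem_ball_zero_iff] at hz ⊢
  rw [norm_mul, Complex.norm_real, Real.norm_of_nonneg h0.le]
  calc ρ * ‖z‖ < ρ * ρ⁻¹ := by gcongr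
    _ = 1 := mul_inv_cancel₀ h0.ne'

/-- Harnack constant for Whitney boxes. -/
noncomputable def harn (κ : ℕ) : ℝ≥0∞ :=
  ENNReal.ofReal (2 * (1 + 9) * (1 + 9 * 2 ^ (κ + 1)) ^ 2)

lemma harn_ne_top (κ : ℕ) : harn κ ≠ ∞ := ENNReal.ofReal_ne_top

lemma pke_le_harn {κ l : ℕ} {x : ℝ} {z : ℂ} (h1 : ‖z - ctr l x‖ ≤ 9 * (1 / 2) ^ l)
    (h2 : (1 / 2 : ℝ) ^ (l + κ + 1) ≤ 1 - ‖z‖) (y : ℝ) :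
    pke z y ≤ harn κ * pke (ctr l x) y := by
  have h3 : (0 : ℝ) < (1 / 2) ^ (l + κ + 1) := by positivity
  refine pke_le_mul (by rw [mem_ball_zero_iff]; linarith) (ctr_mem_ball l x) ?_ ?_ (by norm_num)
    (by positivity) y
  · rw [norm_ctr]; linarith
  · rw [norm_ctr]
    calc 1 - (1 - (1 / 2 : ℝ) ^ l) = 2 ^ (κ + 1) * (1 / 2) ^ (l + κ + 1) := by
          rw [add_assoc, pow_add (1 / 2 : ℝ), mul_left_comm, ← mul_pow]; norm_num
      _ ≤ _ := by gcongr

lemma near_box {κ l : ℕ} {x : ℝ} {w z : ℂ} (hw : w ∈ box κ l (cell l x))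
    (hz : ‖z - w‖ ≤ (1 / 2 : ℝ) ^ (l + κ + 1)) :
    ‖z - ctr l x‖ ≤ 9 * (1 / 2) ^ l ∧ (1 / 2 : ℝ) ^ (l + κ + 1) ≤ 1 - ‖z‖ := by
  have h1 := norm_sub_ctr_le hw
  have h2 := (norm_of_mem_box hw).1
  have h3 : ((1 : ℝ) / 2) ^ (l + κ + 1) ≤ (1 / 2) ^ l :=
    pow_le_pow_of_le_one (by norm_num) (by norm_num) (by omega)
  constructor
  · calc ‖z - ctr l x‖ = ‖(z - w) + (w - ctr l x)‖ := by ring_nf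
      _ ≤ ‖z - w‖ + ‖w - ctr l x‖ := norm_add_le _ _
      _ ≤ _ := by linarith
  · have h4 : ‖z‖ ≤ ‖z - w‖ + ‖w‖ := by
      calc ‖z‖ = ‖(z - w) + w‖ := by ring_nf
        _ ≤ _ := norm_add_le _ _
    have h5 : ((1 : ℝ) / 2) ^ (l + κ) = 2 * (1 / 2) ^ (l + κ + 1) := by rw [pow_succ]; ring
    linarith

/-- The constant in the Cauchy estimates on Whitney boxes. -/
noncomputable def cauc (κ j : ℕ) : ℝ≥0∞ := ENNReal.ofReal (j.factorial * 2 ^ ((κ + 1) * j))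

lemma cauc_ne_top (κ j : ℕ) : cauc κ j ≠ ∞ := ENNReal.ofReal_ne_top

lemma cs_le_of_near {κ j : ℕ} {F : ℂ → ℂ} (hF : DifferentiableOn ℂ F (ball 0 1)) {l : ℕ} {x : ℝ}
    {K : ℝ≥0∞} (hK : ∀ z, ‖z - ctr l x‖ ≤ 9 * (1 / 2) ^ l →
      (1 / 2 : ℝ) ^ (l + κ + 1) ≤ 1 - ‖z‖ → ‖F z‖ₑ ≤ K) :
    cs κ j F l x ≤ cauc κ j * K := by
  rcases eq_or_ne K ∞ with rfl | hKt
  · rw [ENNReal.mul_top]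
    · exact le_top
    · rw [cauc, ne_eq, ENNReal.ofReal_eq_zero, not_le]; positivity
  refine iSup₂_le fun w hw => ?_
  set δ : ℝ := (1 / 2 : ℝ) ^ (l + κ + 1) with hδ
  have hδ0 : 0 < δ := by positivity
  have hsub : closedBall w δ ⊆ ball 0 1 := by
    intro z hz
    have := (near_box hw (mem_closedBall_iff_norm.1 hz)).2
    rw [mem_ball_zero_iff]; linarith
  have hc : DiffContOnCl ℂ F (ball w δ) :=
    ⟨hF.mono (ball_subset_closedBall.trans hsub), by
      rw [closure_ball _ hδ0.ne']; exact hF.continuousOn.mono hsub⟩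
  have := Complex.norm_iteratedDeriv_le_of_forall_mem_sphere_norm_le j hδ0 hc (C := K.toReal)
    fun z hz => by
      obtain ⟨h1, h2⟩ := near_box hw (mem_sphere_iff_norm.1 hz).le
      rw [← toReal_enorm]
      exact ENNReal.toReal_mono hKt (hK z h1 h2)
  have e : (1 / 2 : ℝ≥0∞) ^ (l * j) = ENNReal.ofReal ((1 / 2) ^ (l * j)) := by
    rw [ENNReal.ofReal_pow (by norm_num), ENNReal.ofReal_div_of_pos (by norm_num)]; simp
  rw [← ofReal_norm, e, ← ENNReal.ofReal_mul (norm_nonneg _), cauc, ← ENNReal.ofReal_toReal hKt,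
    ← ENNReal.ofReal_mul (by positivity)]
  refine ENNReal.ofReal_le_ofReal ?_
  calc ‖iteratedDeriv j F w‖ * (1 / 2) ^ (l * j)
      ≤ (j.factorial * K.toReal / δ ^ j) * (1 / 2) ^ (l * j) := by gcongr
    _ = _ := by
        rw [hδ, ← pow_mul, add_assoc, add_mul, pow_add]
        field_simp
        rw [mul_assoc, ← mul_pow]; norm_num

lemma cs_rpow_le {κ j : ℕ} {F : ℂ → ℂ} (hF : AN F) {e : ℝ} (he : 1 ≤ e) (l : ℕ) (x : ℝ) :
    cs κ j F l x ^ e ≤ cauc κ j ^ e * (harn κ * ∫⁻ y, pke (ctr l x) y * ‖F (circlePt y)‖ₑ ^ e ∂cm) := by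
  set I := harn κ * ∫⁻ y, pke (ctr l x) y * ‖F (circlePt y)‖ₑ ^ e ∂cm with hI
  have he0 : 0 < e := by linarith
  have h : cs κ j F l x ≤ cauc κ j * I ^ e⁻¹ := by
    refine cs_le_of_near hF.diffOn fun z h1 h2 => ?_
    have h3 : (0 : ℝ) < (1 / 2) ^ (l + κ + 1) := by positivity
    have hz : z ∈ ball (0 : ℂ) 1 := by rw [mem_ball_zero_iff]; linarith
    rw [ENNReal.le_rpow_inv_iff he0]
    refine (poisson_le hF hz he).trans ?_
    rw [hI, ← lintegral_const_mul' _ _ (harn_ne_top κ)]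
    refine lintegral_mono fun y => ?_
    rw [← mul_assoc]
    gcongr
    exact pke_le_harn h1 h2 y
  calc cs κ j F l x ^ e ≤ (cauc κ j * I ^ e⁻¹) ^ e := by gcongr
    _ = _ := by
      rw [ENNReal.mul_rpow_of_nonneg _ _ he0.le, ← ENNReal.rpow_mul, inv_mul_cancel₀ he0.ne',
        ENNReal.rpow_one]

/-- Nontangential maximal function estimate for `p ≥ 2`. -/
lemma lintegral_iSup_cs_le_of_AN (κ j : ℕ) {p : ℝ} (hp : 2 ≤ p) : ∃ C : ℝ≥0∞, C ≠ ∞ ∧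
    ∀ F, AN F → ∫⁻ x, (⨆ l, cs κ j F l x) ^ p ∂cm ≤ C * ∫⁻ y, ‖F (circlePt y)‖ₑ ^ p ∂cm := by
  refine ⟨(cauc κ j ^ (p / 2) * harn κ) ^ 2 * 400, ?_, fun F hF => ?_⟩
  · refine ENNReal.mul_ne_top (ENNReal.pow_ne_top (ENNReal.mul_ne_top ?_ (harn_ne_top κ)))
      (by norm_num)
    exact ENNReal.rpow_ne_top_of_nonneg (by linarith) (cauc_ne_top κ j)
  have hm : Measurable fun y => ‖F (circlePt y)‖ₑ ^ (p / 2) :=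
    hF.continuous_circle.enorm.measurable.pow_const _
  calc ∫⁻ x, (⨆ l, cs κ j F l x) ^ p ∂cm
      ≤ ∫⁻ x, (cauc κ j ^ (p / 2) * harn κ) ^ 2 *
          pmax (fun y => ‖F (circlePt y)‖ₑ ^ (p / 2)) x ^ 2 ∂cm := by
        refine lintegral_mono fun x => ?_
        have e : (⨆ l, cs κ j F l x) ^ p = ((⨆ l, cs κ j F l x) ^ (p / 2)) ^ 2 := by
          rw [← ENNReal.rpow_two, ← ENNReal.rpow_mul]; congr 1; ring
        rw [e, ← mul_pow]
        gcongr
        rw [← ENNReal.le_rpow_inv_iff (by linarith)]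
        refine iSup_le fun l => ?_
        rw [ENNReal.le_rpow_inv_iff (by linarith), mul_assoc]
        refine (cs_rpow_le hF (by linarith) l x).trans ?_
        gcongr
        exact le_iSup (fun l => ∫⁻ y, pke (ctr l x) y * ‖F (circlePt y)‖ₑ ^ (p / 2) ∂cm) l
    _ = (cauc κ j ^ (p / 2) * harn κ) ^ 2 *
          ∫⁻ x, pmax (fun y => ‖F (circlePt y)‖ₑ ^ (p / 2)) x ^ 2 ∂cm :=
        lintegral_const_mul _ ((measurable_pmax hm).pow_const 2)
    _ ≤ (cauc κ j ^ (p / 2) * harn κ) ^ 2 *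
          (400 * ∫⁻ y, (‖F (circlePt y)‖ₑ ^ (p / 2)) ^ 2 ∂cm) := by
        gcongr
        exact lintegral_pmax_sq_le hm
    _ = _ := by
        rw [mul_assoc]
        congr 3 with y
        rw [← ENNReal.rpow_two, ← ENNReal.rpow_mul]; congr 1; ring

/-- The lower limit of the integral means at the unit circle. -/
noncomputable def Hl (p : ℝ) (F : ℂ → ℂ) : ℝ≥0∞ :=
  liminf (fun ρ : ℝ => ∫⁻ y, ‖F (ρ * circlePt y)‖ₑ ^ p ∂cm) (𝓝[<] 1)

lemma cs_le_dilate {κ j l : ℕ} {F : ℂ → ℂ} {ρ : ℝ} (h0 : 1 - (1 / 2) ^ (l + κ + 1) ≤ ρ)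
    (h1 : ρ < 1) (x : ℝ) : cs κ j F l x ≤ 2 ^ j * cs (κ + 1) j (fun z => F (ρ * z)) l x := by
  have hp : ((1 : ℝ) / 2) ^ (l + κ) ≤ 1 := pow_le_one₀ (by norm_num) (by norm_num)
  have hp2 : ((1 : ℝ) / 2) ^ (l + κ + 1) = (1 / 2) ^ (l + κ) / 2 := by rw [pow_succ]; ring
  have hp3 : (0 : ℝ) < (1 / 2) ^ (l + κ) := by positivity
  have hp4 : ((1 : ℝ) / 2) ^ l ≤ 1 := pow_le_one₀ (by norm_num) (by norm_num)
  have hρ : 1 / 2 ≤ ρ := by linarith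
  have hρ0 : 0 < ρ := by linarith
  refine iSup₂_le fun w hw => ?_
  have hw2 : w / ρ ∈ box (κ + 1) l (cell l x) := by
    obtain ⟨r, φ, e1, e2, e3, rfl⟩ := hw
    refine ⟨r / ρ, φ, e1, ?_, ?_, by push_cast; ring⟩
    · have : r / ρ ≤ 1 - (1 / 2) ^ (l + κ + 1) := by
        rw [div_le_iff₀ hρ0]
        nlinarith
      rw [← add_assoc]; linarith
    · have : r ≤ r / ρ := by
        rw [le_div_iff₀ hρ0]; nlinarith
      linarith
  refine le_trans ?_ (mul_le_mul_right (le_cs hw2) _)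
  rw [iteratedDeriv_dilate]
  have hρc : (ρ : ℂ) ≠ 0 := by exact_mod_cast hρ0.ne'
  dsimp only
  rw [mul_div_cancel₀ _ hρc, enorm_mul, enorm_pow, ← mul_assoc, ← mul_assoc, ← mul_pow]
  gcongr
  have h3 : (1 : ℝ≥0∞) ≤ 2 * ‖(ρ : ℂ)‖ₑ := by
    rw [← ofReal_norm, Complex.norm_real, Real.norm_of_nonneg hρ0.le]
    have : (2 : ℝ≥0∞) = ENNReal.ofReal 2 := by simp
    rw [this, ← ENNReal.ofReal_mul (by norm_num), ENNReal.one_le_ofReal]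
    linarith
  exact le_mul_of_one_le_left' (one_le_pow_of_one_le' h3 j)

/-- Passing from functions holomorphic across the circle to functions on the open disc. -/
lemma le_Hl_of_AN {κ j : ℕ} {p : ℝ} {C : ℝ≥0∞} (Φ : ℕ → (ℕ → ℝ → ℝ≥0∞) → ℝ≥0∞)
    (hmono : ∀ L c d, (∀ l < L, ∀ x, c l x ≤ 2 ^ j * d l x) → Φ L c ≤ 2 ^ (j * p) * Φ L d)
    (hΦ : ∀ L, ∀ G, AN G → Φ L (cs (κ + 1) j G) ≤ C * ∫⁻ y, ‖G (circlePt y)‖ₑ ^ p ∂cm)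
    {F : ℂ → ℂ} (hF : DifferentiableOn ℂ F (ball 0 1)) (hCt : C ≠ ∞) (hp : 0 ≤ p) (L : ℕ) :
    Φ L (cs κ j F) ≤ 2 ^ (j * p) * C * Hl p F := by
  have h2 : (2 : ℝ≥0∞) ^ (j * p) * C ≠ ∞ :=
    ENNReal.mul_ne_top (ENNReal.rpow_ne_top_of_nonneg (by positivity) (by norm_num)) hCt
  rw [Hl, ← ENNReal.liminf_const_mul_of_ne_top h2]
  refine le_liminf_of_le (by isBoundedDefault) ?_
  have hev : ∀ᶠ ρ : ℝ in 𝓝[<] 1, 1 - (1 / 2) ^ (L + κ + 1) < ρ ∧ ρ < 1 := by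
    refine (eventually_nhdsWithin_of_eventually_nhds (lt_mem_nhds ?_)).and self_mem_nhdsWithin
    have : (0 : ℝ) < (1 / 2) ^ (L + κ + 1) := by positivity
    linarith
  filter_upwards [hev] with ρ ⟨hρ1, hρ2⟩
  have hp0 : ((1 : ℝ) / 2) ^ (L + κ + 1) ≤ 1 := pow_le_one₀ (by norm_num) (by norm_num)
  have hAN := AN_dilate hF (ρ := ρ) (by linarith) hρ2
  refine (hmono L _ _ fun l hl x => cs_le_dilate ?_ hρ2 x).trans ((mul_le_mul_right (hΦ L _ hAN) _).trans_eq
    (mul_assoc _ _ _).symm)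
  have : ((1 : ℝ) / 2) ^ (L + κ + 1) ≤ (1 / 2) ^ (l + κ + 1) :=
    pow_le_pow_of_le_one (by norm_num) (by norm_num) (by omega)
  linarith

lemma lintegral_iSup_rpow {u : ℕ → ℝ → ℝ≥0∞} (hu : ∀ L, Measurable (u L)) (hm : Monotone u)
    {p : ℝ} (hp : 0 < p) :
    ∫⁻ x, (⨆ L, u L x) ^ p ∂cm = ⨆ L, ∫⁻ x, u L x ^ p ∂cm := by
  rw [← lintegral_iSup (fun L => (hu L).pow_const p)
    fun a b h x => by dsimp only; gcongr; exact hm h x]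
  refine lintegral_congr fun x => ?_
  exact (ENNReal.orderIsoRpow p hp).map_iSup fun L => u L x

lemma iSup_eq_iSup_iSup_lt (c : ℕ → ℝ≥0∞) : ⨆ l, c l = ⨆ L, ⨆ l < L, c l :=
  le_antisymm (iSup_le fun l => le_iSup_of_le (l + 1) (le_iSup₂_of_le l (Nat.lt_succ_self l) le_rfl))
    (iSup_le fun _ => iSup₂_le fun l _ => le_iSup c l)

/-- Square function of the normalised `j`-th derivatives. -/
noncomputable def SQ (κ j : ℕ) (F : ℂ → ℂ) (x : ℝ) : ℝ≥0∞ := ∑' l, cs κ j F l x ^ 2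

/-- Nontangential maximal function of the normalised `j`-th derivatives. -/
noncomputable def NM (κ j : ℕ) (F : ℂ → ℂ) (x : ℝ) : ℝ≥0∞ := ⨆ l, cs κ j F l x

lemma measurable_SQ (κ j : ℕ) (F : ℂ → ℂ) : Measurable (SQ κ j F) :=
  Measurable.tsum fun l => (measurable_cs κ j F l).pow_const 2

lemma measurable_NM (κ j : ℕ) (F : ℂ → ℂ) : Measurable (NM κ j F) :=
  Measurable.iSup fun l => measurable_cs κ j F l

lemma lintegral_NM_le_Hl {κ j : ℕ} {p : ℝ} (hp : 0 < p) {C : ℝ≥0∞} (hC : C ≠ ∞)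
    (h : ∀ G, AN G → ∫⁻ x, NM (κ + 1) j G x ^ p ∂cm ≤ C * ∫⁻ y, ‖G (circlePt y)‖ₑ ^ p ∂cm)
    {F : ℂ → ℂ} (hF : DifferentiableOn ℂ F (ball 0 1)) :
    ∫⁻ x, NM κ j F x ^ p ∂cm ≤ 2 ^ (j * p) * C * Hl p F := by
  simp only [NM, iSup_eq_iSup_iSup_lt (fun l => cs κ j F l _)]
  rw [lintegral_iSup_rpow (u := fun L x => ⨆ l < L, cs κ j F l x) (fun L => Measurable.iSup fun l => Measurable.iSup fun _ =>
    measurable_cs κ j F l) (fun L M hLM x => iSup₂_le fun l hl =>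
      le_iSup₂_of_le l (lt_of_lt_of_le hl hLM) le_rfl) hp]
  refine iSup_le fun L => ?_
  refine le_Hl_of_AN (fun L c => ∫⁻ x, (⨆ l < L, c l x) ^ p ∂cm) ?_ ?_ hF hC hp.le L
  · intro L c d hcd
    rw [← lintegral_const_mul' _ _ (ENNReal.rpow_ne_top_of_nonneg (by positivity) (by norm_num))]
    refine lintegral_mono fun x => ?_
    have h1 : (⨆ l < L, c l x) ≤ 2 ^ j * ⨆ l < L, d l x :=
      iSup₂_le fun l hl => (hcd l hl x).trans (by
        gcongr; exact le_iSup₂_of_le (f := fun l _ => d l x) l hl le_rfl)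
    calc (⨆ l < L, c l x) ^ p ≤ (2 ^ j * ⨆ l < L, d l x) ^ p := by gcongr
      _ = _ := by
        rw [ENNReal.mul_rpow_of_nonneg _ _ hp.le, ← ENNReal.rpow_natCast, ← ENNReal.rpow_mul]
  · intro L G hG
    refine le_trans (lintegral_mono fun x => ?_) (h G hG)
    dsimp only
    gcongr
    exact iSup₂_le fun l _ => le_iSup (fun l => cs (κ + 1) j G l x) l

lemma lintegral_SQ_le_Hl {κ j : ℕ} {p : ℝ} (hp : 0 < p) {C : ℝ≥0∞} (hC : C ≠ ∞)
    (h : ∀ G, AN G → ∫⁻ x, SQ (κ + 1) j G x ^ (p / 2) ∂cm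
      ≤ C * ∫⁻ y, ‖G (circlePt y)‖ₑ ^ p ∂cm)
    {F : ℂ → ℂ} (hF : DifferentiableOn ℂ F (ball 0 1)) :
    ∫⁻ x, SQ κ j F x ^ (p / 2) ∂cm ≤ 2 ^ (j * p) * C * Hl p F := by
  simp only [SQ, ENNReal.tsum_eq_iSup_nat]
  rw [lintegral_iSup_rpow (u := fun L x => ∑ l ∈ Finset.range L, cs κ j F l x ^ 2)
    (fun L => Finset.measurable_sum _ fun l _ =>
    (measurable_cs κ j F l).pow_const 2) (fun L M hLM x => Finset.sum_le_sum_of_subset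
      (Finset.range_mono hLM)) (by positivity)]
  refine iSup_le fun L => ?_
  refine le_Hl_of_AN (fun L c => ∫⁻ x, (∑ l ∈ Finset.range L, c l x ^ 2) ^ (p / 2) ∂cm)
    ?_ ?_ hF hC hp.le L
  · intro L c d hcd
    rw [← lintegral_const_mul' _ _ (ENNReal.rpow_ne_top_of_nonneg (by positivity) (by norm_num))]
    refine lintegral_mono fun x => ?_
    have h1 : ∑ l ∈ Finset.range L, c l x ^ 2
        ≤ (2 ^ j) ^ 2 * ∑ l ∈ Finset.range L, d l x ^ 2 := by
      rw [Finset.mul_sum]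
      refine Finset.sum_le_sum fun l hl => ?_
      rw [← mul_pow]
      gcongr
      exact hcd l (Finset.mem_range.1 hl) x
    calc (∑ l ∈ Finset.range L, c l x ^ 2) ^ (p / 2)
        ≤ ((2 ^ j) ^ 2 * ∑ l ∈ Finset.range L, d l x ^ 2) ^ (p / 2) := by gcongr
      _ = _ := by
        rw [ENNReal.mul_rpow_of_nonneg _ _ (by positivity), ← pow_mul, ← ENNReal.rpow_natCast,
          ← ENNReal.rpow_mul]
        congr 2; push_cast; ring
  · intro L G hG
    refine le_trans (lintegral_mono fun x => ?_) (h G hG)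
    dsimp only
    gcongr
    exact ENNReal.sum_le_tsum _

theorem lintegral_NM_le_of_two_le (κ j : ℕ) {p : ℝ} (hp : 2 ≤ p) :
    ∃ C : ℝ≥0∞, C ≠ ∞ ∧ ∀ F : ℂ → ℂ, DifferentiableOn ℂ F (ball 0 1) →
      ∫⁻ x, NM κ j F x ^ p ∂cm ≤ C * Hl p F := by
  obtain ⟨C, hC, h⟩ := lintegral_iSup_cs_le_of_AN (κ + 1) j hp
  refine ⟨2 ^ (j * p) * C, ENNReal.mul_ne_top
    (ENNReal.rpow_ne_top_of_nonneg (by positivity) (by norm_num)) hC, fun F hF => ?_⟩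
  exact lintegral_NM_le_Hl (by linarith) hC h hF

lemma integral_circlePt_pow_mul_conj (m k : ℕ) :
    ∫ y, circlePt y ^ m * (starRingEnd ℂ) (circlePt y ^ k) ∂cm = if m = k then 2 * Real.pi else 0 := by
  have e : ∀ y : ℝ, circlePt y ^ m * (starRingEnd ℂ) (circlePt y ^ k)
      = Complex.exp (((m : ℂ) - k) * Complex.I * y) := by
    intro y
    simp only [circlePt, ← Complex.exp_conj, ← Complex.exp_nat_mul, ← Complex.exp_add]
    congr 1
    simp
    ring
  simp_rw [e]
  rw [← intervalIntegral.integral_of_le (by positivity)]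
  split_ifs with h
  · subst h
    simp
  · have hmk : ((m : ℂ) - k) ≠ 0 := by
      rw [sub_ne_zero]; exact_mod_cast h
    rw [integral_exp_mul_complex (mul_ne_zero hmk Complex.I_ne_zero)]
    have : Complex.exp (((m : ℂ) - k) * Complex.I * ((2 * Real.pi : ℝ) : ℂ)) = 1 := by
      rw [Complex.exp_eq_one_iff]
      exact ⟨(m : ℤ) - k, by push_cast; ring⟩
    rw [this]
    simp

lemma integral_norm_sq_sum (c : ℕ → ℂ) (N : ℕ) :
    ∫ y, ‖∑ m ∈ Finset.range N, c m * circlePt y ^ m‖ ^ 2 ∂cm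
      = 2 * Real.pi * ∑ m ∈ Finset.range N, ‖c m‖ ^ 2 := by
  have hc : Continuous fun y => circlePt y := continuous_circlePt
  have key : ∫ y, (((‖∑ m ∈ Finset.range N, c m * circlePt y ^ m‖ ^ 2 : ℝ)) : ℂ) ∂cm
      = ((2 * Real.pi * ∑ m ∈ Finset.range N, ‖c m‖ ^ 2 : ℝ) : ℂ) := by
    have e : ∀ y : ℝ, ((‖∑ m ∈ Finset.range N, c m * circlePt y ^ m‖ ^ 2 : ℝ) : ℂ)
        = ∑ m ∈ Finset.range N, ∑ k ∈ Finset.range N, c m * (starRingEnd ℂ) (c k) *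
          (circlePt y ^ m * (starRingEnd ℂ) (circlePt y ^ k)) := by
      intro y
      push_cast
      rw [← Complex.mul_conj', map_sum, Finset.sum_mul_sum]
      refine Finset.sum_congr rfl fun m _ => Finset.sum_congr rfl fun k _ => ?_
      rw [map_mul]; ring
    refine (integral_congr_ae (ae_of_all _ e)).trans ?_
    rw [integral_finsetSum _ fun m _ => integrable_of_continuous (by fun_prop)]
    push_cast
    rw [Finset.mul_sum]
    refine Finset.sum_congr rfl fun m hm => ?_
    rw [integral_finsetSum _ fun k _ => integrable_of_continuous (by fun_prop)]
    simp_rw [integral_const_mul, integral_circlePt_pow_mul_conj]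
    simp only [apply_ite Complex.ofReal, mul_ite, Complex.ofReal_zero, mul_zero]
    rw [Finset.sum_ite_eq, if_pos hm, Complex.mul_conj']
    push_cast
    ring
  exact Complex.ofReal_injective ((integral_complex_ofReal).symm.trans key)

/-- Parseval identity for absolutely convergent power series on the circle. -/
lemma lintegral_enorm_tsum_sq {c : ℕ → ℂ} (hc : Summable fun m => ‖c m‖) :
    ∫⁻ y, ‖∑' m, c m * circlePt y ^ m‖ₑ ^ 2 ∂cm
      = ENNReal.ofReal (2 * Real.pi) * ∑' m, ‖c m‖ₑ ^ 2 := by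
  have hs : ∀ y, Summable fun m => c m * circlePt y ^ m := fun y =>
    Summable.of_norm (by simpa [norm_circlePt] using hc)
  have hcont : ∀ N, Continuous fun y => ∑ m ∈ Finset.range N, c m * circlePt y ^ m := by
    have := continuous_circlePt
    intro N; fun_prop
  have hpart : ∀ N, ∫⁻ y, ‖∑ m ∈ Finset.range N, c m * circlePt y ^ m‖ₑ ^ 2 ∂cm
      = ENNReal.ofReal (2 * Real.pi) * ∑ m ∈ Finset.range N, ‖c m‖ₑ ^ 2 := by
    intro N
    have := integral_norm_sq_sum c N
    have e : ∀ z : ℂ, ‖z‖ₑ ^ 2 = ENNReal.ofReal (‖z‖ ^ 2) := fun z => by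
      rw [ENNReal.ofReal_pow (norm_nonneg _), ofReal_norm]
    simp_rw [e]
    rw [← ofReal_integral_eq_lintegral_ofReal (integrable_of_continuous (by have := hcont N; fun_prop))
      (ae_of_all _ fun _ => by positivity), this, ENNReal.ofReal_mul (by positivity),
      ENNReal.ofReal_sum_of_nonneg fun _ _ => by positivity]
  have h1 : Tendsto (fun N => ∫⁻ y, ‖∑ m ∈ Finset.range N, c m * circlePt y ^ m‖ₑ ^ 2 ∂cm) atTop
      (𝓝 (∫⁻ y, ‖∑' m, c m * circlePt y ^ m‖ₑ ^ 2 ∂cm)) := by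
    refine tendsto_lintegral_of_dominated_convergence (fun _ => ENNReal.ofReal (∑' m, ‖c m‖) ^ 2)
      (fun N => ((hcont N).enorm.measurable.pow_const 2)) (fun N => ae_of_all _ fun y => ?_) ?_
      (ae_of_all _ fun y => ?_)
    · dsimp only
      rw [← ofReal_norm]
      gcongr
      refine (norm_sum_le _ _).trans ?_
      simp only [norm_mul, norm_pow, norm_circlePt, one_pow, mul_one]
      exact hc.sum_le_tsum _ fun _ _ => norm_nonneg _
    · rw [lintegral_const]
      exact ENNReal.mul_ne_top (ENNReal.pow_ne_top ENNReal.ofReal_ne_top) (measure_ne_top _ _)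
    · exact ((ENNReal.continuous_pow 2).comp continuous_enorm).tendsto _ |>.comp
        (hs y).hasSum.tendsto_sum_nat
  simp_rw [hpart] at h1
  refine tendsto_nhds_unique h1 ?_
  exact ENNReal.Tendsto.const_mul (ENNReal.tendsto_nat_tsum _) (Or.inr ENNReal.ofReal_ne_top)

lemma lintegral_enorm_sq_circle {F : ℂ → ℂ} (hF : AN F) :
    ∫⁻ y, ‖F (circlePt y)‖ₑ ^ 2 ∂cm
      = ENNReal.ofReal (2 * Real.pi) * ∑' m : ℕ, ‖iteratedDeriv m F 0 / m.factorial‖ₑ ^ 2 := by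
  obtain ⟨R, hR, hF⟩ := hF
  have key : ∀ z ∈ ball (0 : ℂ) R,
      HasSum (fun m : ℕ => iteratedDeriv m F 0 / m.factorial * z ^ m) (F z) := by
    intro z hz
    refine (Complex.hasSum_taylorSeries_on_ball hF hz).congr_fun fun m => ?_
    simp only [sub_zero, smul_eq_mul]; ring
  have hsum : Summable fun m : ℕ => ‖iteratedDeriv m F 0 / m.factorial‖ := by
    have := (key 1 (by simpa using hR)).summable.norm
    simpa using this
  rw [← lintegral_enorm_tsum_sq hsum]
  refine lintegral_congr fun y => ?_
  rw [(key (circlePt y) (by simpa [norm_circlePt] using hR)).tsum_eq]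

lemma AN.dilate {F : ℂ → ℂ} (h : AN F) {ρ : ℝ} (h0 : 0 < ρ) (h1 : ρ < 1) : AN fun z => F (ρ * z) :=
  AN_dilate h.diffOn h0 h1

lemma one_add_pow_le_exp (N : ℕ) {v : ℝ} (hv : 0 ≤ v) :
    (1 + v) ^ N ≤ N.factorial * Real.exp 1 * Real.exp v := by
  have h := Real.pow_div_factorial_le_exp (1 + v) (by linarith) N
  rw [div_le_iff₀ (by positivity), Real.exp_add] at h
  linarith

/-- Constant in the summation of dyadic multipliers. -/
noncomputable def dyc (κ j : ℕ) : ℝ :=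
  2 * (2 ^ κ) ^ (2 * j + 1) * ((2 * j + 1).factorial * Real.exp 1)

lemma dyadic_multiplier_term {κ j : ℕ} (hj : 1 ≤ j) {u : ℝ} (hu : 0 ≤ u) :
    u ^ (2 * j) * Real.exp (-(u / 2 ^ κ)) ≤ dyc κ j * (u / (1 + u) - (u / 2) / (1 + u / 2)) := by
  have h1 : u / (1 + u) - (u / 2) / (1 + u / 2) = u / ((1 + u) * (2 + u)) := by
    field_simp; ring
  have hk : (1 : ℝ) ≤ 2 ^ κ := one_le_pow₀ (by norm_num)
  have h2 : (1 + u) ^ (2 * j + 1) ≤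
      (2 ^ κ) ^ (2 * j + 1) * ((2 * j + 1).factorial * Real.exp 1 * Real.exp (u / 2 ^ κ)) := by
    refine le_trans ?_ (mul_le_mul_of_nonneg_left
      (one_add_pow_le_exp (2 * j + 1) (v := u / 2 ^ κ) (by positivity)) (by positivity))
    rw [← mul_pow]
    gcongr
    rw [mul_add, mul_div_cancel₀ _ (by positivity)]
    linarith
  rw [h1, Real.exp_neg, ← div_eq_mul_inv, dyc, mul_div_assoc', div_le_div_iff₀ (by positivity)
    (by positivity)]
  obtain ⟨i, rfl⟩ : ∃ i, j = i + 1 := ⟨j - 1, by omega⟩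
  have h3 : u ^ (2 * (i + 1)) * ((1 + u) * (2 + u)) ≤ 2 * (1 + u) ^ (2 * (i + 1) + 1) * u := by
    have h4 : u ^ (2 * i + 1) ≤ (1 + u) ^ (2 * i + 1) := by gcongr; linarith
    calc u ^ (2 * (i + 1)) * ((1 + u) * (2 + u)) = u ^ (2 * i + 1) * (u * ((1 + u) * (2 + u))) := by
          ring
      _ ≤ (1 + u) ^ (2 * i + 1) * (u * ((1 + u) * (2 * (1 + u)))) := by
          gcongr; linarith
      _ = _ := by ring
  nlinarith

lemma dyadic_multiplier_sum {κ j : ℕ} (hj : 1 ≤ j) (M L : ℕ) :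
    ∑ l ∈ Finset.range L, ((M : ℝ) * (1 / 2) ^ l) ^ (2 * j) * (1 - (1 / 2) ^ (l + κ + 1)) ^ (2 * M)
      ≤ dyc κ j := by
  have h0 : 0 ≤ dyc κ j := by unfold dyc; positivity
  set h : ℕ → ℝ := fun l => (M * (1 / 2) ^ l) / (1 + M * (1 / 2) ^ l) with hh
  have hterm : ∀ l, ((M : ℝ) * (1 / 2) ^ l) ^ (2 * j) * (1 - (1 / 2) ^ (l + κ + 1)) ^ (2 * M)
      ≤ dyc κ j * (h l - h (l + 1)) := by
    intro l
    have hp : ((1 : ℝ) / 2) ^ (l + κ + 1) ≤ 1 := pow_le_one₀ (by norm_num) (by norm_num)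
    have := dyadic_multiplier_term (κ := κ) hj (u := M * (1 / 2) ^ l) (by positivity)
    have e : (M * (1 / 2 : ℝ) ^ l) / 2 = M * (1 / 2) ^ (l + 1) := by rw [pow_succ]; ring
    rw [e] at this
    refine le_trans ?_ this
    gcongr
    calc (1 - (1 / 2 : ℝ) ^ (l + κ + 1)) ^ (2 * M)
        ≤ Real.exp (-(1 / 2) ^ (l + κ + 1)) ^ (2 * M) := by
          refine pow_le_pow_left₀ (by linarith) ?_ _
          exact Real.one_sub_le_exp_neg _
      _ = _ := by
          rw [← Real.exp_nat_mul]
          congr 1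
          push_cast
          rw [pow_succ, pow_add]
          have : (1 / 2 : ℝ) ^ κ = 1 / 2 ^ κ := by rw [div_pow, one_pow]
          rw [this]
          ring
  calc _ ≤ ∑ l ∈ Finset.range L, dyc κ j * (h l - h (l + 1)) := Finset.sum_le_sum fun l _ => hterm l
    _ = dyc κ j * (h 0 - h L) := by rw [← Finset.mul_sum, Finset.sum_range_sub']
    _ ≤ dyc κ j * 1 := by
        gcongr
        have h1 : h 0 ≤ 1 := by
          rw [hh]; exact (div_le_one (by positivity)).2 (by linarith)
        have h2 : 0 ≤ h L := by positivity
        linarith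
    _ = _ := mul_one _

lemma half_pow_eq (m : ℕ) : (1 / 2 : ℝ≥0∞) ^ m = ENNReal.ofReal ((1 / 2) ^ m) := by
  rw [ENNReal.ofReal_pow (by norm_num), ENNReal.ofReal_div_of_pos (by norm_num)]; simp

lemma iteratedDeriv_add_apply (i j : ℕ) (F : ℂ → ℂ) :
    iteratedDeriv i (iteratedDeriv j F) = iteratedDeriv (i + j) F := by
  simp only [iteratedDeriv_eq_iterate, ← Function.iterate_add_apply]

lemma cs_eq_cs_iteratedDeriv (κ i j : ℕ) (F : ℂ → ℂ) (l : ℕ) (x : ℝ) :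
    cs κ (i + j) F l x = cs κ i (iteratedDeriv j F) l x * (1 / 2) ^ (l * j) := by
  simp only [cs, iteratedDeriv_add_apply, ENNReal.iSup_mul]
  refine iSup_congr fun w => iSup_congr fun _ => ?_
  rw [mul_add, pow_add, mul_assoc]

lemma lintegral_lintegral_pke_ctr {φ : ℝ → ℝ≥0∞} (hφ : Measurable φ) (l : ℕ) :
    ∫⁻ x, ∫⁻ y, pke (ctr l x) y * φ y ∂cm ∂cm = ∫⁻ y, φ y ∂cm := by
  rw [lintegral_lintegral_swap]
  · refine lintegral_congr fun y => ?_
    simp_rw [pke_ctr_symm l _ y]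
    rw [lintegral_mul_const _ (measurable_pke_left _), lintegral_pke (ctr_mem_ball l y), one_mul]
  · exact ((measurable_pke_ctr l).fun_mul (hφ.fun_comp (g := φ) measurable_snd)).aemeasurable

lemma lintegral_cs_sq_le (κ j : ℕ) {G : ℂ → ℂ} (hG : AN G) (l : ℕ) :
    ∫⁻ x, cs κ j G l x ^ 2 ∂cm ≤ cauc (κ + 1) 0 ^ 2 * harn (κ + 1) *
      ((1 / 2) ^ (2 * (l * j)) *
        ∫⁻ y, ‖iteratedDeriv j G (((1 - (1 / 2) ^ (l + κ + 1) : ℝ) : ℂ) * circlePt y)‖ₑ ^ 2 ∂cm) := by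
  set R : ℝ := 1 - (1 / 2) ^ (l + κ + 1) with hR
  have hp : ((1 : ℝ) / 2) ^ (l + κ) ≤ 1 := pow_le_one₀ (by norm_num) (by norm_num)
  have hp2 : ((1 : ℝ) / 2) ^ (l + κ + 1) = (1 / 2) ^ (l + κ) / 2 := by rw [pow_succ]; ring
  have hp3 : (0 : ℝ) < (1 / 2) ^ (l + κ) := by positivity
  have hR0 : 0 < R := by linarith
  have hR1 : R < 1 := by linarith
  set H : ℂ → ℂ := fun z => iteratedDeriv j G (R * z) with hH
  have hHA : AN H := (hG.iteratedDeriv j).dilate hR0 hR1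
  have hm : Measurable fun y => ‖H (circlePt y)‖ₑ ^ 2 :=
    hHA.continuous_circle.enorm.measurable.pow_const 2
  have h1 : ∀ x, cs κ j G l x ^ 2 ≤ (cauc (κ + 1) 0 ^ 2 * harn (κ + 1) * (1 / 2) ^ (2 * (l * j))) *
      ∫⁻ y, pke (ctr l x) y * ‖H (circlePt y)‖ₑ ^ 2 ∂cm := by
    intro x
    have e := cs_eq_cs_iteratedDeriv κ 0 j G l x
    rw [zero_add] at e
    have h2 := cs_le_dilate (κ := κ) (j := 0) (l := l) (F := iteratedDeriv j G) hR.le hR1 x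
    rw [pow_zero, one_mul] at h2
    have h3 := cs_rpow_le (κ := κ + 1) (j := 0) hHA (e := 2) (by norm_num) l x
    simp only [ENNReal.rpow_two] at h3
    rw [e, mul_pow]
    calc _ ≤ cs (κ + 1) 0 H l x ^ 2 * ((1 / 2) ^ (l * j)) ^ 2 := by gcongr
      _ ≤ (cauc (κ + 1) 0 ^ 2 * (harn (κ + 1) *
          ∫⁻ y, pke (ctr l x) y * ‖H (circlePt y)‖ₑ ^ 2 ∂cm)) * ((1 / 2) ^ (l * j)) ^ 2 := by gcongr
      _ = _ := by rw [← pow_mul, mul_comm (l * j) 2]; ring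
  refine (lintegral_mono h1).trans_eq ?_
  rw [lintegral_const_mul _ (measurable_pmean hm l), lintegral_lintegral_pke_ctr hm, mul_assoc]

lemma coeff_mul_le {κ j l : ℕ} (m : ℕ) {R b : ℝ} (hR : R = 1 - (1 / 2) ^ (l + κ + 1)) (hb : 0 ≤ b) :
    ((1 / 2 : ℝ) ^ (2 * (l * j))) * (R ^ m * b / m.factorial) ^ 2 ≤
      4 ^ j * ((((m + j : ℕ) : ℝ) * (1 / 2) ^ l) ^ (2 * j) * R ^ (2 * (m + j))) *
        (b / (m + j).factorial) ^ 2 := by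
  have hp : ((1 : ℝ) / 2) ^ (l + κ + 1) ≤ 1 / 2 := by
    rw [pow_succ]; nlinarith [pow_le_one₀ (n := l + κ) (by norm_num : (0:ℝ) ≤ 1/2) (by norm_num)]
  have hR2 : 1 / 2 ≤ R := by linarith
  have h1 : ((m + j).factorial : ℝ) ≤ m.factorial * ((m + j : ℕ) : ℝ) ^ j := by
    have e := Nat.factorial_mul_descFactorial (Nat.le_add_left j m)
    rw [Nat.add_sub_cancel] at e
    rw [← e]
    exact_mod_cast Nat.mul_le_mul_left _ (Nat.descFactorial_le_pow _ _)
  have h2 : (1 : ℝ) ≤ 2 ^ j * R ^ j := by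
    rw [← mul_pow]; exact one_le_pow₀ (by linarith)
  have h3 : R ^ m * b / m.factorial ≤
      2 ^ j * R ^ j * R ^ m * ((m + j : ℕ) : ℝ) ^ j * (b / (m + j).factorial) := by
    rw [div_le_iff₀ (by positivity)]
    calc R ^ m * b = 1 * (R ^ m * b * ((m + j).factorial / (m + j).factorial)) := by
          rw [div_self (by positivity)]; ring
      _ ≤ (2 ^ j * R ^ j) * (R ^ m * b *
          ((m.factorial * ((m + j : ℕ) : ℝ) ^ j) / (m + j).factorial)) := by gcongr
      _ = _ := by ring
  calc _ ≤ (1 / 2 : ℝ) ^ (2 * (l * j)) *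
        (2 ^ j * R ^ j * R ^ m * ((m + j : ℕ) : ℝ) ^ j * (b / (m + j).factorial)) ^ 2 := by gcongr
    _ = _ := by
        have : (4 : ℝ) ^ j = (2 ^ j) ^ 2 := by rw [← pow_mul, mul_comm, pow_mul]; norm_num
        rw [this, mul_pow _ ((1 / 2 : ℝ) ^ l), ← pow_mul (1 / 2 : ℝ)]
        ring

/-- Littlewood–Paley estimate in `L²`. -/
lemma lintegral_SQ_le_of_AN (κ : ℕ) {j : ℕ} (hj : 1 ≤ j) : ∃ C : ℝ≥0∞, C ≠ ∞ ∧
    ∀ F, AN F → ∫⁻ x, SQ κ j F x ∂cm ≤ C * ∫⁻ y, ‖F (circlePt y)‖ₑ ^ 2 ∂cm := by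
  refine ⟨cauc (κ + 1) 0 ^ 2 * harn (κ + 1) * ENNReal.ofReal (4 ^ j * dyc κ j), ?_, fun F hF => ?_⟩
  · exact ENNReal.mul_ne_top (ENNReal.mul_ne_top (ENNReal.pow_ne_top (cauc_ne_top _ _))
      (harn_ne_top _)) ENNReal.ofReal_ne_top
  simp only [SQ]
  rw [lintegral_tsum fun l => ((measurable_cs κ j F l).pow_const 2).aemeasurable,
    ENNReal.tsum_eq_iSup_nat]
  refine iSup_le fun L => ?_
  refine (Finset.sum_le_sum fun l _ => lintegral_cs_sq_le κ j hF l).trans ?_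
  rw [← Finset.mul_sum, mul_assoc (_ * harn _)]
  gcongr
  set R : ℕ → ℝ := fun l => 1 - (1 / 2) ^ (l + κ + 1) with hR
  have hR01 : ∀ l, 0 < R l ∧ R l < 1 := by
    intro l
    have hp : ((1 : ℝ) / 2) ^ (l + κ) ≤ 1 := pow_le_one₀ (by norm_num) (by norm_num)
    have hp2 : ((1 : ℝ) / 2) ^ (l + κ + 1) = (1 / 2) ^ (l + κ) / 2 := by rw [pow_succ]; ring
    have hp3 : (0 : ℝ) < (1 / 2) ^ (l + κ) := by positivity
    constructor <;> simp only [hR] <;> linarith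
  have hA : ∀ l, AN fun z => iteratedDeriv j F (R l * z) := fun l =>
    (hF.iteratedDeriv j).dilate (hR01 l).1 (hR01 l).2
  set b : ℕ → ℝ := fun m => ‖iteratedDeriv m F 0‖ with hb
  have e : ∀ l, ∫⁻ y, ‖iteratedDeriv j F (((1 - (1 / 2) ^ (l + κ + 1) : ℝ) : ℂ) * circlePt y)‖ₑ ^ 2 ∂cm
      = ENNReal.ofReal (2 * Real.pi) *
        ∑' m : ℕ, ENNReal.ofReal ((R l ^ m * b (m + j) / m.factorial) ^ 2) := by
    intro l
    rw [lintegral_enorm_sq_circle (hA l)]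
    congr 1
    refine tsum_congr fun m => ?_
    rw [iteratedDeriv_dilate, iteratedDeriv_add_apply, ENNReal.ofReal_pow (by
      have := (hR01 l).1; positivity), ← ofReal_norm]
    simp [abs_of_pos (hR01 l).1, hb]
  have e2 : ∫⁻ y, ‖F (circlePt y)‖ₑ ^ 2 ∂cm = ENNReal.ofReal (2 * Real.pi) *
        ∑' m : ℕ, ENNReal.ofReal ((b m / m.factorial) ^ 2) := by
    rw [lintegral_enorm_sq_circle hF]
    congr 1
    refine tsum_congr fun m => ?_
    rw [ENNReal.ofReal_pow (by positivity), ← ofReal_norm]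
    simp [hb]
  simp_rw [e]
  rw [e2, mul_left_comm (ENNReal.ofReal (4 ^ j * _))]
  have e3 : ∀ l, (1 / 2 : ℝ≥0∞) ^ (2 * (l * j)) * (ENNReal.ofReal (2 * Real.pi) *
      ∑' m : ℕ, ENNReal.ofReal ((R l ^ m * b (m + j) / m.factorial) ^ 2)) =
      ENNReal.ofReal (2 * Real.pi) * ∑' m : ℕ, ENNReal.ofReal ((1 / 2) ^ (2 * (l * j)) *
        (R l ^ m * b (m + j) / m.factorial) ^ 2) := by
    intro l
    rw [mul_left_comm, ← ENNReal.tsum_mul_left, half_pow_eq]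
    congr 2 with m
    rw [ENNReal.ofReal_mul (by positivity)]
  simp_rw [e3]
  rw [← Finset.mul_sum]
  gcongr
  rw [← Summable.tsum_finsetSum fun _ _ => ENNReal.summable, ← ENNReal.tsum_mul_left]
  calc _ ≤ ∑' m : ℕ, ENNReal.ofReal (4 ^ j * dyc κ j) *
        ENNReal.ofReal ((b (m + j) / (m + j).factorial) ^ 2) := by
        refine ENNReal.tsum_le_tsum fun m => ?_
        rw [← ENNReal.ofReal_sum_of_nonneg fun _ _ => by positivity, ← ENNReal.ofReal_mul (by
          unfold dyc; positivity)]
        refine ENNReal.ofReal_le_ofReal ?_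
        refine (Finset.sum_le_sum fun l _ => coeff_mul_le (κ := κ) (l := l) (j := j) m (R := R l) rfl
          (norm_nonneg (iteratedDeriv (m + j) F 0))).trans ?_
        rw [← Finset.sum_mul, ← Finset.mul_sum]
        gcongr
        exact dyadic_multiplier_sum hj (m + j) L
    _ ≤ _ := ENNReal.tsum_comp_le_tsum_of_injective (add_left_injective j) fun m =>
        ENNReal.ofReal (4 ^ j * dyc κ j) * ENNReal.ofReal ((b m / m.factorial) ^ 2)

theorem lintegral_SQ_le_two (κ : ℕ) {j : ℕ} (hj : 1 ≤ j) : ∃ C : ℝ≥0∞, C ≠ ∞ ∧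
    ∀ F : ℂ → ℂ, DifferentiableOn ℂ F (ball 0 1) → ∫⁻ x, SQ κ j F x ∂cm ≤ C * Hl 2 F := by
  obtain ⟨C, hC, h⟩ := lintegral_SQ_le_of_AN (κ + 1) hj
  refine ⟨2 ^ (j * (2 : ℝ)) * C, ENNReal.mul_ne_top
    (ENNReal.rpow_ne_top_of_nonneg (by positivity) (by norm_num)) hC, fun F hF => ?_⟩
  have := lintegral_SQ_le_Hl (κ := κ) (j := j) (p := 2) (by norm_num) hC (fun G hG => by
    simpa using h G hG) hF
  simpa using this

lemma differentiableOn_integral {α : Type*} [MeasurableSpace α] {μ : Measure α} {U : Set ℂ}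
    (hU : IsOpen U) {k : ℂ → α → ℂ} {B : α → ℝ} (hB : Integrable B μ)
    (hm : ∀ z ∈ U, AEStronglyMeasurable (k z) μ) (hk : ∀ a, DifferentiableOn ℂ (fun z => k z a) U)
    (hb : ∀ z ∈ U, ∀ a, ‖k z a‖ ≤ B a) : DifferentiableOn ℂ (fun z => ∫ a, k z a ∂μ) U := by
  intro z₀ hz₀
  obtain ⟨ε, hε, hεU⟩ := Metric.isOpen_iff.1 hU z₀ hz₀
  have hd : ∀ a, ∀ z ∈ U, HasDerivAt (fun z => k z a) (deriv (fun z => k z a) z) z := fun a z hz =>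
    ((hk a).differentiableAt (hU.mem_nhds hz)).hasDerivAt
  have hsub : ∀ z ∈ ball z₀ (ε / 2), closedBall z (ε / 3) ⊆ U := by
    intro z hz w hw
    refine hεU ?_
    rw [mem_ball] at hz ⊢
    rw [mem_closedBall] at hw
    linarith [dist_triangle w z z₀]
  have hmem : ∀ z ∈ ball z₀ (ε / 2), z ∈ U := fun z hz => hsub z hz (mem_closedBall_self (by positivity))
  refine (hasDerivAt_integral_of_dominated_loc_of_deriv_le (s := ball z₀ (ε / 2))
    (F' := fun z a => deriv (fun z => k z a) z) (bound := fun a => B a / (ε / 3))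
    (ball_mem_nhds _ (by positivity)) ?_ ?_ ?_ ?_ ?_ ?_).2.differentiableAt.differentiableWithinAt
  · filter_upwards [hU.mem_nhds hz₀] with z hz using hm z hz
  · exact hB.mono' (hm z₀ hz₀) (ae_of_all _ (hb z₀ hz₀))
  · set h : ℕ → ℂ := fun n => ((ε / 2 * (1 / 2) ^ (n + 1) : ℝ) : ℂ) with hh
    have h0 : ∀ n, h n ≠ 0 := fun n => by
      simp only [hh, ne_eq, Complex.ofReal_eq_zero]; positivity
    have hz : ∀ n, z₀ + h n ∈ U := fun n => hmem _ (by
      rw [mem_ball, dist_eq_norm, add_sub_cancel_left, Complex.norm_real, Real.norm_of_nonneg (by positivity)]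
      have : (1 / 2 : ℝ) ^ (n + 1) < 1 := pow_lt_one₀ (by norm_num) (by norm_num) (by omega)
      nlinarith)
    have hlim : Tendsto h atTop (𝓝[≠] 0) := by
      refine tendsto_nhdsWithin_iff.2 ⟨?_, Eventually.of_forall h0⟩
      have : Tendsto (fun n : ℕ => ε / 2 * (1 / 2 : ℝ) ^ (n + 1)) atTop (𝓝 (ε / 2 * 0)) :=
        ((_root_.tendsto_pow_atTop_nhds_zero_of_lt_one (by norm_num) (by norm_num)).comp
          (tendsto_add_atTop_nat 1)).const_mul _
      rw [mul_zero] at this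
      exact (Complex.continuous_ofReal.tendsto' 0 0 (by simp)).comp this
    refine aestronglyMeasurable_of_tendsto_ae atTop
      (f := fun n a => (h n)⁻¹ • (k (z₀ + h n) a - k z₀ a))
      (fun n => ((hm _ (hz n)).fun_sub (hm _ hz₀)).fun_const_smul _) (ae_of_all _ fun a => ?_)
    exact (hd a z₀ hz₀).tendsto_slope_zero.comp hlim
  · refine ae_of_all _ fun a z hz => ?_
    refine Complex.norm_deriv_le_of_forall_mem_sphere_norm_le (by positivity) ?_ fun w hw =>
      hb w (hsub z hz (sphere_subset_closedBall hw)) a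
    exact ((hk a).mono (hsub z hz)).diffContOnCl_ball subset_rfl
  · exact hB.div_const _
  · exact ae_of_all _ fun a z hz => hd a z (hmem z hz)

/-- Herglotz transform of a bounded function on the circle. -/
noncomputable def hV (φ : ℝ → ℝ≥0∞) (w : ℂ) : ℂ :=
  ∫ y, (circlePt y + w) / (circlePt y - w) * ((φ y).toReal / (2 * Real.pi) : ℝ) ∂cm

section Herglotz

variable {φ : ℝ → ℝ≥0∞} {K : ℝ≥0∞}

lemma norm_herglotz_le {R : ℝ} (hR : R < 1) {w : ℂ} (hw : w ∈ ball (0 : ℂ) R) (hK : K ≠ ∞)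
    (h : ∀ y, φ y ≤ K) (y : ℝ) :
    ‖(circlePt y + w) / (circlePt y - w) * ((φ y).toReal / (2 * Real.pi) : ℝ)‖
      ≤ 2 / (1 - R) * (K.toReal / (2 * Real.pi)) := by
  rw [mem_ball_zero_iff] at hw
  have h1 := one_sub_le_norm_circlePt_sub w y
  have h2 : ‖circlePt y + w‖ ≤ 2 := (norm_add_le _ _).trans (by rw [norm_circlePt]; linarith)
  rw [norm_mul, norm_div, Complex.norm_real, Real.norm_of_nonneg (by positivity)]
  have h3 : 0 < 1 - R := by linarith
  have h4 : 1 - R ≤ ‖circlePt y - w‖ := by linarith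
  have h5 : (φ y).toReal ≤ K.toReal := ENNReal.toReal_mono hK (h y)
  gcongr

lemma aestronglyMeasurable_herglotz (hφ : Measurable φ) (w : ℂ) : AEStronglyMeasurable
    (fun y => (circlePt y + w) / (circlePt y - w) * ((φ y).toReal / (2 * Real.pi) : ℝ)) cm := by
  have := continuous_circlePt.measurable
  refine Measurable.aestronglyMeasurable ?_
  fun_prop

lemma integrable_herglotz (hφ : Measurable φ) (hK : K ≠ ∞) (h : ∀ y, φ y ≤ K) {w : ℂ}
    (hw : w ∈ ball (0 : ℂ) 1) : Integrable
    (fun y => (circlePt y + w) / (circlePt y - w) * ((φ y).toReal / (2 * Real.pi) : ℝ)) cm := by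
  obtain ⟨R, hR, hR1⟩ := exists_between (mem_ball_zero_iff.1 hw)
  exact (integrable_const _).mono' (aestronglyMeasurable_herglotz hφ w)
    (ae_of_all _ (norm_herglotz_le hR1 (mem_ball_zero_iff.2 hR) hK h))

lemma differentiableOn_hV (hφ : Measurable φ) (hK : K ≠ ∞) (h : ∀ y, φ y ≤ K) :
    DifferentiableOn ℂ (hV φ) (ball 0 1) := by
  intro w hw
  obtain ⟨R, hR, hR1⟩ := exists_between (mem_ball_zero_iff.1 hw)
  refine ((differentiableOn_integral isOpen_ball (integrable_const _)
    (fun z _ => aestronglyMeasurable_herglotz hφ z) (fun y z hz => ?_) fun z hz =>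
    norm_herglotz_le hR1 hz hK h).differentiableAt
      (isOpen_ball.mem_nhds (mem_ball_zero_iff.2 hR))).differentiableWithinAt
  have := circlePt_sub_ne_zero (ball_subset_ball hR1.le hz) y
  refine DifferentiableAt.differentiableWithinAt ?_
  fun_prop (disch := assumption)

lemma herglotz_re {w : ℂ} (y : ℝ) (t : ℝ) :
    ((circlePt y + w) / (circlePt y - w) * (t / (2 * Real.pi) : ℝ)).re = pk w y * t := by
  rw [Complex.re_mul_ofReal]
  have h1 : ((circlePt y + w) / (circlePt y - w)).re = (1 - ‖w‖ ^ 2) / ‖circlePt y - w‖ ^ 2 := by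
    rw [Complex.div_re, ← add_div, Complex.normSq_eq_norm_sq]
    congr 1
    have e1 : ‖circlePt y‖ ^ 2 = 1 := by rw [norm_circlePt]; norm_num
    rw [← e1, ← Complex.normSq_eq_norm_sq, ← Complex.normSq_eq_norm_sq, Complex.normSq_apply,
      Complex.normSq_apply]
    simp
    ring
  rw [h1, pk]
  ring

lemma re_hV (hφ : Measurable φ) (hK : K ≠ ∞) (h : ∀ y, φ y ≤ K) {w : ℂ} (hw : w ∈ ball (0 : ℂ) 1) :
    (hV φ w).re = (∫⁻ y, pke w y * φ y ∂cm).toReal := by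
  have e1 : (hV φ w).re = ∫ y, pk w y * (φ y).toReal ∂cm := by
    rw [hV, ← Complex.reCLM_apply, ← ContinuousLinearMap.integral_comp_comm _
      (integrable_herglotz hφ hK h hw)]
    simp only [Complex.reCLM_apply, herglotz_re]
  rw [e1, integral_eq_lintegral_of_nonneg_ae
    (ae_of_all _ fun y => mul_nonneg (pk_nonneg hw y) toReal_nonneg)
    ((continuous_pk hw).measurable.mul hφ.ennreal_toReal).aestronglyMeasurable]
  congr 1
  refine lintegral_congr fun y => ?_
  rw [ENNReal.ofReal_mul (pk_nonneg hw y), ENNReal.ofReal_toReal (ne_top_of_le_ne_top hK (h y)), pke]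

end Herglotz

lemma lintegral_lintegral_pke {r : ℝ} (h0 : 0 ≤ r) (h1 : r < 1) {φ : ℝ → ℝ≥0∞} (hφ : Measurable φ) :
    ∫⁻ x, ∫⁻ y, pke (r * circlePt x) y * φ y ∂cm ∂cm = ∫⁻ y, φ y ∂cm := by
  rw [lintegral_lintegral_swap]
  · refine lintegral_congr fun y => ?_
    have e : ∀ x, pke (r * circlePt x) y = pke (r * circlePt y) x := fun x => by
      simp only [pke, pk_symm r x y]
    simp_rw [e]
    rw [lintegral_mul_const _ (measurable_pke_left _), lintegral_pke (smul_circlePt_mem_ball h0 h1 y),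
      one_mul]
  · have h : Measurable fun z : ℝ × ℝ => ((r : ℂ) * circlePt z.1, z.2) := by
      have := continuous_circlePt.measurable
      fun_prop
    exact ((Measurable.fun_comp (g := fun z : ℂ × ℝ => pke z.1 z.2) measurable_pke h).fun_mul
      (hφ.fun_comp (g := φ) measurable_snd)).aemeasurable

lemma integral_circle_eq {F : ℂ → ℂ} (hF : AN F) :
    ∫ y, F (circlePt y) ∂cm = 2 * Real.pi * F 0 := by
  rw [poisson_formula hF (w := 0) (by simp)]
  have e : ∀ y, pk 0 y = (2 * Real.pi)⁻¹ := fun y => by simp [pk, norm_circlePt]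
  simp_rw [e]
  rw [integral_const_mul]
  have : (Real.pi : ℂ) ≠ 0 := by exact_mod_cast Real.pi_ne_zero
  push_cast
  field_simp

lemma lintegral_enorm_sq_le_of_im_eq_zero {F : ℂ → ℂ} (hF : AN F) (h0 : (F 0).im = 0) :
    ∫⁻ y, ‖F (circlePt y)‖ₑ ^ 2 ∂cm ≤ 2 * ∫⁻ y, ENNReal.ofReal ((F (circlePt y)).re ^ 2) ∂cm := by
  have hc := hF.continuous_circle
  have hsq : AN fun z => F z ^ 2 := by
    obtain ⟨R, hR, h⟩ := hF
    exact ⟨R, hR, h.pow 2⟩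
  have h1 : 0 ≤ ∫ y, (((F (circlePt y)) ^ 2).re) ∂cm := by
    have e := integral_circle_eq hsq
    have hc2 : Continuous fun y => F (circlePt y) ^ 2 := hc.pow 2
    have e2 : ∫ y, (((F (circlePt y)) ^ 2).re) ∂cm = (∫ y, F (circlePt y) ^ 2 ∂cm).re := by
      rw [← Complex.reCLM_apply, ← ContinuousLinearMap.integral_comp_comm _
        (integrable_of_continuous hc2)]
      rfl
    rw [e2, e]
    have e3 : F 0 = ((F 0).re : ℂ) := by
      apply Complex.ext <;> simp [h0]
    rw [e3]
    have : (2 * Real.pi * ((F 0).re : ℂ) ^ 2).re = 2 * Real.pi * (F 0).re ^ 2 := by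
      norm_cast
    rw [this]
    positivity
  have e : ∀ z : ℂ, ‖z‖ₑ ^ 2 = ENNReal.ofReal (‖z‖ ^ 2) := fun z => by
    rw [ENNReal.ofReal_pow (norm_nonneg _), ofReal_norm]
  have hre : Continuous fun y => (F (circlePt y)).re := Complex.continuous_re.comp hc
  have hre2 : Continuous fun y => ((F (circlePt y)) ^ 2).re := Complex.continuous_re.comp (hc.pow 2)
  have hn : Continuous fun y => ‖F (circlePt y)‖ ^ 2 := hc.norm.pow 2
  have hr : Continuous fun y => (F (circlePt y)).re ^ 2 := hre.pow 2
  simp_rw [e]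
  rw [← ofReal_integral_eq_lintegral_ofReal (integrable_of_continuous hn)
    (ae_of_all _ fun _ => by positivity), ← ofReal_integral_eq_lintegral_ofReal
    (integrable_of_continuous hr) (ae_of_all _ fun _ => by positivity)]
  have e2 : (2 : ℝ≥0∞) = ENNReal.ofReal 2 := by simp
  rw [e2, ← ENNReal.ofReal_mul (by norm_num), ← integral_const_mul]
  refine ENNReal.ofReal_le_ofReal ?_
  have h2 : ∀ y, 2 * (F (circlePt y)).re ^ 2 = ‖F (circlePt y)‖ ^ 2 + ((F (circlePt y)) ^ 2).re := by
    intro y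
    rw [← Complex.normSq_eq_norm_sq, Complex.normSq_apply, pow_two (F _), Complex.mul_re]
    ring
  simp_rw [h2]
  rw [integral_add (integrable_of_continuous hn) (integrable_of_continuous hre2)]
  linarith

/-- A holomorphic function of modulus at least the Poisson extension of `φ`, with controlled
argument and `L²` norm; `ψ` is its logarithm. -/
lemma exists_outer {φ : ℝ → ℝ≥0∞} (hφ : Measurable φ) {δ K : ℝ≥0∞} (hδ0 : δ ≠ 0) (hδ : ∀ y, δ ≤ φ y)
    (hK : K ≠ ∞) (h : ∀ y, φ y ≤ K) : ∃ ψ : ℂ → ℂ, DifferentiableOn ℂ ψ (ball 0 1) ∧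
      (∀ w ∈ ball (0 : ℂ) 1, |(ψ w).im| ≤ Real.pi / 2) ∧
      (∀ w ∈ ball (0 : ℂ) 1, ∫⁻ y, pke w y * φ y ∂cm ≤ ‖Complex.exp (ψ w)‖ₑ) ∧
      (∀ r : ℝ, 0 < r → r < 1 → ∫⁻ x, ‖Complex.exp (ψ (r * circlePt x))‖ₑ ^ 2 ∂cm
        ≤ 2 * ∫⁻ y, φ y ^ 2 ∂cm) := by
  have hlt : ∀ w ∈ ball (0 : ℂ) 1, ∫⁻ y, pke w y * φ y ∂cm ≤ K := fun w hw => by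
    calc ∫⁻ y, pke w y * φ y ∂cm ≤ ∫⁻ y, pke w y * K ∂cm := by gcongr; exact h _
      _ = K := by rw [lintegral_mul_const _ (measurable_pke_left _), lintegral_pke hw, one_mul]
  have hgt : ∀ w ∈ ball (0 : ℂ) 1, δ ≤ ∫⁻ y, pke w y * φ y ∂cm := fun w hw => by
    calc δ = ∫⁻ y, pke w y * δ ∂cm := by
          rw [lintegral_mul_const _ (measurable_pke_left _), lintegral_pke hw, one_mul]
      _ ≤ _ := by gcongr; exact hδ _
  have hpos : ∀ w ∈ ball (0 : ℂ) 1, 0 < (hV φ w).re := fun w hw => by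
    rw [re_hV hφ hK h hw]
    refine ENNReal.toReal_pos ?_ (ne_top_of_le_ne_top hK (hlt w hw))
    exact (lt_of_lt_of_le (pos_iff_ne_zero.2 hδ0) (hgt w hw)).ne'
  have hne : ∀ w ∈ ball (0 : ℂ) 1, hV φ w ≠ 0 := fun w hw h0 => by
    have := hpos w hw
    rw [h0] at this
    simp at this
  have hdiff := differentiableOn_hV hφ hK h
  refine ⟨fun w => Complex.log (hV φ w), hdiff.clog fun w hw => Or.inl (hpos w hw), fun w hw => ?_,
    fun w hw => ?_, fun r h0 h1 => ?_⟩
  · rw [Complex.log_im, Complex.abs_arg_le_pi_div_two_iff]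
    exact (hpos w hw).le
  · rw [Complex.exp_log (hne w hw), ← ENNReal.ofReal_toReal (ne_top_of_le_ne_top hK (hlt w hw)),
      ← re_hV hφ hK h hw, ← ofReal_norm]
    exact ENNReal.ofReal_le_ofReal ((le_abs_self _).trans (Complex.abs_re_le_norm _))
  · have hball := fun x => smul_circlePt_mem_ball h0.le h1 x
    have e : ∀ x, Complex.exp (Complex.log (hV φ (r * circlePt x))) = hV φ (r * circlePt x) :=
      fun x => Complex.exp_log (hne _ (hball x))
    simp_rw [e]
    have hz : (hV φ (r * 0)).im = 0 := by
      rw [mul_zero, hV]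
      have e : ∀ y, (circlePt y + 0) / (circlePt y - 0) * ((φ y).toReal / (2 * Real.pi) : ℝ)
          = (((φ y).toReal / (2 * Real.pi) : ℝ) : ℂ) := fun y => by
        rw [add_zero, sub_zero, div_self (circlePt_ne_zero y), one_mul]
      simp_rw [e]
      rw [integral_complex_ofReal, Complex.ofReal_im]
    refine (lintegral_enorm_sq_le_of_im_eq_zero (AN_dilate hdiff h0 h1) hz).trans ?_
    gcongr 2 * ?_
    rw [← lintegral_lintegral_pke h0.le h1 (hφ.pow_const 2)]
    refine lintegral_mono fun x => ?_
    dsimp only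
    rw [ENNReal.ofReal_pow (hpos _ (hball x)).le, re_hV hφ hK h (hball x),
      ENNReal.ofReal_toReal (ne_top_of_le_ne_top hK (hlt _ (hball x)))]
    have := jensen_pke (hball x) hφ (p := 2) (by norm_num)
    simpa using this

/-- Interpolation nodes on a vertical line. -/
noncomputable def node (β : ℝ) (i : ℕ) : ℂ := β + i * Complex.I

lemma node_injective (β : ℝ) : Function.Injective (node β) := fun i k h => by
  have := congrArg Complex.im h
  simpa [node] using this

/-- Distortion of moduli under powers along a vertical line. -/
noncomputable def twist (i : ℕ) : ℝ≥0∞ := ENNReal.ofReal (Real.exp (i * (Real.pi / 2)))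

lemma twist_ne_top (i : ℕ) : twist i ≠ ∞ := ENNReal.ofReal_ne_top

lemma enorm_exp_rpow (z : ℂ) (β : ℝ) :
    ‖Complex.exp z‖ₑ ^ β = ENNReal.ofReal (Real.exp (β * z.re)) := by
  rw [← ofReal_norm, Complex.norm_exp, ENNReal.ofReal_rpow_of_pos (Real.exp_pos _), ← Real.exp_mul,
    mul_comm]

lemma enorm_exp_node_le {z : ℂ} (hz : |z.im| ≤ Real.pi / 2) (β : ℝ) (i : ℕ) :
    ‖Complex.exp (node β i * z)‖ₑ ≤ twist i * ‖Complex.exp z‖ₑ ^ β := by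
  rw [enorm_exp_rpow, twist, ← ENNReal.ofReal_mul (Real.exp_pos _).le, ← Real.exp_add, ← ofReal_norm,
    Complex.norm_exp]
  refine ENNReal.ofReal_le_ofReal (Real.exp_le_exp.2 ?_)
  have := (abs_le.1 hz).1
  have hi : (0 : ℝ) ≤ i := by positivity
  simp [node]
  nlinarith

lemma le_enorm_exp_node {z : ℂ} (hz : |z.im| ≤ Real.pi / 2) (β : ℝ) (i : ℕ) :
    ‖Complex.exp z‖ₑ ^ β ≤ twist i * ‖Complex.exp (node β i * z)‖ₑ := by
  rw [enorm_exp_rpow, twist, ← ofReal_norm, ← ENNReal.ofReal_mul (Real.exp_pos _).le,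
    Complex.norm_exp, ← Real.exp_add]
  refine ENNReal.ofReal_le_ofReal (Real.exp_le_exp.2 ?_)
  have := (abs_le.1 hz).2
  have hi : (0 : ℝ) ≤ i := by positivity
  simp [node]
  nlinarith

lemma exists_interpolation (N : ℕ) (β : ℝ) : ∃ C : ℝ≥0∞, C ≠ ∞ ∧
    ∀ z : ℂ, |z.im| ≤ Real.pi / 2 → ∀ P : Polynomial ℂ, P.natDegree ≤ N →
      ‖Complex.exp z‖ₑ ^ β * ‖P.eval 0‖ₑ ≤
        C * ∑ i ∈ Finset.range (N + 1), ‖Complex.exp (node β i * z) * P.eval (node β i)‖ₑ := by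
  refine ⟨∑ i ∈ Finset.range (N + 1), twist i *
    ‖(Lagrange.basis (Finset.range (N + 1)) (node β) i).eval 0‖ₑ, ?_, fun z hz P hP => ?_⟩
  · exact ENNReal.sum_ne_top.2 fun i _ => ENNReal.mul_ne_top (twist_ne_top i) (by simp)
  have h1 : P.eval 0 = ∑ i ∈ Finset.range (N + 1),
      P.eval (node β i) * (Lagrange.basis (Finset.range (N + 1)) (node β) i).eval 0 := by
    conv_lhs => rw [Lagrange.eq_interpolate (s := Finset.range (N + 1)) (v := node β)
      (node_injective β).injOn (f := P) (by
        rw [Finset.card_range]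
        exact (Polynomial.degree_le_natDegree.trans_lt (by exact_mod_cast Nat.lt_succ_of_le hP)))]
    simp [Lagrange.interpolate_apply, Polynomial.eval_finsetSum]
  rw [h1]
  refine (mul_le_mul_right (enorm_sum_le _ _) _).trans ?_
  rw [Finset.mul_sum, Finset.sum_mul]
  refine Finset.sum_le_sum fun i hi => ?_
  calc ‖Complex.exp z‖ₑ ^ β *
        ‖P.eval (node β i) * (Lagrange.basis (Finset.range (N + 1)) (node β) i).eval 0‖ₑ
      ≤ twist i * ‖Complex.exp (node β i * z)‖ₑ * (‖P.eval (node β i)‖ₑ *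
        ‖(Lagrange.basis (Finset.range (N + 1)) (node β) i).eval 0‖ₑ) := by
        rw [enorm_mul]
        gcongr
        exact le_enorm_exp_node hz β i
    _ = (twist i * ‖(Lagrange.basis (Finset.range (N + 1)) (node β) i).eval 0‖ₑ) *
        ‖Complex.exp (node β i * z) * P.eval (node β i)‖ₑ := by
        rw [enorm_mul]; ring
    _ ≤ _ := by
        gcongr
        exact Finset.single_le_sum
          (f := fun i => ‖Complex.exp (node β i * z) * P.eval (node β i)‖ₑ)
          (fun _ _ => zero_le) hi

/-- Derivatives of `F exp(bψ)` are `exp(bψ)` times polynomials in `b`. -/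
lemma exists_polynomial_iteratedDeriv {F ψ : ℂ → ℂ} {U : Set ℂ} (hU : IsOpen U)
    (hF : DifferentiableOn ℂ F U) (hψ : DifferentiableOn ℂ ψ U) (k : ℕ) :
    ∃ u : ℕ → ℂ → ℂ, (∀ i, DifferentiableOn ℂ (u i) U) ∧ ∀ b, ∀ z ∈ U,
      iteratedDeriv k (fun z => F z * Complex.exp (b * ψ z)) z
        = Complex.exp (b * ψ z) * ∑ i ∈ Finset.range (k + 1), b ^ i * u i z := by
  induction k with
  | zero => exact ⟨fun _ => F, fun _ => hF, fun b z _ => by simp; ring⟩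
  | succ k ih =>
    obtain ⟨u, hu, h⟩ := ih
    set v : ℕ → ℂ → ℂ := fun i => if i ≤ k then u i else 0 with hv
    have hvd : ∀ i, DifferentiableOn ℂ (v i) U := fun i => by
      simp only [hv]; split_ifs
      · exact hu i
      · exact differentiableOn_const 0
    refine ⟨fun i z => deriv (v i) z + if i = 0 then 0 else deriv ψ z * v (i - 1) z, fun i => ?_,
      fun b z hz => ?_⟩
    · refine ((hvd i).deriv hU).add ?_
      split_ifs
      · exact differentiableOn_const 0
      · exact (hψ.deriv hU).mul (hvd _)
    · rw [iteratedDeriv_succ]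
      have h' : iteratedDeriv k (fun z => F z * Complex.exp (b * ψ z)) =ᶠ[𝓝 z]
          fun z => Complex.exp (b * ψ z) * ∑ i ∈ Finset.range (k + 1), b ^ i * v i z := by
        filter_upwards [hU.mem_nhds hz] with w hw
        rw [h b w hw]
        congr 1
        refine Finset.sum_congr rfl fun i hi => ?_
        rw [hv]; simp only
        rw [if_pos (Finset.mem_range_succ_iff.1 hi)]
      rw [h'.deriv_eq]
      have d1 := ((hψ.differentiableAt (hU.mem_nhds hz)).hasDerivAt.const_mul b).cexp
      have d2 : HasDerivAt (fun z => ∑ i ∈ Finset.range (k + 1), b ^ i * v i z)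
          (∑ i ∈ Finset.range (k + 1), b ^ i * deriv (v i) z) z :=
        HasDerivAt.fun_sum fun i _ =>
          (((hvd i).differentiableAt (hU.mem_nhds hz)).hasDerivAt.const_mul (b ^ i))
      rw [(d1.fun_mul d2).deriv]
      simp_rw [mul_add]
      rw [Finset.sum_add_distrib]
      have e1 : ∑ i ∈ Finset.range (k + 1 + 1), b ^ i * deriv (v i) z
          = ∑ i ∈ Finset.range (k + 1), b ^ i * deriv (v i) z := by
        rw [Finset.sum_range_succ]
        simp [hv]
      have e2 : ∑ i ∈ Finset.range (k + 1 + 1),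
          b ^ i * (if i = 0 then 0 else deriv ψ z * v (i - 1) z)
          = b * deriv ψ z * ∑ i ∈ Finset.range (k + 1), b ^ i * v i z := by
        rw [Finset.sum_range_succ', Finset.mul_sum]
        simp only [Nat.add_eq_zero_iff, one_ne_zero, and_false, if_false, if_true, mul_zero, add_zero,
          Nat.add_sub_cancel]
        refine Finset.sum_congr rfl fun i _ => ?_
        ring
      rw [e1, e2]
      ring

lemma exists_interpolation_iteratedDeriv (k : ℕ) (β : ℝ) : ∃ C : ℝ≥0∞, C ≠ ∞ ∧
    ∀ (U : Set ℂ) (F ψ : ℂ → ℂ), IsOpen U → DifferentiableOn ℂ F U → DifferentiableOn ℂ ψ U →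
      ∀ z ∈ U, |(ψ z).im| ≤ Real.pi / 2 →
      ‖Complex.exp (ψ z)‖ₑ ^ β * ‖iteratedDeriv k F z‖ₑ ≤ C * ∑ i ∈ Finset.range (k + 1),
        ‖iteratedDeriv k (fun w => F w * Complex.exp (node β i * ψ w)) z‖ₑ := by
  obtain ⟨C, hC, h⟩ := exists_interpolation k β
  refine ⟨C, hC, fun U F ψ hU hF hψ z hz him => ?_⟩
  obtain ⟨u, -, hu⟩ := exists_polynomial_iteratedDeriv hU hF hψ k
  set P : Polynomial ℂ := ∑ i ∈ Finset.range (k + 1), Polynomial.C (u i z) * Polynomial.X ^ i with hP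
  have hdeg : P.natDegree ≤ k := by
    refine Polynomial.natDegree_sum_le_of_forall_le _ _ fun i hi => ?_
    exact (Polynomial.natDegree_C_mul_X_pow_le _ _).trans (Finset.mem_range_succ_iff.1 hi)
  have hev : ∀ b, iteratedDeriv k (fun w => F w * Complex.exp (b * ψ w)) z
      = Complex.exp (b * ψ z) * P.eval b := fun b => by
    rw [hu b z hz, hP, Polynomial.eval_finsetSum]
    congr 1
    refine Finset.sum_congr rfl fun i _ => ?_
    rw [Polynomial.eval_C_mul, Polynomial.eval_pow, Polynomial.eval_X, mul_comm]
  have h0 : iteratedDeriv k F z = P.eval 0 := by simpa using hev 0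
  rw [h0]
  refine (h _ him P hdeg).trans (le_of_eq ?_)
  simp_rw [hev]

lemma rpow_mul_rpow_neg {a : ℝ≥0∞} (h0 : a ≠ 0) (ht : a ≠ ∞) (β : ℝ) : a ^ β * a ^ (-β) = 1 := by
  rw [← ENNReal.rpow_add _ _ h0 ht, add_neg_cancel, ENNReal.rpow_zero]

lemma add_sq_le_two_mul (a b : ℝ≥0∞) : (a + b) ^ 2 ≤ 2 * a ^ 2 + 2 * b ^ 2 := by
  have h := ENNReal.rpow_add_le_mul_rpow_add_rpow a b (p := 2) (by norm_num)
  simp only [ENNReal.rpow_two] at h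
  norm_num at h
  rwa [mul_add] at h

lemma rpow_half_sq (a : ℝ≥0∞) (p : ℝ) : (a ^ (p / 2)) ^ 2 = a ^ p := by
  rw [← ENNReal.rpow_two, ← ENNReal.rpow_mul, div_mul_cancel₀ _ two_ne_zero]

lemma enorm_exp_ne_zero (z : ℂ) : ‖Complex.exp z‖ₑ ≠ 0 := by simp

/-- A function holomorphic on a neighbourhood of the closed disc is dominated by a power of the
exponential of a holomorphic function with bounded argument. -/
lemma exists_majorant {F : ℂ → ℂ} (hF : AN F) {p : ℝ} (hp : 0 < p) {δ : ℝ≥0∞} (hδ : δ ≠ 0)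
    (hδt : δ ≠ ∞) : ∃ ψ : ℂ → ℂ, DifferentiableOn ℂ ψ (ball 0 1) ∧
      (∀ w ∈ ball (0 : ℂ) 1, |(ψ w).im| ≤ Real.pi / 2) ∧
      (∀ w ∈ ball (0 : ℂ) 1, ‖F w‖ₑ ≤ 128 ^ (2 / p) * ‖Complex.exp (ψ w)‖ₑ ^ (2 / p)) ∧
      (∀ r : ℝ, 0 < r → r < 1 → ∫⁻ x, ‖Complex.exp (ψ (r * circlePt x))‖ₑ ^ 2 ∂cm
        ≤ 4 * ∫⁻ y, ‖F (circlePt y)‖ₑ ^ p ∂cm + 4 * δ) := by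
  have hp2 : 0 < p / 2 := by positivity
  set G : ℂ → ℝ := fun z => ‖F z‖ ^ (p / 2) with hG
  have hGc : ContinuousOn G (closedBall 0 1) :=
    hF.continuousOn.norm.rpow_const fun _ _ => Or.inr hp2.le
  have hGe : ∀ z, ENNReal.ofReal (G z) = ‖F z‖ₑ ^ (p / 2) := fun z => by
    rw [hG, ← ofReal_norm, ENNReal.ofReal_rpow_of_nonneg (norm_nonneg _) hp2.le]
  obtain ⟨ε, hε, hε2⟩ : ∃ ε : ℝ, 0 < ε ∧ 2 * Real.pi * ε ^ 2 ≤ δ.toReal := by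
    have hd : 0 < δ.toReal := ENNReal.toReal_pos hδ hδt
    refine ⟨√(δ.toReal / (2 * Real.pi)), by positivity, ?_⟩
    rw [Real.sq_sqrt (by positivity)]
    field_simp
    exact le_rfl
  have huc := (isCompact_closedBall (0 : ℂ) 1).uniformContinuousOn_of_continuous hGc
  obtain ⟨η, hη, hη2⟩ := Metric.uniformContinuousOn_iff.1 huc ε hε
  set φ : ℝ → ℝ≥0∞ := fun y => ‖F (circlePt y)‖ₑ ^ (p / 2) + ENNReal.ofReal ε with hφ
  have hcF : Continuous fun y => F (circlePt y) := hF.continuous_circle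
  have hφm : Measurable φ := by
    have := hcF.enorm.measurable.pow_const (p / 2)
    exact this.add_const _
  obtain ⟨M, hM⟩ := (isCompact_closedBall (0 : ℂ) 1).exists_bound_of_continuousOn hF.continuousOn
  have hK : ∀ y, φ y ≤ ENNReal.ofReal M ^ (p / 2) + ENNReal.ofReal ε := fun y => by
    have : ‖F (circlePt y)‖ₑ ≤ ENNReal.ofReal M := by
      rw [← ofReal_norm]
      exact ENNReal.ofReal_le_ofReal (hM _ (circlePt_mem_closedBall y))
    simp only [hφ]
    gcongr
  obtain ⟨ψ, hψ, him, hle, hL2⟩ := exists_outer hφm (δ := ENNReal.ofReal ε)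
    (by simpa using hε) (fun y => le_add_self)
    (by simp [ENNReal.rpow_eq_top_iff, not_lt.2 hp2.le]) hK
  refine ⟨ψ, hψ, him, fun w hw => ?_, fun r h0 h1 => (hL2 r h0 h1).trans ?_⟩
  · have hbdry : ∀ z : ℂ, ‖z‖ < 1 → 1 - ‖z‖ < η / 40 →
        ‖F z‖ₑ ≤ 128 ^ (2 / p) * ‖Complex.exp (ψ z)‖ₑ ^ (2 / p) := by
      intro z hz hz2
      have hzb : z ∈ ball (0 : ℂ) 1 := by simpa using hz
      obtain ⟨l, x, hx, -, hbox⟩ := exists_mem_box hzb le_rfl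
      have hn := (norm_of_mem_box hbox).1
      have key : (1 / 2) ^ 1 / 64 * ‖F z‖ₑ ^ (p / 2) ≤ ‖Complex.exp (ψ z)‖ₑ := by
        refine (le_lintegral_pke hx hbox (φ := φ) fun y hy => ?_).trans (hle z hzb)
        have hd : dist z (circlePt y) < η := by
          rw [dist_comm, dist_eq_norm]
          refine (norm_circlePt_sub_le_of_mem_box (hy.symm ▸ hbox)).trans_lt ?_
          rw [pow_succ] at hn
          linarith
        have := hη2 z (ball_subset_closedBall hzb) _ (circlePt_mem_closedBall y) hd
        rw [Real.dist_eq] at this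
        simp only [hφ]
        rw [← hGe, ← hGe, ← ENNReal.ofReal_add (by positivity) hε.le]
        refine ENNReal.ofReal_le_ofReal ?_
        have := (abs_lt.1 this).2
        linarith
      have k2 : ‖F z‖ₑ ^ (p / 2) ≤ 128 * ‖Complex.exp (ψ z)‖ₑ := by
        calc ‖F z‖ₑ ^ (p / 2) = 128 * ((1 / 2) ^ 1 / 64 * ‖F z‖ₑ ^ (p / 2)) := by
              rw [← mul_assoc]
              have : (128 : ℝ≥0∞) * ((1 / 2) ^ 1 / 64) = 1 := by
                rw [← ENNReal.toReal_eq_toReal_iff' (by finiteness) (by simp)]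
                simp
                norm_num
              rw [this, one_mul]
          _ ≤ _ := by gcongr
      rw [← ENNReal.mul_rpow_of_nonneg _ _ (by positivity)]
      have : (2 / p) = (p / 2)⁻¹ := by rw [inv_div]
      rw [this, ENNReal.le_rpow_inv_iff hp2]
      exact k2
    set H : ℂ → ℂ := fun z => F z * Complex.exp (-(2 / p : ℝ) * ψ z) with hH
    have hHd : DifferentiableOn ℂ H (ball 0 1) :=
      hF.diffOn.mul (DifferentiableOn.cexp (hψ.const_mul _))
    have hHe : ∀ z, ‖H z‖ₑ = ‖F z‖ₑ * ‖Complex.exp (ψ z)‖ₑ ^ (-(2 / p)) := fun z => by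
      rw [hH, enorm_mul, enorm_exp_rpow, ← ofReal_norm (Complex.exp _), Complex.norm_exp]
      congr 3
      simp
    set B : ℝ≥0∞ := 128 ^ (2 / p) with hB
    have hBt : B ≠ ∞ := by simp [hB, ENNReal.rpow_eq_top_iff]
    have hHb : ∀ z : ℂ, ‖z‖ < 1 → 1 - ‖z‖ < η / 40 → ‖H z‖ ≤ B.toReal := by
      intro z h1 h2
      rw [← toReal_enorm]
      refine ENNReal.toReal_mono hBt ?_
      rw [hHe]
      calc _ ≤ 128 ^ (2 / p) * ‖Complex.exp (ψ z)‖ₑ ^ (2 / p)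
            * ‖Complex.exp (ψ z)‖ₑ ^ (-(2 / p)) := by gcongr; exact hbdry z h1 h2
        _ = B := by rw [mul_assoc, rpow_mul_rpow_neg (enorm_exp_ne_zero _) enorm_ne_top, mul_one]
    have hw1 : ‖w‖ < 1 := by simpa using hw
    obtain ⟨r, hr1, hr2⟩ := exists_between (max_lt hw1 (show 1 - η / 40 < 1 by linarith))
    have hr0 : 0 < r := (norm_nonneg w).trans_lt ((le_max_left _ _).trans_lt hr1)
    have hrη := (le_max_right _ _).trans_lt hr1
    have hmax : ‖H w‖ ≤ B.toReal := by
      refine Complex.norm_le_of_forall_mem_frontier_norm_le (U := ball (0 : ℂ) r) isBounded_ball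
        (DifferentiableOn.diffContOnCl (hHd.mono ?_)) ?_ (subset_closure ?_)
      · exact closure_ball_subset_closedBall.trans (closedBall_subset_ball hr2)
      · intro z hz
        rw [frontier_ball _ hr0.ne', mem_sphere_zero_iff_norm] at hz
        exact hHb z (by rw [hz]; exact hr2) (by rw [hz]; linarith)
      · rw [mem_ball_zero_iff]
        exact (le_max_left _ _).trans_lt hr1
    have hmax2 : ‖H w‖ₑ ≤ B := by
      rw [← ofReal_norm, ← ENNReal.ofReal_toReal hBt]
      exact ENNReal.ofReal_le_ofReal hmax
    calc ‖F w‖ₑ = ‖H w‖ₑ * ‖Complex.exp (ψ w)‖ₑ ^ (2 / p) := by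
          rw [hHe, mul_assoc, mul_comm (_ ^ (-(2 / p))),
            rpow_mul_rpow_neg (enorm_exp_ne_zero _) enorm_ne_top, mul_one]
      _ ≤ _ := by gcongr
  · have h2 : ∀ y, φ y ^ 2 ≤ 2 * ‖F (circlePt y)‖ₑ ^ p + 2 * ENNReal.ofReal (ε ^ 2) := fun y => by
      have h := add_sq_le_two_mul (‖F (circlePt y)‖ₑ ^ (p / 2)) (ENNReal.ofReal ε)
      rwa [rpow_half_sq, ← ENNReal.ofReal_pow hε.le] at h
    calc 2 * ∫⁻ y, φ y ^ 2 ∂cm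
        ≤ 2 * ∫⁻ y, (2 * ‖F (circlePt y)‖ₑ ^ p + 2 * ENNReal.ofReal (ε ^ 2)) ∂cm := by
          gcongr; exact h2 _
      _ = 4 * ∫⁻ y, ‖F (circlePt y)‖ₑ ^ p ∂cm + 4 * (ENNReal.ofReal (ε ^ 2) * cm univ) := by
          rw [lintegral_add_right _ measurable_const, lintegral_const_mul _
            (hcF.enorm.measurable.pow_const p), lintegral_const]
          ring
      _ ≤ _ := by
          gcongr
          rw [cm_univ, ← ENNReal.ofReal_mul (by positivity), ← ENNReal.ofReal_toReal hδt]
          refine ENNReal.ofReal_le_ofReal ?_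
          linarith

lemma Hl_le_of_forall {p : ℝ} {F : ℂ → ℂ} {B : ℝ≥0∞} (h : ∀ r : ℝ, 0 < r → r < 1 →
    ∫⁻ y, ‖F (r * circlePt y)‖ₑ ^ p ∂cm ≤ B) : Hl p F ≤ B := by
  refine liminf_le_of_le (by isBoundedDefault) fun b hb => ?_
  have h1 : ∀ᶠ r : ℝ in 𝓝[<] 1, 0 < r ∧ r < 1 := by
    filter_upwards [Ioo_mem_nhdsLT (show (0 : ℝ) < 1 by norm_num)] with r hr using hr
  obtain ⟨r, hr1, hr2⟩ := (hb.and h1).exists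
  exact hr1.trans (h r hr2.1 hr2.2)

lemma le_of_forall_le_mul_add {A C I : ℝ≥0∞} (hC : C ≠ ∞)
    (h : ∀ δ : ℝ≥0∞, δ ≠ 0 → δ ≠ ∞ → A ≤ C * (I + δ)) : A ≤ C * I := by
  refine ENNReal.le_of_forall_pos_le_add fun ε hε _ => ?_
  have hC1 : C + 1 ≠ ∞ := by finiteness
  have hC0 : C + 1 ≠ 0 := by simp
  refine (h (ε / (C + 1)) ?_ ?_).trans ?_
  · exact (ENNReal.div_pos (by simpa using hε.ne') hC1).ne'
  · exact ENNReal.div_ne_top (by simp) hC0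
  · rw [mul_add]
    gcongr
    calc C * (ε / (C + 1)) ≤ (C + 1) * (ε / (C + 1)) := by gcongr; exact le_self_add
      _ = ε := ENNReal.mul_div_cancel hC0 hC1

lemma cs_le {κ j : ℕ} {F : ℂ → ℂ} {l : ℕ} {x : ℝ} {K : ℝ≥0∞}
    (h : ∀ w ∈ box κ l (cell l x), ‖iteratedDeriv j F w‖ₑ * (1 / 2) ^ (l * j) ≤ K) :
    cs κ j F l x ≤ K := iSup₂_le h

/-- Comparison of the derivatives of `F` with those of its twists by powers of `exp ψ`. -/
lemma exists_cs_le_rpow_mul_sum (κ j : ℕ) {β : ℝ} (hβ : 0 ≤ β) : ∃ C : ℝ≥0∞, C ≠ ∞ ∧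
    ∀ F ψ : ℂ → ℂ, DifferentiableOn ℂ F (ball 0 1) → DifferentiableOn ℂ ψ (ball 0 1) →
      (∀ w ∈ ball (0 : ℂ) 1, |(ψ w).im| ≤ Real.pi / 2) → ∀ l x,
      cs κ j F l x ≤ C * cs κ 0 (fun w => Complex.exp (ψ w)) l x ^ β * ∑ i ∈ Finset.range (j + 1),
        cs κ j (fun w => F w * Complex.exp (node (-β) i * ψ w)) l x := by
  obtain ⟨C, hC, h⟩ := exists_interpolation_iteratedDeriv j (-β)
  refine ⟨C, hC, fun F ψ hF hψ him l x => cs_le fun w hw => ?_⟩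
  have hwb := box_subset_ball hw
  have h1 := h _ F ψ isOpen_ball hF hψ w hwb (him w hwb)
  have h2 : ‖Complex.exp (ψ w)‖ₑ ≤ cs κ 0 (fun w => Complex.exp (ψ w)) l x := by
    simpa using le_cs (j := 0) (F := fun w => Complex.exp (ψ w)) hw
  calc ‖iteratedDeriv j F w‖ₑ * (1 / 2) ^ (l * j)
      = ‖Complex.exp (ψ w)‖ₑ ^ β * (‖Complex.exp (ψ w)‖ₑ ^ (-β) * ‖iteratedDeriv j F w‖ₑ)
        * (1 / 2) ^ (l * j) := by
        rw [← mul_assoc, rpow_mul_rpow_neg (enorm_exp_ne_zero _) enorm_ne_top, one_mul]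
    _ ≤ cs κ 0 (fun w => Complex.exp (ψ w)) l x ^ β * (C * ∑ i ∈ Finset.range (j + 1),
        ‖iteratedDeriv j (fun w => F w * Complex.exp (node (-β) i * ψ w)) w‖ₑ)
        * (1 / 2) ^ (l * j) := by gcongr
    _ = C * cs κ 0 (fun w => Complex.exp (ψ w)) l x ^ β * ∑ i ∈ Finset.range (j + 1),
        ‖iteratedDeriv j (fun w => F w * Complex.exp (node (-β) i * ψ w)) w‖ₑ
        * (1 / 2) ^ (l * j) := by rw [← Finset.sum_mul]; ring
    _ ≤ _ := by
        gcongr with i hi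
        exact le_cs hw

lemma exists_rpow_mul_cs_le_sum (κ j : ℕ) {β : ℝ} (hβ : 0 ≤ β) : ∃ C : ℝ≥0∞, C ≠ ∞ ∧
    ∀ F ψ : ℂ → ℂ, DifferentiableOn ℂ F (ball 0 1) → DifferentiableOn ℂ ψ (ball 0 1) →
      (∀ w ∈ ball (0 : ℂ) 1, |(ψ w).im| ≤ Real.pi / 2) → ∀ l x (m : ℝ≥0∞),
      (∀ w ∈ box κ l (cell l x), m ≤ ‖Complex.exp (ψ w)‖ₑ) →
      m ^ β * cs κ j F l x ≤ C * ∑ i ∈ Finset.range (j + 1),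
        cs κ j (fun w => F w * Complex.exp (node β i * ψ w)) l x := by
  obtain ⟨C, hC, h⟩ := exists_interpolation_iteratedDeriv j β
  refine ⟨C, hC, fun F ψ hF hψ him l x m hm => ?_⟩
  unfold cs
  simp_rw [ENNReal.mul_iSup]
  refine iSup₂_le fun w hw => ?_
  have hwb := box_subset_ball hw
  have h1 := h _ F ψ isOpen_ball hF hψ w hwb (him w hwb)
  calc m ^ β * (‖iteratedDeriv j F w‖ₑ * (1 / 2) ^ (l * j))
      ≤ ‖Complex.exp (ψ w)‖ₑ ^ β * ‖iteratedDeriv j F w‖ₑ * (1 / 2) ^ (l * j) := by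
        rw [mul_assoc]; gcongr; exact hm w hw
    _ ≤ C * ∑ i ∈ Finset.range (j + 1),
        ‖iteratedDeriv j (fun w => F w * Complex.exp (node β i * ψ w)) w‖ₑ
        * (1 / 2) ^ (l * j) := by
        rw [← Finset.sum_mul, ← mul_assoc]; gcongr
    _ ≤ _ := by
        gcongr with i hi
        exact le_cs (F := fun w => F w * Complex.exp (node β i * ψ w)) hw

lemma cs_le_of_bounded {κ j : ℕ} {F : ℂ → ℂ} (hF : DifferentiableOn ℂ F (ball 0 1)) {K : ℝ≥0∞}
    (hK : ∀ z ∈ ball (0 : ℂ) 1, ‖F z‖ₑ ≤ K) (l : ℕ) (x : ℝ) : cs κ j F l x ≤ cauc κ j * K := by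
  refine cs_le_of_near hF fun z _ hz => hK z ?_
  rw [mem_ball_zero_iff]
  have : (0 : ℝ) < (1 / 2) ^ (l + κ + 1) := by positivity
  linarith

lemma cs_le_NM (κ j : ℕ) (F : ℂ → ℂ) (l : ℕ) (x : ℝ) : cs κ j F l x ≤ NM κ j F x :=
  le_iSup (fun l => cs κ j F l x) l

/-- Nontangential maximal theorem for analytic functions, for all exponents. -/
lemma lintegral_NM_le (κ j : ℕ) {p : ℝ} (hp : 0 < p) : ∃ C : ℝ≥0∞, C ≠ ∞ ∧
    ∀ F : ℂ → ℂ, DifferentiableOn ℂ F (ball 0 1) → ∫⁻ x, NM κ j F x ^ p ∂cm ≤ C * Hl p F := by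
  have hp2 : 0 ≤ 2 / p := by positivity
  obtain ⟨C₁, hC₁, h₁⟩ := exists_cs_le_rpow_mul_sum (κ + 1) j hp2
  obtain ⟨C₂, hC₂, h₂⟩ := lintegral_NM_le_of_two_le (κ + 1) 0 le_rfl
  set D : ℝ≥0∞ := C₁ * ∑ i ∈ Finset.range (j + 1), cauc (κ + 1) j * (128 ^ (2 / p) * twist i) with hD
  have hDt : D ≠ ∞ := by
    refine ENNReal.mul_ne_top hC₁ (ENNReal.sum_ne_top.2 fun i _ => ?_)
    refine ENNReal.mul_ne_top (cauc_ne_top _ _) (ENNReal.mul_ne_top ?_ (twist_ne_top i))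
    exact ENNReal.rpow_ne_top_of_nonneg hp2 (by norm_num)
  have hDp : D ^ p ≠ ∞ := ENNReal.rpow_ne_top_of_nonneg hp.le hDt
  have key : ∀ G, AN G → ∫⁻ x, NM (κ + 1) j G x ^ p ∂cm
      ≤ D ^ p * C₂ * 4 * ∫⁻ y, ‖G (circlePt y)‖ₑ ^ p ∂cm := by
    intro G hG
    refine le_of_forall_le_mul_add (by finiteness) fun δ hδ hδt => ?_
    obtain ⟨ψ, hψ, him, hle, hL2⟩ := exists_majorant hG hp hδ hδt
    have hpt : ∀ x, NM (κ + 1) j G x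
        ≤ D * NM (κ + 1) 0 (fun w => Complex.exp (ψ w)) x ^ (2 / p) := fun x => by
      refine iSup_le fun l => (h₁ G ψ hG.diffOn hψ him l x).trans ?_
      have hb : ∀ i, cs (κ + 1) j (fun w => G w * Complex.exp (node (-(2 / p)) i * ψ w)) l x
          ≤ cauc (κ + 1) j * (128 ^ (2 / p) * twist i) := fun i => by
        refine cs_le_of_bounded (hG.diffOn.fun_mul (DifferentiableOn.cexp (hψ.const_mul _)))
          (fun z hz => ?_) l x
        rw [enorm_mul]
        calc _ ≤ 128 ^ (2 / p) * ‖Complex.exp (ψ z)‖ₑ ^ (2 / p)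
              * (twist i * ‖Complex.exp (ψ z)‖ₑ ^ (-(2 / p))) := by
              gcongr
              · exact hle z hz
              · exact enorm_exp_node_le (him z hz) _ i
          _ = 128 ^ (2 / p) * twist i * (‖Complex.exp (ψ z)‖ₑ ^ (2 / p)
              * ‖Complex.exp (ψ z)‖ₑ ^ (-(2 / p))) := by ring
          _ = _ := by rw [rpow_mul_rpow_neg (enorm_exp_ne_zero _) enorm_ne_top, mul_one]
      calc _ ≤ C₁ * NM (κ + 1) 0 (fun w => Complex.exp (ψ w)) x ^ (2 / p)
            * ∑ i ∈ Finset.range (j + 1), cauc (κ + 1) j * (128 ^ (2 / p) * twist i) := by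
            gcongr with i hi
            · exact cs_le_NM _ _ _ _ _
            · exact hb i
        _ = _ := by rw [hD]; ring
    calc ∫⁻ x, NM (κ + 1) j G x ^ p ∂cm
        ≤ ∫⁻ x, D ^ p * NM (κ + 1) 0 (fun w => Complex.exp (ψ w)) x ^ (2 : ℝ) ∂cm := by
          refine lintegral_mono fun x => ?_
          calc _ ≤ _ := ENNReal.rpow_le_rpow (hpt x) hp.le
            _ = _ := by
              rw [ENNReal.mul_rpow_of_nonneg _ _ hp.le, ← ENNReal.rpow_mul,
                div_mul_cancel₀ _ hp.ne']
      _ = D ^ p * ∫⁻ x, NM (κ + 1) 0 (fun w => Complex.exp (ψ w)) x ^ (2 : ℝ) ∂cm :=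
          lintegral_const_mul _ ((measurable_NM _ _ _).pow_const _)
      _ ≤ D ^ p * (C₂ * (4 * ∫⁻ y, ‖G (circlePt y)‖ₑ ^ p ∂cm + 4 * δ)) := by
          gcongr
          refine (h₂ _ hψ.cexp).trans ?_
          gcongr
          refine Hl_le_of_forall fun r h0 h1 => ?_
          simpa using hL2 r h0 h1
      _ = _ := by ring
  refine ⟨2 ^ (j * p) * (D ^ p * C₂ * 4), ENNReal.mul_ne_top
    (ENNReal.rpow_ne_top_of_nonneg (by positivity) (by norm_num)) (by finiteness), fun F hF =>
    lintegral_NM_le_Hl hp (by finiteness) key hF⟩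

lemma sq_sum_range_le (n : ℕ) (a : ℕ → ℝ≥0∞) :
    (∑ i ∈ Finset.range n, a i) ^ 2 ≤ n * ∑ i ∈ Finset.range n, a i ^ 2 := by
  have h := ENNReal.inner_le_Lp_mul_Lq (Finset.range n) (fun _ => 1) a
    (p := 2) (q := 2) Real.HolderConjugate.two_two
  simp only [one_mul, ENNReal.rpow_two, one_pow, Finset.sum_const, Finset.card_range,
    nsmul_eq_mul, mul_one] at h
  calc _ ≤ ((n : ℝ≥0∞) ^ (1 / 2 : ℝ) * (∑ i ∈ Finset.range n, a i ^ 2) ^ (1 / 2 : ℝ)) ^ 2 := by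
        gcongr
    _ = _ := by
        rw [mul_pow, ← ENNReal.rpow_two, ← ENNReal.rpow_two, ← ENNReal.rpow_mul, ← ENNReal.rpow_mul]
        norm_num

lemma lintegral_sum_range {n : ℕ} {f : ℕ → ℝ → ℝ≥0∞} (hf : ∀ i, Measurable (f i)) :
    ∫⁻ x, ∑ i ∈ Finset.range n, f i x ∂cm = ∑ i ∈ Finset.range n, ∫⁻ x, f i x ∂cm :=
  lintegral_finsetSum _ fun i _ => hf i

lemma exists_lintegral_SQ_le_of_lt_two (κ : ℕ) {j : ℕ} (hj : 1 ≤ j) {p : ℝ} (hp : 0 < p)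
    (hp2 : p < 2) : ∃ C : ℝ≥0∞, C ≠ ∞ ∧ ∀ G, AN G →
      ∫⁻ x, SQ κ j G x ^ (p / 2) ∂cm ≤ C * ∫⁻ y, ‖G (circlePt y)‖ₑ ^ p ∂cm := by
  set β : ℝ := (2 - p) / p with hβ
  have hβ0 : 0 ≤ β := div_nonneg (by linarith) hp.le
  obtain ⟨C₁, hC₁, h₁⟩ := exists_cs_le_rpow_mul_sum κ j hβ0
  obtain ⟨C₂, hC₂, h₂⟩ := lintegral_NM_le_of_two_le κ 0 le_rfl
  obtain ⟨C₃, hC₃, h₃⟩ := lintegral_SQ_le_two κ hj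
  set T : ℝ≥0∞ := ∑ i ∈ Finset.range (j + 1), (128 ^ (2 / p) * twist i) ^ 2 with hT
  have hTt : T ≠ ∞ := by
    refine ENNReal.sum_ne_top.2 fun i _ => ENNReal.pow_ne_top (ENNReal.mul_ne_top ?_ (twist_ne_top i))
    exact ENNReal.rpow_ne_top_of_nonneg (by positivity) (by norm_num)
  set D : ℝ≥0∞ := (C₁ ^ 2 * (j + 1 : ℕ)) ^ (p / 2) with hD
  have hDt : D ≠ ∞ := ENNReal.rpow_ne_top_of_nonneg (by positivity) (by finiteness)
  have hC₂' : C₂ ^ (1 - p / 2) ≠ ∞ := ENNReal.rpow_ne_top_of_nonneg (by linarith) hC₂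
  have hC₃' : (C₃ * T) ^ (p / 2) ≠ ∞ := ENNReal.rpow_ne_top_of_nonneg (by positivity) (by finiteness)
  refine ⟨D * C₂ ^ (1 - p / 2) * (C₃ * T) ^ (p / 2) * 4, by finiteness, fun G hG => ?_⟩
  refine le_of_forall_le_mul_add (by finiteness) fun δ hδ hδt => ?_
  obtain ⟨ψ, hψ, him, hle, hL2⟩ := exists_majorant hG hp hδ hδt
  set V : ℂ → ℂ := fun w => Complex.exp (ψ w) with hV
  set H : ℕ → ℂ → ℂ := fun i w => G w * Complex.exp (node (-β) i * ψ w) with hH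
  set B : ℝ≥0∞ := 4 * ∫⁻ y, ‖G (circlePt y)‖ₑ ^ p ∂cm + 4 * δ with hB
  have hVB : Hl 2 V ≤ B := Hl_le_of_forall fun r h0 h1 => by simpa using hL2 r h0 h1
  have hHd : ∀ i, DifferentiableOn ℂ (H i) (ball 0 1) := fun i =>
    hG.diffOn.fun_mul (DifferentiableOn.cexp (hψ.const_mul _))
  have hHle : ∀ i, ∀ z ∈ ball (0 : ℂ) 1, ‖H i z‖ₑ ≤ 128 ^ (2 / p) * twist i * ‖V z‖ₑ := by
    intro i z hz
    rw [hH, enorm_mul]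
    calc _ ≤ 128 ^ (2 / p) * ‖V z‖ₑ ^ (2 / p) * (twist i * ‖V z‖ₑ ^ (-β)) := by
          gcongr
          · exact hle z hz
          · exact enorm_exp_node_le (him z hz) _ i
      _ = 128 ^ (2 / p) * twist i * (‖V z‖ₑ ^ (2 / p) * ‖V z‖ₑ ^ (-β)) := by ring
      _ = _ := by
          rw [← ENNReal.rpow_add _ _ (enorm_exp_ne_zero _) enorm_ne_top]
          have : 2 / p + -β = 1 := by rw [hβ]; field_simp; ring
          rw [this, ENNReal.rpow_one]
  have hHB : ∀ i, Hl 2 (H i) ≤ (128 ^ (2 / p) * twist i) ^ 2 * B := fun i => by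
    refine Hl_le_of_forall fun r h0 h1 => ?_
    calc ∫⁻ y, ‖H i (r * circlePt y)‖ₑ ^ (2 : ℝ) ∂cm
        ≤ ∫⁻ y, (128 ^ (2 / p) * twist i) ^ 2 * ‖V (r * circlePt y)‖ₑ ^ 2 ∂cm := by
          refine lintegral_mono fun y => ?_
          rw [ENNReal.rpow_two, ← mul_pow]
          gcongr
          exact hHle i _ (smul_circlePt_mem_ball h0.le h1 y)
      _ = (128 ^ (2 / p) * twist i) ^ 2 * ∫⁻ y, ‖V (r * circlePt y)‖ₑ ^ 2 ∂cm := by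
          refine lintegral_const_mul _ (Measurable.pow_const (Continuous.measurable ?_) 2)
          exact (continuous_slice hψ.cexp.continuousOn h0.le h1).enorm
      _ ≤ _ := by gcongr; exact hL2 r h0 h1
  have hpt : ∀ x, SQ κ j G x ^ (p / 2) ≤ D * ((NM κ 0 V x ^ (2 : ℝ)) ^ (1 - p / 2)
      * (∑ i ∈ Finset.range (j + 1), SQ κ j (H i) x) ^ (p / 2)) := by
    intro x
    have h : SQ κ j G x ≤ C₁ ^ 2 * (j + 1 : ℕ) * (NM κ 0 V x ^ (2 * β)
        * ∑ i ∈ Finset.range (j + 1), SQ κ j (H i) x) := by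
      calc SQ κ j G x ≤ ∑' l, C₁ ^ 2 * NM κ 0 V x ^ (2 * β) * ((j + 1 : ℕ) *
            ∑ i ∈ Finset.range (j + 1), cs κ j (H i) l x ^ 2) := by
            refine ENNReal.tsum_le_tsum fun l => ?_
            calc cs κ j G l x ^ 2 ≤ (C₁ * NM κ 0 V x ^ β
                  * ∑ i ∈ Finset.range (j + 1), cs κ j (H i) l x) ^ 2 := by
                  gcongr
                  refine (h₁ G ψ hG.diffOn hψ him l x).trans ?_
                  gcongr
                  exact cs_le_NM _ _ _ _ _
              _ = C₁ ^ 2 * NM κ 0 V x ^ (2 * β)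
                  * (∑ i ∈ Finset.range (j + 1), cs κ j (H i) l x) ^ 2 := by
                  rw [mul_pow, mul_pow, ← ENNReal.rpow_natCast (_ ^ β), ← ENNReal.rpow_mul,
                    mul_comm β]
                  rfl
              _ ≤ _ := by gcongr; exact sq_sum_range_le _ _
        _ = _ := by
            rw [ENNReal.tsum_mul_left, ENNReal.tsum_mul_left,
              Summable.tsum_finsetSum fun _ _ => ENNReal.summable]
            simp only [SQ]
            ring
    refine (ENNReal.rpow_le_rpow h (by positivity)).trans (le_of_eq ?_)
    rw [ENNReal.mul_rpow_of_nonneg _ (NM κ 0 V x ^ (2 * β) * _) (by positivity),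
      ENNReal.mul_rpow_of_nonneg (NM κ 0 V x ^ (2 * β)) _ (by positivity), ← ENNReal.rpow_mul, ← ENNReal.rpow_mul]
    have : 2 * β * (p / 2) = 2 * (1 - p / 2) := by rw [hβ]; field_simp
    rw [this]
  have hm1 : Measurable fun x => NM κ 0 V x ^ (2 : ℝ) := (measurable_NM _ _ _).pow_const _
  have hm2 : Measurable fun x => ∑ i ∈ Finset.range (j + 1), SQ κ j (H i) x :=
    Finset.measurable_fun_sum _ fun i _ => measurable_SQ κ j (H i)
  calc ∫⁻ x, SQ κ j G x ^ (p / 2) ∂cm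
      ≤ ∫⁻ x, D * ((NM κ 0 V x ^ (2 : ℝ)) ^ (1 - p / 2)
      * (∑ i ∈ Finset.range (j + 1), SQ κ j (H i) x) ^ (p / 2)) ∂cm := lintegral_mono hpt
    _ = D * ∫⁻ x, (NM κ 0 V x ^ (2 : ℝ)) ^ (1 - p / 2)
      * (∑ i ∈ Finset.range (j + 1), SQ κ j (H i) x) ^ (p / 2) ∂cm :=
        lintegral_const_mul _ ((hm1.pow_const _).fun_mul (hm2.pow_const _))
    _ ≤ D * ((∫⁻ x, NM κ 0 V x ^ (2 : ℝ) ∂cm) ^ (1 - p / 2)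
      * (∫⁻ x, ∑ i ∈ Finset.range (j + 1), SQ κ j (H i) x ∂cm) ^ (p / 2)) := by
        gcongr
        exact ENNReal.lintegral_mul_norm_pow_le hm1.aemeasurable hm2.aemeasurable
          (by linarith) (by positivity) (by ring)
    _ ≤ D * ((C₂ * B) ^ (1 - p / 2) * (C₃ * T * B) ^ (p / 2)) := by
        gcongr
        · linarith
        · exact (h₂ _ hψ.cexp).trans (by gcongr)
        · rw [lintegral_sum_range fun i => measurable_SQ κ j (H i), hT, Finset.mul_sum,
            Finset.sum_mul]
          refine Finset.sum_le_sum fun i _ => (h₃ _ (hHd i)).trans ?_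
          rw [mul_assoc]
          gcongr
          exact hHB i
    _ = D * C₂ ^ (1 - p / 2) * (C₃ * T) ^ (p / 2) * (B ^ (1 - p / 2) * B ^ (p / 2)) := by
        rw [ENNReal.mul_rpow_of_nonneg _ _ (by linarith),
          ENNReal.mul_rpow_of_nonneg _ _ (by positivity)]
        ring
    _ = _ := by
        rw [← ENNReal.rpow_add_of_nonneg _ _ (by linarith) (by positivity), sub_add_cancel,
          ENNReal.rpow_one, hB]
        ring

/-- Truncated square function of the normalised `j`-th derivatives. -/
noncomputable def XS (κ j : ℕ) (F : ℂ → ℂ) (L : ℕ) (x : ℝ) : ℝ≥0∞ :=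
  ∑ l ∈ Finset.range L, cs κ j F l x ^ 2

lemma measurable_XS (κ j : ℕ) (F : ℂ → ℂ) (L : ℕ) : Measurable (XS κ j F L) :=
  Finset.measurable_fun_sum _ fun l _ => (measurable_cs κ j F l).pow_const 2

lemma XS_congr {κ j : ℕ} {F : ℂ → ℂ} {l m : ℕ} (hm : m ≤ l + 1) {x y : ℝ}
    (h : cell l x = cell l y) : XS κ j F m x = XS κ j F m y :=
  Finset.sum_congr rfl fun k hk => by
    rw [cs_congr_cell (cell_eq_of_le (by have := Finset.mem_range.1 hk; omega) h)]

lemma XS_mono (κ j : ℕ) (F : ℂ → ℂ) (x : ℝ) : Monotone fun L => XS κ j F L x :=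
  fun _ _ h => Finset.sum_le_sum_of_subset (Finset.range_mono h)

lemma SQ_eq_iSup (κ j : ℕ) (F : ℂ → ℂ) (x : ℝ) : SQ κ j F x = ⨆ L, XS κ j F L x :=
  ENNReal.tsum_eq_iSup_nat

lemma XS_le_SQ (κ j : ℕ) (F : ℂ → ℂ) (L : ℕ) (x : ℝ) : XS κ j F L x ≤ SQ κ j F x :=
  ENNReal.sum_le_tsum _

lemma lintegral_SQ_rpow (κ j : ℕ) (F : ℂ → ℂ) {e : ℝ} (he : 0 < e) :
    ∫⁻ x, SQ κ j F x ^ e ∂cm = ⨆ L, ∫⁻ x, XS κ j F L x ^ e ∂cm := by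
  simp_rw [SQ_eq_iSup]
  exact lintegral_iSup_rpow (measurable_XS κ j F) (fun _ _ h x => XS_mono κ j F x h) he

lemma add_rpow_le (A a : ℝ≥0∞) {e : ℝ} (he : 0 ≤ e) :
    (A + a) ^ (e + 1) ≤ A ^ (e + 1) + ENNReal.ofReal (e + 1) * (a * (A + a) ^ e) := by
  rcases eq_or_ne A ∞ with rfl | hA
  · simp [ENNReal.top_rpow_of_pos (show 0 < e + 1 by linarith)]
  rcases eq_or_ne a ∞ with rfl | ha
  · rw [add_top]
    have : (∞ : ℝ≥0∞) ^ e ≠ 0 := by simp [ENNReal.rpow_eq_zero_iff, not_lt.2 he]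
    rw [ENNReal.top_mul this, ENNReal.mul_top (by simp; linarith), add_top]
    exact le_top
  lift A to NNReal using hA
  lift a to NNReal using ha
  have hr : ((A : ℝ) + a) ^ (e + 1) ≤ (A : ℝ) ^ (e + 1) + (e + 1) * (a * ((A : ℝ) + a) ^ e) := by
    rcases eq_or_lt_of_le (show (0 : ℝ) ≤ A + a by positivity) with h | h
    · rw [← h, Real.zero_rpow (by linarith)]
      positivity
    have hb := one_add_mul_self_le_rpow_one_add (s := -(a / (A + a) : ℝ)) (p := e + 1)
      (by rw [neg_le_neg_iff, div_le_one h]; simp) (by linarith)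
    have e1 : (1 : ℝ) + -(a / (A + a) : ℝ) = A / (A + a) := by field_simp; ring
    rw [e1, Real.div_rpow (by positivity) h.le, le_div_iff₀ (by positivity)] at hb
    have e2 : ((A : ℝ) + a) ^ (e + 1) = (A + a) ^ e * (A + a) := Real.rpow_add_one h.ne' e
    rw [e2] at hb ⊢
    have e3 : (1 + (e + 1) * -(a / (A + a) : ℝ)) * ((A + a) ^ e * (A + a))
        = (A + a) ^ e * (A + a) - (e + 1) * (a * ((A : ℝ) + a) ^ e) := by field_simp; ring
    linarith
  have he1 : 0 ≤ e + 1 := by linarith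
  have key := ENNReal.ofReal_le_ofReal hr
  rw [ENNReal.ofReal_add (by positivity) (by positivity), ENNReal.ofReal_mul he1,
    ENNReal.ofReal_mul (by positivity), ← ENNReal.ofReal_rpow_of_nonneg (by positivity) he1,
    ← ENNReal.ofReal_rpow_of_nonneg (by positivity) he1,
    ← ENNReal.ofReal_rpow_of_nonneg (by positivity) he,
    ENNReal.ofReal_add (by positivity) (by positivity)] at key
  simpa using key

lemma sum_rpow_le (a : ℕ → ℝ≥0∞) {e : ℝ} (he : 0 ≤ e) (L : ℕ) :
    (∑ l ∈ Finset.range L, a l) ^ (e + 1) ≤ ENNReal.ofReal (e + 1) *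
      ∑ l ∈ Finset.range L, a l * (∑ m ∈ Finset.range (l + 1), a m) ^ e := by
  induction L with
  | zero => simp [ENNReal.zero_rpow_of_pos (show 0 < e + 1 by linarith)]
  | succ L ih =>
    rw [Finset.sum_range_succ, Finset.sum_range_succ _ L, mul_add]
    refine (add_rpow_le _ _ he).trans ?_
    gcongr ?_ + ?_
    rw [Finset.sum_range_succ]

/-- A holomorphic logarithm whose exponential dominates powers of the truncated square function. -/
lemma exists_stopping (κ j : ℕ) (F : ℂ → ℂ) (L : ℕ) {K : ℝ≥0∞} (hK : K ≠ ∞)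
    (hFK : ∀ x, XS κ j F L x ≤ K) {t : ℝ} (ht : 0 < t) {δ : ℝ≥0∞} (hδ : δ ≠ 0) (hδt : δ ≠ ∞) :
    ∃ ψ : ℂ → ℂ, DifferentiableOn ℂ ψ (ball 0 1) ∧
      (∀ w ∈ ball (0 : ℂ) 1, |(ψ w).im| ≤ Real.pi / 2) ∧
      (∀ l < L, ∀ x ∈ Ioc 0 (2 * Real.pi), ∀ w ∈ box κ l (cell l x),
        (1 / 2) ^ κ / 64 * XS κ j F (l + 1) x ^ (t / 2) ≤ ‖Complex.exp (ψ w)‖ₑ) ∧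
      (∀ r : ℝ, 0 < r → r < 1 → ∫⁻ x, ‖Complex.exp (ψ (r * circlePt x))‖ₑ ^ 2 ∂cm
        ≤ 4 * ∫⁻ y, XS κ j F L y ^ t ∂cm + 4 * δ) := by
  have ht2 : 0 ≤ t / 2 := by positivity
  obtain ⟨ε, hε, hε2⟩ : ∃ ε : ℝ, 0 < ε ∧ 2 * Real.pi * ε ^ 2 ≤ δ.toReal := by
    have hd : 0 < δ.toReal := ENNReal.toReal_pos hδ hδt
    refine ⟨√(δ.toReal / (2 * Real.pi)), by positivity, ?_⟩
    rw [Real.sq_sqrt (by positivity)]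
    field_simp
    exact le_rfl
  set φ : ℝ → ℝ≥0∞ := fun y => XS κ j F L y ^ (t / 2) + ENNReal.ofReal ε with hφ
  have hφm : Measurable φ := ((measurable_XS κ j F L).pow_const (t / 2)).add_const _
  have hKb : ∀ y, φ y ≤ K ^ (t / 2) + ENNReal.ofReal ε := fun y => by
    simp only [hφ]; gcongr; exact hFK y
  obtain ⟨ψ, hψ, him, hle, hL2⟩ := exists_outer hφm (δ := ENNReal.ofReal ε)
    (by simpa using hε) (fun y => le_add_self)
    (by have := ENNReal.rpow_ne_top_of_nonneg ht2 hK; finiteness) hKb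
  refine ⟨ψ, hψ, him, fun l hl x hx w hw => ?_, fun r h0 h1 => (hL2 r h0 h1).trans ?_⟩
  · refine (le_lintegral_pke hx hw (φ := φ) fun y hy => ?_).trans (hle w (box_subset_ball hw))
    refine le_trans ?_ le_self_add
    gcongr
    rw [← XS_congr le_rfl hy]
    exact XS_mono κ j F y hl
  · have h2 : ∀ y, φ y ^ 2 ≤ 2 * XS κ j F L y ^ t + 2 * ENNReal.ofReal (ε ^ 2) := fun y => by
      have h := add_sq_le_two_mul (XS κ j F L y ^ (t / 2)) (ENNReal.ofReal ε)
      rwa [rpow_half_sq, ← ENNReal.ofReal_pow hε.le] at h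
    calc 2 * ∫⁻ y, φ y ^ 2 ∂cm
        ≤ 2 * ∫⁻ y, (2 * XS κ j F L y ^ t + 2 * ENNReal.ofReal (ε ^ 2)) ∂cm := by
          gcongr; exact h2 _
      _ = 4 * ∫⁻ y, XS κ j F L y ^ t ∂cm + 4 * (ENNReal.ofReal (ε ^ 2) * cm univ) := by
          rw [lintegral_add_right _ measurable_const, lintegral_const_mul _
            ((measurable_XS κ j F L).pow_const t), lintegral_const]
          ring
      _ ≤ _ := by
          gcongr
          rw [cm_univ, ← ENNReal.ofReal_mul (by positivity), ← ENNReal.ofReal_toReal hδt]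
          refine ENNReal.ofReal_le_ofReal ?_
          linarith

lemma rpow_le_of_self_improving {Y A : ℝ≥0∞} (hY : Y ≠ ∞) {θ : ℝ} (hθ : 0 < θ)
    (h : ∀ δ : ℝ≥0∞, δ ≠ 0 → δ ≠ ∞ → Y ≤ A * (4 * Y + 4 * δ) ^ (1 - θ)) :
    Y ^ θ ≤ A * 8 ^ (1 - θ) := by
  rcases eq_or_ne Y 0 with rfl | h0
  · simp [ENNReal.zero_rpow_of_pos hθ]
  have h1 := h Y h0 hY
  have e : 4 * Y + 4 * Y = 8 * Y := by ring
  rw [e, ENNReal.mul_rpow_of_ne_top (by norm_num) hY, ← mul_assoc] at h1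
  have e2 : Y = Y ^ θ * Y ^ (1 - θ) := by
    rw [← ENNReal.rpow_add _ _ h0 hY]; simp
  have hz : Y ^ (1 - θ) ≠ 0 := by simp [ENNReal.rpow_eq_zero_iff, h0, hY]
  have ht : Y ^ (1 - θ) ≠ ∞ := by simp [ENNReal.rpow_eq_top_iff, h0, hY]
  conv_lhs at h1 => rw [e2]
  exact (ENNReal.mul_le_mul_iff_left hz ht).1 h1

lemma boxc_ne_zero (κ : ℕ) : ((1 / 2) ^ κ / 64 : ℝ≥0∞) ≠ 0 :=
  (ENNReal.div_pos (pow_ne_zero _ (by norm_num)) (by norm_num)).ne'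

lemma boxc_ne_top (κ : ℕ) : ((1 / 2) ^ κ / 64 : ℝ≥0∞) ≠ ∞ :=
  ENNReal.div_ne_top (ENNReal.pow_ne_top (by norm_num)) (by norm_num)

/-- Constant of `XS_rpow_le`. -/
noncomputable def stopc (κ : ℕ) (t β : ℝ) (C : ℝ≥0∞) (N : ℕ) : ℝ≥0∞ :=
  ENNReal.ofReal (t * β + 1) * ((((1 / 2) ^ κ / 64 : ℝ≥0∞) ^ (2 * β))⁻¹ * (C ^ 2 * N))

lemma stopc_base_ne_zero (κ : ℕ) (β : ℝ) : ((1 / 2) ^ κ / 64 : ℝ≥0∞) ^ (2 * β) ≠ 0 := by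
  rw [Ne, ENNReal.rpow_eq_zero_iff]
  simp only [boxc_ne_zero κ, boxc_ne_top κ, false_and, or_self, not_false_eq_true]

lemma stopc_ne_top (κ : ℕ) (t β : ℝ) {C : ℝ≥0∞} (hC : C ≠ ∞) (N : ℕ) : stopc κ t β C N ≠ ∞ := by
  have := stopc_base_ne_zero κ β
  unfold stopc
  finiteness

lemma XS_rpow_le {κ j N L : ℕ} {F : ℂ → ℂ} {H : ℕ → ℂ → ℂ} {t β : ℝ} (ht : 0 ≤ t) (hβ : 0 ≤ β)
    {C : ℝ≥0∞} {x : ℝ}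
    (h : ∀ l < L, ((1 / 2) ^ κ / 64 * XS κ j F (l + 1) x ^ (t / 2)) ^ β * cs κ j F l x
      ≤ C * ∑ i ∈ Finset.range N, cs κ j (H i) l x) :
    XS κ j F L x ^ (t * β + 1) ≤ stopc κ t β C N * ∑ i ∈ Finset.range N, SQ κ j (H i) x := by
  have h0 := stopc_base_ne_zero κ β
  have h1 : ((1 / 2) ^ κ / 64 : ℝ≥0∞) ^ (2 * β) ≠ ∞ :=
    ENNReal.rpow_ne_top_of_nonneg (by positivity)
      (boxc_ne_top κ)
  unfold stopc
  rw [mul_assoc]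
  refine (sum_rpow_le _ (by positivity) L).trans ?_
  gcongr
  rw [mul_assoc, ← ENNReal.mul_le_iff_le_inv h0 h1, Finset.mul_sum, Finset.mul_sum]
  calc ∑ l ∈ Finset.range L, ((1 / 2) ^ κ / 64 : ℝ≥0∞) ^ (2 * β) * (cs κ j F l x ^ 2 *
        (∑ m ∈ Finset.range (l + 1), cs κ j F m x ^ 2) ^ (t * β))
      ≤ ∑ l ∈ Finset.range L, ∑ i ∈ Finset.range N, C ^ 2 * N * cs κ j (H i) l x ^ 2 := by
        refine Finset.sum_le_sum fun l hl => ?_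
        rw [← Finset.mul_sum]
        calc _ = (((1 / 2) ^ κ / 64 * XS κ j F (l + 1) x ^ (t / 2)) ^ β * cs κ j F l x) ^ 2 := by
              rw [mul_pow, ← ENNReal.rpow_natCast (_ ^ β), ← ENNReal.rpow_mul,
                ENNReal.mul_rpow_of_nonneg _ (XS κ j F (l + 1) x ^ (t / 2)) (by positivity),
                ← ENNReal.rpow_mul, Nat.cast_ofNat, mul_comm β,
                show t / 2 * (2 * β) = t * β by ring, XS]
              ring
          _ ≤ (C * ∑ i ∈ Finset.range N, cs κ j (H i) l x) ^ 2 := by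
              exact pow_le_pow_left' (h l (Finset.mem_range.1 hl)) 2
          _ ≤ _ := by
              rw [mul_pow, mul_assoc]
              gcongr
              exact sq_sum_range_le _ _
    _ = ∑ i ∈ Finset.range N, C ^ 2 * N * XS κ j (H i) L x := by
        rw [Finset.sum_comm]
        simp only [XS, Finset.mul_sum]
    _ ≤ _ := by
        gcongr
        exact XS_le_SQ _ _ _ _ _

lemma ae_mem_Ioc_cm : ∀ᵐ x ∂cm, x ∈ Ioc 0 (2 * Real.pi) := ae_restrict_mem measurableSet_Ioc

lemma AN.exists_bound {F : ℂ → ℂ} (h : AN F) : ∃ M : ℝ≥0∞, M ≠ ∞ ∧ ∀ z ∈ ball (0 : ℂ) 1, ‖F z‖ₑ ≤ M := by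
  obtain ⟨M, hM⟩ := (isCompact_closedBall (0 : ℂ) 1).exists_bound_of_continuousOn h.continuousOn
  refine ⟨ENNReal.ofReal M, by simp, fun z hz => ?_⟩
  rw [← ofReal_norm]
  exact ENNReal.ofReal_le_ofReal (hM z (ball_subset_closedBall hz))

lemma lintegral_slice_le {F : ℂ → ℂ} (h : AN F) {p : ℝ} (hp : 1 ≤ p) {r : ℝ} (h0 : 0 ≤ r)
    (h1 : r < 1) : ∫⁻ y, ‖F (r * circlePt y)‖ₑ ^ p ∂cm ≤ ∫⁻ y, ‖F (circlePt y)‖ₑ ^ p ∂cm := by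
  rw [← lintegral_lintegral_pke h0 h1 (h.continuous_circle.enorm.measurable.pow_const p)]
  exact lintegral_mono fun x => poisson_le h (smul_circlePt_mem_ball h0 h1 x) hp

lemma exists_lintegral_SQ_le_of_two_lt (κ : ℕ) {j : ℕ} (hj : 1 ≤ j) {p : ℝ} (hp2 : 2 < p) :
    ∃ C : ℝ≥0∞, C ≠ ∞ ∧ ∀ G, AN G →
      ∫⁻ x, SQ κ j G x ^ (p / 2) ∂cm ≤ C * ∫⁻ y, ‖G (circlePt y)‖ₑ ^ p ∂cm := by
  have hp : 0 < p := by linarith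
  set β : ℝ := 1 - 2 / p with hβ
  have hp21 : 2 / p ≤ 1 := (div_le_one hp).2 hp2.le
  have hβ0 : 0 ≤ β := by rw [hβ]; linarith
  obtain ⟨C₁, hC₁, h₁⟩ := exists_rpow_mul_cs_le_sum κ j hβ0
  obtain ⟨C₃, hC₃, h₃⟩ := lintegral_SQ_le_two κ hj
  set T : ℝ≥0∞ := ∑ i ∈ Finset.range (j + 1), twist i ^ 2 with hT
  have hTt : T ≠ ∞ := ENNReal.sum_ne_top.2 fun i _ => ENNReal.pow_ne_top (twist_ne_top i)
  set S : ℝ≥0∞ := stopc κ (p / 2) β C₁ (j + 1) with hS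
  have hSt : S ≠ ∞ := stopc_ne_top _ _ _ hC₁ _
  have h8 : (8 : ℝ≥0∞) ^ (1 - 2 / p) ≠ ∞ := ENNReal.rpow_ne_top_of_nonneg hβ0 (by norm_num)
  refine ⟨(S * (C₃ * T) * 8 ^ (1 - 2 / p)) ^ (p / 2),
    ENNReal.rpow_ne_top_of_nonneg (by positivity) (by finiteness), fun G hG => ?_⟩
  rw [lintegral_SQ_rpow κ j G (by positivity)]
  refine iSup_le fun L => ?_
  obtain ⟨M, hM, hGM⟩ := hG.exists_bound
  set K : ℝ≥0∞ := ∑ l ∈ Finset.range L, (cauc κ j * M) ^ 2 with hK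
  have hcauc := cauc_ne_top κ j
  have hKt : K ≠ ∞ := ENNReal.sum_ne_top.2 fun i _ => by finiteness
  have hXK : ∀ x, XS κ j G L x ≤ K := fun x => Finset.sum_le_sum fun l _ => by
    gcongr; exact cs_le_of_bounded hG.diffOn hGM l x
  set I := ∫⁻ y, ‖G (circlePt y)‖ₑ ^ p ∂cm with hI
  set Y := ∫⁻ x, XS κ j G L x ^ (p / 2) ∂cm with hY
  have hYt : Y ≠ ∞ := by
    refine ((lintegral_mono fun x => ENNReal.rpow_le_rpow (hXK x) (by positivity)).trans_lt
      (b := ∫⁻ x, K ^ (p / 2) ∂cm) ?_).ne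
    rw [lintegral_const, cm_univ]
    exact ENNReal.mul_lt_top (ENNReal.rpow_lt_top_of_nonneg (by positivity) hKt) ENNReal.ofReal_lt_top
  have key : Y ^ (2 / p) ≤ S * (C₃ * T) * I ^ (2 / p) * 8 ^ (1 - 2 / p) := by
    refine rpow_le_of_self_improving hYt (by positivity) fun δ hδ hδt => ?_
    obtain ⟨ψ, hψ, him, hlow, hL2⟩ := exists_stopping κ j G L hKt hXK (t := p / 2) (by positivity) hδ hδt
    set V : ℂ → ℂ := fun w => Complex.exp (ψ w) with hV
    set H : ℕ → ℂ → ℂ := fun i w => G w * Complex.exp (node β i * ψ w) with hH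
    set B : ℝ≥0∞ := 4 * Y + 4 * δ with hB
    have hHd : ∀ i, DifferentiableOn ℂ (H i) (ball 0 1) := fun i =>
      hG.diffOn.fun_mul (DifferentiableOn.cexp (hψ.const_mul _))
    have hHB : ∀ i, Hl 2 (H i) ≤ twist i ^ 2 * (I ^ (2 / p) * B ^ (1 - 2 / p)) := fun i => by
      refine Hl_le_of_forall fun r h0 h1 => ?_
      have m1 : Measurable fun y => ‖G (r * circlePt y)‖ₑ ^ p :=
        (continuous_slice hG.diffOn.continuousOn h0.le h1).enorm.measurable.pow_const p
      have m2 : Measurable fun y => ‖V (r * circlePt y)‖ₑ ^ 2 :=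
        (continuous_slice hψ.cexp.continuousOn h0.le h1).enorm.measurable.pow_const 2
      calc ∫⁻ y, ‖H i (r * circlePt y)‖ₑ ^ (2 : ℝ) ∂cm
          ≤ ∫⁻ y, twist i ^ 2 * ((‖G (r * circlePt y)‖ₑ ^ p) ^ (2 / p)
              * (‖V (r * circlePt y)‖ₑ ^ 2) ^ (1 - 2 / p)) ∂cm := by
            refine lintegral_mono fun y => ?_
            rw [← ENNReal.rpow_mul, ← ENNReal.rpow_natCast (‖V _‖ₑ), ← ENNReal.rpow_mul,
              mul_div_cancel₀ _ hp.ne', ENNReal.rpow_two, ENNReal.rpow_two, hH, enorm_mul, Nat.cast_ofNat]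
            calc _ ≤ (‖G (r * circlePt y)‖ₑ * (twist i * ‖V (r * circlePt y)‖ₑ ^ β)) ^ 2 := by
                  gcongr
                  exact enorm_exp_node_le (him _ (smul_circlePt_mem_ball h0.le h1 y)) _ i
              _ = _ := by
                  rw [mul_comm 2, ENNReal.rpow_mul, ENNReal.rpow_two, hβ]
                  ring
        _ = twist i ^ 2 * ∫⁻ y, (‖G (r * circlePt y)‖ₑ ^ p) ^ (2 / p)
              * (‖V (r * circlePt y)‖ₑ ^ 2) ^ (1 - 2 / p) ∂cm :=
            lintegral_const_mul _ ((m1.pow_const _).fun_mul (m2.pow_const _))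
        _ ≤ _ := by
            gcongr
            refine (ENNReal.lintegral_mul_norm_pow_le m1.aemeasurable m2.aemeasurable
              (by positivity) hβ0 (by ring)).trans ?_
            gcongr
            · exact lintegral_slice_le hG (by linarith) h0.le h1
            · exact hL2 r h0 h1
    have hpt : ∀ᵐ x ∂cm, XS κ j G L x ^ (p / 2)
        ≤ S * ∑ i ∈ Finset.range (j + 1), SQ κ j (H i) x := by
      filter_upwards [ae_mem_Ioc_cm] with x hx
      have e : p / 2 * β + 1 = p / 2 := by rw [hβ]; field_simp; ring
      have h := XS_rpow_le (κ := κ) (j := j) (F := G) (L := L) (H := H) (t := p / 2)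
        (by positivity) hβ0 (C := C₁) (N := j + 1) (x := x)
        fun l hl => h₁ G ψ hG.diffOn hψ him l x _ (hlow l hl x hx)
      rwa [e] at h
    calc Y ≤ ∫⁻ x, S * ∑ i ∈ Finset.range (j + 1), SQ κ j (H i) x ∂cm := lintegral_mono_ae hpt
      _ = S * ∑ i ∈ Finset.range (j + 1), ∫⁻ x, SQ κ j (H i) x ∂cm := by
          rw [lintegral_const_mul _ (Finset.measurable_fun_sum _ fun i _ => measurable_SQ κ j (H i)),
            lintegral_sum_range fun i => measurable_SQ κ j (H i)]
      _ ≤ S * ∑ i ∈ Finset.range (j + 1), C₃ * (twist i ^ 2 * (I ^ (2 / p) * B ^ (1 - 2 / p))) := by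
          gcongr with i hi
          exact (h₃ _ (hHd i)).trans (by gcongr; exact hHB i)
      _ = _ := by
          rw [← Finset.mul_sum, ← Finset.sum_mul]
          ring
  calc Y = (Y ^ (2 / p)) ^ (p / 2) := by rw [← ENNReal.rpow_mul]; field_simp; simp
    _ ≤ (S * (C₃ * T) * 8 ^ (1 - 2 / p) * I ^ (2 / p)) ^ (p / 2) := by
        gcongr
        exact key.trans_eq (by ring)
    _ = _ := by
        rw [ENNReal.mul_rpow_of_nonneg _ (I ^ (2 / p)) (by positivity), ← ENNReal.rpow_mul I]
        field_simp
        simp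

/-- The dyadic square function is bounded from the Hardy space `H^p` to `L^p`. -/
theorem lintegral_SQ_le (κ : ℕ) {j : ℕ} (hj : 1 ≤ j) {p : ℝ} (hp : 0 < p) :
    ∃ C : ℝ≥0∞, C ≠ ∞ ∧ ∀ F : ℂ → ℂ, DifferentiableOn ℂ F (ball 0 1) →
      ∫⁻ x, SQ κ j F x ^ (p / 2) ∂cm ≤ C * Hl p F := by
  have key : ∃ C : ℝ≥0∞, C ≠ ∞ ∧ ∀ G, AN G → ∫⁻ x, SQ (κ + 1) j G x ^ (p / 2) ∂cm
      ≤ C * ∫⁻ y, ‖G (circlePt y)‖ₑ ^ p ∂cm := by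
    rcases lt_trichotomy p 2 with h | rfl | h
    · exact exists_lintegral_SQ_le_of_lt_two (κ + 1) hj hp h
    · simpa using lintegral_SQ_le_of_AN (κ + 1) hj
    · exact exists_lintegral_SQ_le_of_two_lt (κ + 1) hj h
  obtain ⟨C, hC, h⟩ := key
  have h2 : (2 : ℝ≥0∞) ^ (j * p) ≠ ∞ := ENNReal.rpow_ne_top_of_nonneg (by positivity) (by norm_num)
  exact ⟨2 ^ (j * p) * C, by finiteness, fun F hF => lintegral_SQ_le_Hl hp hC h hF⟩

lemma radial_comparison {M M₁ M₂ : ℝ → ℝ} (h₁ : ∀ r ∈ Ioo (-1 : ℝ) 1, HasDerivAt M (M₁ r) r)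
    (h₂ : ∀ r ∈ Ioo (-1 : ℝ) 1, HasDerivAt M₁ (M₂ r) r) {b : ℕ → ℝ} (hb : ∀ l, 0 ≤ b l) (L : ℕ)
    (h : ∀ l < L, ∀ r ∈ Ioo (1 - (1 / 2 : ℝ) ^ l) (1 - (1 / 2) ^ (l + 1)),
      r * M₂ r + M₁ r ≤ r * b l) :
    M (1 - (1 / 2) ^ L) ≤ M 0 + ∑ l ∈ Finset.range L, (1 / 4) ^ l * b l := by
  set K : ℕ → ℝ := fun l => ∑ i ∈ Finset.range l, b i * (1 / 2) ^ (i + 1) with hK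
  have hK0 : ∀ l, 0 ≤ K l := fun l => Finset.sum_nonneg fun i _ => mul_nonneg (hb i) (by positivity)
  suffices H : ∀ l ≤ L, (1 - (1 / 2) ^ l) * M₁ (1 - (1 / 2) ^ l) ≤ (1 - (1 / 2) ^ l) * K l ∧
      M (1 - (1 / 2) ^ l) + (1 / 2) ^ l * K l ≤ M 0 + ∑ i ∈ Finset.range l, (1 / 4) ^ i * b i by
    have := mul_nonneg (show (0 : ℝ) ≤ (1 / 2) ^ L by positivity) (hK0 L)
    linarith [(H L le_rfl).2]
  intro l
  induction l with
  | zero => simp [hK]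
  | succ l ih =>
    intro hl
    obtain ⟨i1, i2⟩ := ih (by omega)
    have hp : (0 : ℝ) < (1 / 2) ^ l := by positivity
    have hp1 : ((1 : ℝ) / 2) ^ l ≤ 1 := pow_le_one₀ (by norm_num) (by norm_num)
    have hq : ((1 : ℝ) / 2) ^ (l + 1) = (1 / 2) ^ l / 2 := by rw [pow_succ]; ring
    have h4 : ((1 : ℝ) / 4) ^ l = (1 / 2) ^ l * (1 / 2) ^ l := by rw [← mul_pow]; norm_num
    have hKs : K (l + 1) = K l + b l * (1 / 2) ^ (l + 1) := Finset.sum_range_succ _ _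
    set ρ : ℝ := 1 - (1 / 2) ^ l with hρ
    set σ : ℝ := 1 - (1 / 2) ^ (l + 1) with hσ
    have hρ0 : 0 ≤ ρ := by linarith
    have hρσ : ρ < σ := by linarith
    have hσ1 : σ < 1 := by linarith
    have hmem : ∀ r ∈ Icc ρ σ, r ∈ Ioo (-1 : ℝ) 1 := fun r hr => ⟨by linarith [hr.1], by linarith [hr.2]⟩
    have hder : ∀ r ∈ Ioo (-1 : ℝ) 1, HasDerivAt (fun r => r * (M₁ r - K l - b l * (r - ρ)))
        (1 * (M₁ r - K l - b l * (r - ρ)) + r * (M₂ r - b l * 1)) r := fun r hr => by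
      refine (hasDerivAt_id' r).fun_mul ?_
      exact ((h₂ r hr).sub_const (K l)).fun_sub (((hasDerivAt_id' r).sub_const ρ).const_mul (b l))
    have anti : AntitoneOn (fun r => r * (M₁ r - K l - b l * (r - ρ))) (Icc ρ σ) := by
      refine antitoneOn_of_deriv_nonpos (convex_Icc _ _)
        (fun r hr => (hder r (hmem r hr)).continuousAt.continuousWithinAt)
        (fun r hr => ?_) fun r hr => ?_
      · rw [interior_Icc] at hr
        exact (hder r (hmem r (Ioo_subset_Icc_self hr))).differentiableAt.differentiableWithinAt
      · rw [interior_Icc] at hr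
        rw [(hder r (hmem r (Ioo_subset_Icc_self hr))).deriv]
        have := h l (by omega) r hr
        nlinarith [hK0 l, mul_nonneg (hb l) (sub_nonneg.2 hr.1.le)]
    have hbd : ∀ r ∈ Icc ρ σ, 0 < r → M₁ r ≤ K (l + 1) := fun r hr h0 => by
      have := anti (left_mem_Icc.2 hρσ.le) hr hr.1
      simp only [sub_self, mul_zero, sub_zero] at this
      have h3 : r * (M₁ r - K l - b l * (r - ρ)) ≤ r * 0 := by linarith
      have h5 := le_of_mul_le_mul_left h3 h0
      have : b l * (r - ρ) ≤ b l * (1 / 2) ^ (l + 1) :=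
        mul_le_mul_of_nonneg_left (by linarith [hr.2]) (hb l)
      linarith
    refine ⟨mul_le_mul_of_nonneg_left (hbd σ (right_mem_Icc.2 hρσ.le) (by linarith)) (by linarith), ?_⟩
    have hmv := (convex_Icc ρ σ).image_sub_le_mul_sub_of_deriv_le (f := M) (C := K (l + 1))
      (fun r hr => (h₁ r (hmem r hr)).continuousAt.continuousWithinAt)
      (fun r hr => by
        rw [interior_Icc] at hr
        exact (h₁ r (hmem r (Ioo_subset_Icc_self hr))).differentiableAt.differentiableWithinAt)
      (fun r hr => by
        rw [interior_Icc] at hr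
        rw [(h₁ r (hmem r (Ioo_subset_Icc_self hr))).deriv]
        exact hbd r (Ioo_subset_Icc_self hr) (by linarith [hr.1]))
      ρ (left_mem_Icc.2 hρσ.le) σ (right_mem_Icc.2 hρσ.le) hρσ.le
    have e : σ - ρ = (1 / 2) ^ (l + 1) := by linarith
    rw [e] at hmv
    rw [Finset.sum_range_succ, h4]
    have : (1 / 2 : ℝ) ^ (l + 1) * K (l + 1) + K (l + 1) * (1 / 2) ^ (l + 1)
        ≤ (1 / 2) ^ l * K l + (1 / 2) ^ l * (1 / 2) ^ l * b l := by
      rw [hKs, hq]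
      nlinarith [mul_nonneg (mul_nonneg hp.le hp.le) (hb l)]
    linarith

lemma hasDerivAt_integral_of_continuousOn {u u' : ℝ → ℝ → ℝ}
    (hu : ContinuousOn (Function.uncurry u) (Ioo (-1) 1 ×ˢ univ))
    (hu' : ContinuousOn (Function.uncurry u') (Ioo (-1) 1 ×ˢ univ))
    (hd : ∀ r ∈ Ioo (-1 : ℝ) 1, ∀ θ, HasDerivAt (fun r => u r θ) (u' r θ) r) {r : ℝ}
    (hr : r ∈ Ioo (-1 : ℝ) 1) (a b : ℝ) :
    HasDerivAt (fun r => ∫ θ in a..b, u r θ) (∫ θ in a..b, u' r θ) r := by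
  have slice : ∀ {v : ℝ → ℝ → ℝ}, ContinuousOn (Function.uncurry v) (Ioo (-1) 1 ×ˢ univ) →
      ∀ r ∈ Ioo (-1 : ℝ) 1, Continuous (v r) := fun hv r hr =>
    hv.comp_continuous (Continuous.prodMk_right r) fun θ => ⟨hr, mem_univ _⟩
  obtain ⟨ε, hε, hεs⟩ := Metric.nhds_basis_closedBall.mem_iff.1 (isOpen_Ioo.mem_nhds hr)
  obtain ⟨C, hC⟩ := ((isCompact_closedBall r ε).prod (isCompact_uIcc (a := a) (b := b))).exists_bound_of_continuousOn
    (hu'.mono (prod_mono hεs (subset_univ _)))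
  refine (intervalIntegral.hasDerivAt_integral_of_dominated_loc_of_deriv_le (F := u) (F' := u')
    (bound := fun _ => C) (closedBall_mem_nhds r hε)
    ?_ ((slice hu r hr).intervalIntegrable _ _) (slice hu' r hr).aestronglyMeasurable ?_
    intervalIntegrable_const ?_).2
  · filter_upwards [isOpen_Ioo.mem_nhds hr] with x hx
    exact (slice hu x hx).aestronglyMeasurable
  · exact Eventually.of_forall fun θ hθ x hx => hC (x, θ) ⟨hx, uIoc_subset_uIcc hθ⟩
  · exact Eventually.of_forall fun θ _ x hx => hd x (hεs hx) θ

/-- Squared norm of the pair `(f, w)`. -/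
noncomputable def sqn (f w : ℂ) : ℝ := ‖f‖ ^ 2 + ‖w‖ ^ 2

/-- First derivative of `sqn` along a curve. -/
noncomputable def sqn₁ (f w f₁ w₁ : ℂ) : ℝ := 2 * inner ℝ f f₁ + 2 * inner ℝ w w₁

/-- Second derivative of `sqn` along a curve. -/
noncomputable def sqn₂ (f w f₁ w₁ f₂ w₂ : ℂ) : ℝ :=
  2 * (inner ℝ f f₂ + inner ℝ f₁ f₁) + 2 * (inner ℝ w w₂ + inner ℝ w₁ w₁)

/-- First derivative of `sqn ^ e` along a curve. -/
noncomputable def sqp₁ (e : ℝ) (f w f₁ w₁ : ℂ) : ℝ := e * (sqn f w ^ (e - 1) * sqn₁ f w f₁ w₁)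

/-- Second derivative of `sqn ^ e` along a curve. -/
noncomputable def sqp₂ (e : ℝ) (f w f₁ w₁ f₂ w₂ : ℂ) : ℝ :=
  e * ((sqn₁ f w f₁ w₁ * (e - 1) * sqn f w ^ (e - 1 - 1)) * sqn₁ f w f₁ w₁
    + sqn f w ^ (e - 1) * sqn₂ f w f₁ w₁ f₂ w₂)

lemma sqn_pos (f : ℂ) {w : ℂ} (hw : w ≠ 0) : 0 < sqn f w := by
  have := norm_pos_iff.2 hw
  unfold sqn
  positivity

section Curve

variable {f w f₁ w₁ : ℝ → ℂ} {f₂ w₂ : ℂ} {t : ℝ}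

lemma hasDerivAt_sqn (hf : HasDerivAt f (f₁ t) t) (hw : HasDerivAt w (w₁ t) t) :
    HasDerivAt (fun t => sqn (f t) (w t)) (sqn₁ (f t) (w t) (f₁ t) (w₁ t)) t :=
  hf.norm_sq.fun_add hw.norm_sq

lemma hasDerivAt_sqn_rpow (hf : HasDerivAt f (f₁ t) t) (hw : HasDerivAt w (w₁ t) t)
    (h0 : w t ≠ 0) (e : ℝ) : HasDerivAt (fun t => sqn (f t) (w t) ^ e)
      (sqp₁ e (f t) (w t) (f₁ t) (w₁ t)) t := by
  convert (hasDerivAt_sqn hf hw).rpow_const (p := e) (Or.inl (sqn_pos _ h0).ne') using 1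
  unfold sqp₁
  ring

lemma hasDerivAt_sqp₁ (hf : HasDerivAt f (f₁ t) t) (hw : HasDerivAt w (w₁ t) t)
    (hf₁ : HasDerivAt f₁ f₂ t) (hw₁ : HasDerivAt w₁ w₂ t) (h0 : w t ≠ 0) (e : ℝ) :
    HasDerivAt (fun t => sqp₁ e (f t) (w t) (f₁ t) (w₁ t))
      (sqp₂ e (f t) (w t) (f₁ t) (w₁ t) f₂ w₂) t := by
  refine HasDerivAt.const_mul e (HasDerivAt.fun_mul
    ((hasDerivAt_sqn hf hw).rpow_const (p := e - 1) (Or.inl (sqn_pos _ h0).ne')) ?_)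
  exact ((hf.inner ℝ hf₁).const_mul 2).fun_add ((hw.inner ℝ hw₁).const_mul 2)

end Curve

section Continuity

variable {X : Type*} [TopologicalSpace X] {s : Set X} {f w f₁ w₁ f₂ w₂ : X → ℂ}

lemma continuousOn_sqn_rpow (hf : ContinuousOn f s) (hw : ContinuousOn w s)
    (h0 : ∀ x ∈ s, w x ≠ 0) (e : ℝ) : ContinuousOn (fun x => sqn (f x) (w x) ^ e) s :=
  ((hf.norm.pow 2).add (hw.norm.pow 2)).rpow_const fun x hx => Or.inl (sqn_pos _ (h0 x hx)).ne'

lemma continuousOn_sqp₁ (hf : ContinuousOn f s) (hw : ContinuousOn w s) (hf₁ : ContinuousOn f₁ s)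
    (hw₁ : ContinuousOn w₁ s) (h0 : ∀ x ∈ s, w x ≠ 0) (e : ℝ) :
    ContinuousOn (fun x => sqp₁ e (f x) (w x) (f₁ x) (w₁ x)) s := by
  unfold sqp₁ sqn₁
  have := continuousOn_sqn_rpow hf hw h0 (e - 1)
  fun_prop

lemma continuousOn_sqp₂ (hf : ContinuousOn f s) (hw : ContinuousOn w s) (hf₁ : ContinuousOn f₁ s)
    (hw₁ : ContinuousOn w₁ s) (hf₂ : ContinuousOn f₂ s)
    (hw₂ : ContinuousOn w₂ s) (h0 : ∀ x ∈ s, w x ≠ 0) (e : ℝ) :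
    ContinuousOn (fun x => sqp₂ e (f x) (w x) (f₁ x) (w₁ x) (f₂ x) (w₂ x)) s := by
  unfold sqp₂ sqn₁ sqn₂
  have := continuousOn_sqn_rpow hf hw h0 (e - 1)
  have := continuousOn_sqn_rpow hf hw h0 (e - 1 - 1)
  fun_prop

end Continuity

lemma sqp₂_le {e : ℝ} (he : 0 ≤ e) (he1 : e ≤ 1) {f w f₁ w₁ f₂ w₂ : ℂ} (hw : w ≠ 0) :
    sqp₂ e f w f₁ w₁ f₂ w₂ ≤ e * (sqn f w ^ (e - 1) * sqn₂ f w f₁ w₁ f₂ w₂) := by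
  unfold sqp₂
  have h1 : 0 ≤ sqn f w ^ (e - 1 - 1) := (Real.rpow_pos_of_pos (sqn_pos f hw) _).le
  have h2 : 0 ≤ (1 - e) * (sqn₁ f w f₁ w₁ ^ 2 * sqn f w ^ (e - 1 - 1)) :=
    mul_nonneg (by linarith) (mul_nonneg (sq_nonneg _) h1)
  refine mul_le_mul_of_nonneg_left ?_ he
  nlinarith

lemma sqn₂_polar (f w F₁ W₁ F₂ W₂ : ℂ) (r : ℝ) {c : ℂ} (hc : ‖c‖ = 1) :
    r ^ 2 * sqn₂ f w (F₁ * c) (W₁ * c) (F₂ * c * c) (W₂ * c * c)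
      + r * sqn₁ f w (F₁ * c) (W₁ * c)
      + sqn₂ f w (F₁ * (r * c * Complex.I)) (W₁ * (r * c * Complex.I))
        (F₂ * (r * c * Complex.I) * (r * c * Complex.I) + F₁ * (-(r * c)))
        (W₂ * (r * c * Complex.I) * (r * c * Complex.I) + W₁ * (-(r * c)))
      = r ^ 2 * (4 * sqn F₁ W₁) := by
  have hc2 : c.re ^ 2 + c.im ^ 2 = 1 := by
    have := Complex.sq_norm c
    rw [hc, Complex.normSq_apply] at this
    linarith
  have h : ∀ z v : ℂ, inner ℝ z v = z.re * v.re + z.im * v.im := fun z v => by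
    rw [Complex.inner]; simp; ring
  simp only [sqn₂, sqn₁, sqn, h, Complex.sq_norm, Complex.normSq_apply, Complex.mul_re,
    Complex.mul_im, Complex.add_re, Complex.add_im, Complex.neg_re, Complex.neg_im, Complex.I_re,
    Complex.I_im, Complex.ofReal_re, Complex.ofReal_im]
  linear_combination (4 * r ^ 2 * (F₁.re ^ 2 + F₁.im ^ 2 + W₁.re ^ 2 + W₁.im ^ 2)) * hc2

lemma sqp_polar_le {e : ℝ} (he : 0 ≤ e) (he1 : e ≤ 1) (f F₁ W₁ F₂ W₂ : ℂ) {w : ℂ} (hw : w ≠ 0)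
    {r : ℝ} {c : ℂ} (hc : ‖c‖ = 1) :
    r ^ 2 * sqp₂ e f w (F₁ * c) (W₁ * c) (F₂ * c * c) (W₂ * c * c)
      + r * sqp₁ e f w (F₁ * c) (W₁ * c)
      + sqp₂ e f w (F₁ * (r * c * Complex.I)) (W₁ * (r * c * Complex.I))
        (F₂ * (r * c * Complex.I) * (r * c * Complex.I) + F₁ * (-(r * c)))
        (W₂ * (r * c * Complex.I) * (r * c * Complex.I) + W₁ * (-(r * c)))
      ≤ r ^ 2 * (4 * e * (sqn f w ^ (e - 1) * sqn F₁ W₁)) := by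
  have h1 := sqp₂_le he he1 (f := f) (f₁ := F₁ * c) (w₁ := W₁ * c) (f₂ := F₂ * c * c)
    (w₂ := W₂ * c * c) hw
  have h2 := sqp₂_le he he1 (f := f) (f₁ := F₁ * (r * c * Complex.I))
    (w₁ := W₁ * (r * c * Complex.I))
    (f₂ := F₂ * (r * c * Complex.I) * (r * c * Complex.I) + F₁ * (-(r * c)))
    (w₂ := W₂ * (r * c * Complex.I) * (r * c * Complex.I) + W₁ * (-(r * c))) hw
  have h3 := sqn₂_polar f w F₁ W₁ F₂ W₂ r hc
  have h4 := mul_le_mul_of_nonneg_left h1 (sq_nonneg r)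
  refine (add_le_add (add_le_add h4 le_rfl) h2).trans_eq ?_
  unfold sqp₁
  linear_combination e * sqn f w ^ (e - 1) * h3

section Polar

variable {F : ℂ → ℂ} {r : ℝ}

lemma real_mul_circlePt_mem_ball (hr : r ∈ Ioo (-1 : ℝ) 1) (θ : ℝ) :
    (r : ℂ) * circlePt θ ∈ ball (0 : ℂ) 1 := by
  rw [mem_ball_zero_iff, norm_mul, norm_circlePt, mul_one, Complex.norm_real, Real.norm_eq_abs,
    abs_lt]
  exact hr

lemma hasDerivAt_radial (hF : DifferentiableOn ℂ F (ball 0 1)) (hr : r ∈ Ioo (-1 : ℝ) 1) (θ : ℝ) :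
    HasDerivAt (fun r : ℝ => F (r * circlePt θ)) (deriv F (r * circlePt θ) * circlePt θ) r := by
  have h := (hF.differentiableAt (isOpen_ball.mem_nhds (real_mul_circlePt_mem_ball hr θ))).hasDerivAt
  have h2 : HasDerivAt (fun z : ℂ => z * circlePt θ) (circlePt θ) (r : ℂ) := by
    simpa using (hasDerivAt_id' (r : ℂ)).mul_const (circlePt θ)
  exact (HasDerivAt.comp (r : ℂ) h h2).comp_ofReal

lemma hasDerivAt_real_mul_circlePt (r θ : ℝ) :
    HasDerivAt (fun θ : ℝ => (r : ℂ) * circlePt θ) (r * circlePt θ * Complex.I) θ := by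
  have h : HasDerivAt (fun z : ℂ => (r : ℂ) * Complex.exp (z * Complex.I))
      (r * (Complex.exp (θ * Complex.I) * (1 * Complex.I))) (θ : ℂ) :=
    (((hasDerivAt_id' (θ : ℂ)).mul_const Complex.I).cexp).const_mul (r : ℂ)
  refine HasDerivAt.congr_deriv h.comp_ofReal ?_
  simp only [circlePt]
  ring

lemma hasDerivAt_angular (hF : DifferentiableOn ℂ F (ball 0 1)) (hr : r ∈ Ioo (-1 : ℝ) 1) (θ : ℝ) :
    HasDerivAt (fun θ : ℝ => F (r * circlePt θ))
      (deriv F (r * circlePt θ) * (r * circlePt θ * Complex.I)) θ := by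
  have h := (hF.differentiableAt (isOpen_ball.mem_nhds (real_mul_circlePt_mem_ball hr θ))).hasDerivAt
  exact HasDerivAt.comp θ h (hasDerivAt_real_mul_circlePt r θ)

lemma continuousOn_polar (hF : ContinuousOn F (ball 0 1)) :
    ContinuousOn (fun z : ℝ × ℝ => F (z.1 * circlePt z.2)) (Ioo (-1) 1 ×ˢ univ) :=
  hF.comp (by have := continuous_circlePt; fun_prop)
    fun z hz => real_mul_circlePt_mem_ball hz.1 z.2

end Polar

/-- Growth of the circular means of `(|F|² + |W|²)^e` for holomorphic `F` and nonvanishing `W`. -/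
lemma integral_sqn_rpow_le {F W : ℂ → ℂ} (hF : DifferentiableOn ℂ F (ball 0 1))
    (hW : DifferentiableOn ℂ W (ball 0 1)) (h0 : ∀ z ∈ ball (0 : ℂ) 1, W z ≠ 0) {e : ℝ}
    (he : 0 ≤ e) (he1 : e ≤ 1) {b : ℕ → ℝ} (hb : ∀ l, 0 ≤ b l) (L : ℕ)
    (h : ∀ l < L, ∀ r ∈ Ioo (1 - (1 / 2 : ℝ) ^ l) (1 - (1 / 2) ^ (l + 1)),
      ∫ θ in (0 : ℝ)..2 * Real.pi, 4 * e * (sqn (F (r * circlePt θ)) (W (r * circlePt θ)) ^ (e - 1)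
        * sqn (deriv F (r * circlePt θ)) (deriv W (r * circlePt θ))) ≤ b l) :
    ∫ θ in (0 : ℝ)..2 * Real.pi, sqn (F ((1 - (1 / 2) ^ L : ℝ) * circlePt θ))
        (W ((1 - (1 / 2) ^ L : ℝ) * circlePt θ)) ^ e
      ≤ 2 * Real.pi * sqn (F 0) (W 0) ^ e + ∑ l ∈ Finset.range L, (1 / 4) ^ l * b l := by
  have hF₁ := hF.deriv isOpen_ball
  have hW₁ := hW.deriv isOpen_ball
  have hF₂ := hF₁.deriv isOpen_ball
  have hW₂ := hW₁.deriv isOpen_ball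
  set u : ℝ → ℝ → ℝ := fun r θ => sqn (F (r * circlePt θ)) (W (r * circlePt θ)) ^ e with hu
  set u₁ : ℝ → ℝ → ℝ := fun r θ => sqp₁ e (F (r * circlePt θ)) (W (r * circlePt θ))
    (deriv F (r * circlePt θ) * circlePt θ) (deriv W (r * circlePt θ) * circlePt θ) with hu₁
  set u₂ : ℝ → ℝ → ℝ := fun r θ => sqp₂ e (F (r * circlePt θ)) (W (r * circlePt θ))
    (deriv F (r * circlePt θ) * circlePt θ) (deriv W (r * circlePt θ) * circlePt θ)
    (deriv (deriv F) (r * circlePt θ) * circlePt θ * circlePt θ)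
    (deriv (deriv W) (r * circlePt θ) * circlePt θ * circlePt θ) with hu₂
  set v₁ : ℝ → ℝ → ℝ := fun r θ => sqp₁ e (F (r * circlePt θ)) (W (r * circlePt θ))
    (deriv F (r * circlePt θ) * (r * circlePt θ * Complex.I))
    (deriv W (r * circlePt θ) * (r * circlePt θ * Complex.I)) with hv₁
  set v₂ : ℝ → ℝ → ℝ := fun r θ => sqp₂ e (F (r * circlePt θ)) (W (r * circlePt θ))
    (deriv F (r * circlePt θ) * (r * circlePt θ * Complex.I))
    (deriv W (r * circlePt θ) * (r * circlePt θ * Complex.I))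
    (deriv (deriv F) (r * circlePt θ) * (r * circlePt θ * Complex.I) * (r * circlePt θ * Complex.I)
      + deriv F (r * circlePt θ) * (-(r * circlePt θ)))
    (deriv (deriv W) (r * circlePt θ) * (r * circlePt θ * Complex.I) * (r * circlePt θ * Complex.I)
      + deriv W (r * circlePt θ) * (-(r * circlePt θ))) with hv₂
  have cF := continuousOn_polar hF.continuousOn
  have cW := continuousOn_polar hW.continuousOn
  have cF₁ := continuousOn_polar hF₁.continuousOn
  have cW₁ := continuousOn_polar hW₁.continuousOn
  have cF₂ := continuousOn_polar hF₂.continuousOn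
  have cW₂ := continuousOn_polar hW₂.continuousOn
  have cc : ContinuousOn (fun z : ℝ × ℝ => circlePt z.2) (Ioo (-1) 1 ×ˢ univ) :=
    (continuous_circlePt.comp continuous_snd).continuousOn
  have cr : ContinuousOn (fun z : ℝ × ℝ => (z.1 : ℂ)) (Ioo (-1) 1 ×ˢ univ) :=
    (Complex.continuous_ofReal.comp continuous_fst).continuousOn
  have hne : ∀ z ∈ Ioo (-1 : ℝ) 1 ×ˢ (univ : Set ℝ), W (z.1 * circlePt z.2) ≠ 0 := fun z hz =>
    h0 _ (real_mul_circlePt_mem_ball hz.1 _)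
  have cu : ContinuousOn (Function.uncurry u) (Ioo (-1) 1 ×ˢ univ) :=
    continuousOn_sqn_rpow cF cW hne e
  have cu₁ : ContinuousOn (Function.uncurry u₁) (Ioo (-1) 1 ×ˢ univ) :=
    continuousOn_sqp₁ cF cW (cF₁.mul cc) (cW₁.mul cc) hne e
  have cu₂ : ContinuousOn (Function.uncurry u₂) (Ioo (-1) 1 ×ˢ univ) :=
    continuousOn_sqp₂ cF cW (cF₁.mul cc) (cW₁.mul cc) ((cF₂.mul cc).mul cc) ((cW₂.mul cc).mul cc)
      hne e
  have crc := (cr.mul cc).mul (continuousOn_const (c := Complex.I))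
  have cv₂ : ContinuousOn (Function.uncurry v₂) (Ioo (-1) 1 ×ˢ univ) :=
    continuousOn_sqp₂ cF cW (cF₁.mul crc) (cW₁.mul crc)
      (((cF₂.mul crc).mul crc).add (cF₁.mul (cr.mul cc).neg))
      (((cW₂.mul crc).mul crc).add (cW₁.mul (cr.mul cc).neg)) hne e
  have cw : ContinuousOn (Function.uncurry fun r θ : ℝ => 4 * e *
      (sqn (F (r * circlePt θ)) (W (r * circlePt θ)) ^ (e - 1)
        * sqn (deriv F (r * circlePt θ)) (deriv W (r * circlePt θ)))) (Ioo (-1) 1 ×ˢ univ) :=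
    continuousOn_const.mul ((continuousOn_sqn_rpow cF cW hne (e - 1)).mul
      ((cF₁.norm.pow 2).add (cW₁.norm.pow 2)))
  have slice : ∀ {v : ℝ → ℝ → ℝ}, ContinuousOn (Function.uncurry v) (Ioo (-1) 1 ×ˢ univ) →
      ∀ r ∈ Ioo (-1 : ℝ) 1, IntervalIntegrable (v r) volume 0 (2 * Real.pi) := fun hv r hr =>
    (hv.comp_continuous (Continuous.prodMk_right r) fun θ => ⟨hr, mem_univ _⟩).intervalIntegrable _ _
  have key := radial_comparison (M := fun r => ∫ θ in (0 : ℝ)..2 * Real.pi, u r θ)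
    (M₁ := fun r => ∫ θ in (0 : ℝ)..2 * Real.pi, u₁ r θ)
    (M₂ := fun r => ∫ θ in (0 : ℝ)..2 * Real.pi, u₂ r θ)
    (fun r hr => hasDerivAt_integral_of_continuousOn cu cu₁ (fun r hr θ =>
      hasDerivAt_sqn_rpow (f₁ := fun r => deriv F (r * circlePt θ) * circlePt θ)
        (w₁ := fun r => deriv W (r * circlePt θ) * circlePt θ)
        (hasDerivAt_radial hF hr θ) (hasDerivAt_radial hW hr θ)
        (h0 _ (real_mul_circlePt_mem_ball hr θ)) e) hr _ _)
    (fun r hr => hasDerivAt_integral_of_continuousOn cu₁ cu₂ (fun r hr θ =>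
      hasDerivAt_sqp₁ (f₁ := fun r => deriv F (r * circlePt θ) * circlePt θ)
        (w₁ := fun r => deriv W (r * circlePt θ) * circlePt θ)
        (hasDerivAt_radial hF hr θ) (hasDerivAt_radial hW hr θ)
        ((hasDerivAt_radial hF₁ hr θ).mul_const _) ((hasDerivAt_radial hW₁ hr θ).mul_const _)
        (h0 _ (real_mul_circlePt_mem_ball hr θ)) e) hr _ _) hb L ?_
  · refine key.trans_eq ?_
    simp [hu]
  · intro l hl r hr
    have hp1 : ((1 : ℝ) / 2) ^ l ≤ 1 := pow_le_one₀ (by norm_num) (by norm_num)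
    have hp2 : (0 : ℝ) < (1 / 2) ^ (l + 1) := by positivity
    have hr0 : 0 < r := by linarith [hr.1]
    have hrm : r ∈ Ioo (-1 : ℝ) 1 := ⟨by linarith, by linarith [hr.2]⟩
    have hv0 : ∫ θ in (0 : ℝ)..2 * Real.pi, v₂ r θ = 0 := by
      rw [intervalIntegral.integral_eq_sub_of_hasDerivAt (f := v₁ r) (fun θ _ =>
        hasDerivAt_sqp₁ (f₁ := fun θ => deriv F (r * circlePt θ) * (r * circlePt θ * Complex.I))
        (w₁ := fun θ => deriv W (r * circlePt θ) * (r * circlePt θ * Complex.I))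
        (hasDerivAt_angular hF hrm θ) (hasDerivAt_angular hW hrm θ) ?_ ?_
        (h0 _ (real_mul_circlePt_mem_ball hrm θ)) e) (slice cv₂ r hrm)]
      · have : circlePt (2 * Real.pi) = circlePt 0 := by simp [circlePt]
        simp [hv₁, this]
      · refine HasDerivAt.congr_deriv ((hasDerivAt_angular hF₁ hrm θ).fun_mul
          ((hasDerivAt_real_mul_circlePt r θ).mul_const Complex.I)) ?_
        linear_combination (deriv F (r * circlePt θ) * (r * circlePt θ)) * Complex.I_mul_I
      · refine HasDerivAt.congr_deriv ((hasDerivAt_angular hW₁ hrm θ).fun_mul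
          ((hasDerivAt_real_mul_circlePt r θ).mul_const Complex.I)) ?_
        linear_combination (deriv W (r * circlePt θ) * (r * circlePt θ)) * Complex.I_mul_I
    have hpt : ∫ θ in (0 : ℝ)..2 * Real.pi, (r ^ 2 * u₂ r θ + r * u₁ r θ + v₂ r θ)
        ≤ ∫ θ in (0 : ℝ)..2 * Real.pi, r ^ 2 * (4 * e *
      (sqn (F (r * circlePt θ)) (W (r * circlePt θ)) ^ (e - 1)
        * sqn (deriv F (r * circlePt θ)) (deriv W (r * circlePt θ)))) := by
      refine intervalIntegral.integral_mono_on (by positivity)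
        ((((slice cu₂ r hrm).const_mul _).add ((slice cu₁ r hrm).const_mul _)).add (slice cv₂ r hrm))
        ((slice cw r hrm).const_mul _) fun θ _ => ?_
      exact sqp_polar_le he he1 _ _ _ _ _ (h0 _ (real_mul_circlePt_mem_ball hrm θ))
        (norm_circlePt θ)
    rw [intervalIntegral.integral_add (((slice cu₂ r hrm).const_mul _).add
        ((slice cu₁ r hrm).const_mul _)) (slice cv₂ r hrm),
      intervalIntegral.integral_add ((slice cu₂ r hrm).const_mul _) ((slice cu₁ r hrm).const_mul _),
      hv0, intervalIntegral.integral_const_mul, intervalIntegral.integral_const_mul,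
      intervalIntegral.integral_const_mul] at hpt
    have h2 := hpt.trans (mul_le_mul_of_nonneg_left (h l hl r hr) (sq_nonneg r))
    refine le_of_mul_le_mul_left ?_ hr0
    linarith

lemma exists_XS_le (κ j L : ℕ) {F : ℂ → ℂ} (hF : DifferentiableOn ℂ F (ball 0 1)) :
    ∃ K : ℝ≥0∞, K ≠ ∞ ∧ ∀ x, XS κ j F L x ≤ K := by
  have hpos : (0 : ℝ) < (1 / 2) ^ (L + κ) := by positivity
  have hsub : closedBall (0 : ℂ) (1 - (1 / 2) ^ (L + κ)) ⊆ ball 0 1 :=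
    closedBall_subset_ball (by linarith)
  obtain ⟨M, hM⟩ := (isCompact_closedBall (0 : ℂ) (1 - (1 / 2) ^ (L + κ))).exists_bound_of_continuousOn
    ((differentiableOn_iteratedDeriv isOpen_ball hF j).continuousOn.mono hsub)
  refine ⟨∑ _l ∈ Finset.range L, ENNReal.ofReal M ^ 2, ENNReal.sum_ne_top.2 fun _ _ => by finiteness,
    fun x => Finset.sum_le_sum fun l hl => ?_⟩
  gcongr
  refine cs_le fun w hw => ?_
  have h1 := (norm_of_mem_box hw).1
  have h2 : ((1 : ℝ) / 2) ^ (L + κ) ≤ (1 / 2) ^ (l + κ) :=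
    pow_le_pow_of_le_one (by norm_num) (by norm_num) (by have := Finset.mem_range.1 hl; omega)
  calc _ ≤ ‖iteratedDeriv j F w‖ₑ * 1 := by
        gcongr
        exact pow_le_one₀ (zero_le) (by norm_num)
    _ ≤ _ := by
        rw [mul_one, ← ofReal_norm]
        exact ENNReal.ofReal_le_ofReal (hM w (by rw [mem_closedBall_zero_iff]; linarith))

lemma mul_add_rpow_le {a x : ℝ≥0∞} (ha : a ≠ ∞) (hx : x ≠ ∞) {θ : ℝ} (h0 : 0 < θ) (h1 : θ ≤ 1) :
    ENNReal.ofReal θ * (a * (x + a) ^ (θ - 1)) + x ^ θ ≤ (x + a) ^ θ := by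
  lift a to NNReal using ha
  lift x to NNReal using hx
  rcases eq_or_ne (x + a) 0 with h | h
  · rw [add_eq_zero] at h
    simp [h.1, h.2]
  have hθ : ENNReal.ofReal θ = ((NNReal.mk θ h0.le : NNReal) : ℝ≥0∞) := by
    rw [ENNReal.ofReal, Real.toNNReal_of_nonneg h0.le]
  rw [hθ, ← ENNReal.coe_add, ← ENNReal.coe_rpow_of_ne_zero h, ← ENNReal.coe_rpow_of_ne_zero h,
    ← ENNReal.coe_rpow_of_nonneg _ h0.le]
  norm_cast
  rw [← NNReal.coe_le_coe]
  push_cast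
  have hy : (0 : ℝ) < x + a := by
    have := pos_iff_ne_zero.2 h
    exact_mod_cast this
  set y : ℝ := x + a with hy'
  have hx0 : (0 : ℝ) ≤ x := x.2
  have hb := rpow_one_add_le_one_add_mul_self (s := (x : ℝ) / y - 1) (p := θ)
    (by have : 0 ≤ (x : ℝ) / y := by positivity
        linarith) h0.le h1
  rw [add_sub_cancel, Real.div_rpow hx0 hy.le, div_le_iff₀ (by positivity)] at hb
  have ha' : (a : ℝ) = y - x := by rw [hy']; ring
  rw [ha', Real.rpow_sub_one hy.ne']
  refine (add_le_add_right hb _).trans_eq ?_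
  field_simp
  ring

lemma sum_mul_rpow_le (a : ℕ → ℝ≥0∞) {θ : ℝ} (h0 : 0 < θ) (h1 : θ ≤ 1) (L : ℕ)
    (ha : ∀ l < L, a l ≠ ∞) :
    ENNReal.ofReal θ * ∑ l ∈ Finset.range L, a l * (∑ m ∈ Finset.range (l + 1), a m) ^ (θ - 1)
      ≤ (∑ l ∈ Finset.range L, a l) ^ θ := by
  induction L with
  | zero => simp
  | succ L ih =>
    rw [Finset.sum_range_succ, Finset.sum_range_succ, mul_add, add_comm]
    refine (add_le_add_right (ih fun l hl => ha l (by omega)) _).trans ?_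
    refine mul_add_rpow_le (ha L (by omega)) (ENNReal.sum_ne_top.2 fun l hl => ha l ?_) h0 h1
    have := Finset.mem_range.1 hl
    omega

lemma mem_box_of_mem_Ioo {κ l : ℕ} (hκ : 1 ≤ κ) {r : ℝ}
    (hr : r ∈ Ioo (1 - (1 / 2 : ℝ) ^ l) (1 - (1 / 2) ^ (l + 1))) (x : ℝ) :
    (r * circlePt x : ℂ) ∈ box κ l (cell l x) := by
  have h2 : ((1 : ℝ) / 2) ^ (l + κ) ≤ (1 / 2) ^ (l + 1) :=
    pow_le_pow_of_le_one (by norm_num) (by norm_num) (by omega)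
  exact ⟨r, x, rfl, by linarith [hr.2], by linarith [hr.1], rfl⟩

lemma intervalIntegral_le_toReal {h : ℝ → ℝ} {B : ℝ≥0∞} (hB : B ≠ ∞)
    (hh : ∫⁻ x, ENNReal.ofReal ‖h x‖ ∂cm ≤ B) : ∫ x in 0..2 * Real.pi, h x ≤ B.toReal := by
  rw [intervalIntegral.integral_of_le Real.two_pi_pos.le]
  refine (Real.le_norm_self _).trans ((norm_integral_le_lintegral_norm _).trans ?_)
  exact ENNReal.toReal_mono hB hh

lemma sqn_rpow_mul_le {p : ℝ} (hp : 0 < p) (hp2 : p ≤ 2) (f f₁ z ζ : ℂ) :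
    sqn f (Complex.exp ((2 / p : ℝ) * z)) ^ (p / 2 - 1)
        * sqn f₁ (Complex.exp ((2 / p : ℝ) * z) * ((2 / p : ℝ) * ζ))
      ≤ ‖Complex.exp z‖ ^ (2 - 4 / p) * ‖f₁‖ ^ 2 + 4 / p ^ 2 * ‖Complex.exp z * ζ‖ ^ 2 := by
  have hV : 0 < ‖Complex.exp z‖ := norm_pos_iff.2 (Complex.exp_ne_zero z)
  have hW : ‖Complex.exp ((2 / p : ℝ) * z)‖ = ‖Complex.exp z‖ ^ (2 / p) := by
    rw [Complex.norm_exp, Complex.norm_exp, Complex.re_ofReal_mul, ← Real.exp_mul, mul_comm]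
  have hW2 : ‖Complex.exp ((2 / p : ℝ) * z)‖ ^ 2 = ‖Complex.exp z‖ ^ (4 / p) := by
    rw [hW, ← Real.rpow_natCast, ← Real.rpow_mul hV.le]
    congr 1
    push_cast
    ring
  have h1 : sqn f (Complex.exp ((2 / p : ℝ) * z)) ^ (p / 2 - 1) ≤ ‖Complex.exp z‖ ^ (2 - 4 / p) := by
    calc _ ≤ (‖Complex.exp ((2 / p : ℝ) * z)‖ ^ 2) ^ (p / 2 - 1) := by
          refine Real.rpow_le_rpow_of_nonpos ?_ ?_ (by linarith)
          · rw [hW2]; positivity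
          · unfold sqn; nlinarith [sq_nonneg ‖f‖]
      _ = _ := by
          rw [hW2, ← Real.rpow_mul hV.le]
          congr 1
          field_simp
          ring
  calc _ ≤ ‖Complex.exp z‖ ^ (2 - 4 / p)
          * sqn f₁ (Complex.exp ((2 / p : ℝ) * z) * ((2 / p : ℝ) * ζ)) := by
        gcongr
        unfold sqn; positivity
    _ = _ := by
        rw [sqn, norm_mul, mul_pow, hW2, mul_add, norm_mul, norm_mul, Complex.norm_real,
          Real.norm_of_nonneg (by positivity), ← mul_assoc, ← Real.rpow_add hV,
          sub_add_cancel, Real.rpow_two]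
        ring

lemma ofReal_sqn_le {p : ℝ} (hp : 0 < p) (hp2 : p ≤ 2) (f f₁ z ζ : ℂ) {X c v s : ℝ≥0∞}
    (hc : c ≠ 0) (hct : c ≠ ∞)
    (hm : c * X ^ (p / 4) ≤ ‖Complex.exp z‖ₑ) (hf : ‖f₁‖ₑ ≤ s) (hv : ‖Complex.exp z * ζ‖ₑ ≤ v) :
    ENNReal.ofReal ‖4 * (p / 2) * (sqn f (Complex.exp ((2 / p : ℝ) * z)) ^ (p / 2 - 1)
        * sqn f₁ (Complex.exp ((2 / p : ℝ) * z) * ((2 / p : ℝ) * ζ)))‖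
      ≤ ENNReal.ofReal (2 * p) * (c ^ (2 - 4 / p) * (X ^ (p / 2 - 1) * s ^ 2)
        + ENNReal.ofReal (4 / p ^ 2) * v ^ 2) := by
  have hV : 0 < ‖Complex.exp z‖ := norm_pos_iff.2 (Complex.exp_ne_zero z)
  have h42 : 2 ≤ 4 / p := by rw [le_div_iff₀ hp]; linarith
  have hA : 0 ≤ sqn f (Complex.exp ((2 / p : ℝ) * z)) ^ (p / 2 - 1)
        * sqn f₁ (Complex.exp ((2 / p : ℝ) * z) * ((2 / p : ℝ) * ζ)) := by
    unfold sqn; positivity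
  rw [Real.norm_of_nonneg (mul_nonneg (by positivity) hA), ENNReal.ofReal_mul (by positivity),
    show 4 * (p / 2) = 2 * p by ring]
  gcongr
  refine (ENNReal.ofReal_le_ofReal (sqn_rpow_mul_le hp hp2 f f₁ z ζ)).trans ?_
  rw [ENNReal.ofReal_add (by positivity) (by positivity), ENNReal.ofReal_mul (by positivity),
    ENNReal.ofReal_mul (by positivity), ← ENNReal.ofReal_rpow_of_pos hV,
    ENNReal.ofReal_pow (norm_nonneg _), ENNReal.ofReal_pow (norm_nonneg _), ofReal_norm, ofReal_norm,
    ofReal_norm]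
  gcongr ?_ + _ * ?_ ^ 2
  · rw [← mul_assoc]
    gcongr
    have hγ : 0 ≤ 4 / p - 2 := by linarith
    have e1 : ∀ x : ℝ≥0∞, x ^ (2 - 4 / p) = (x ^ (4 / p - 2))⁻¹ := fun x => by
      rw [← ENNReal.rpow_neg, neg_sub]
    have e2 : X ^ (p / 2 - 1) = ((X ^ (p / 4)) ^ (4 / p - 2))⁻¹ := by
      rw [← ENNReal.rpow_mul, ← ENNReal.rpow_neg]
      congr 1
      field_simp
      ring
    have hc0 : c ^ (4 / p - 2) ≠ 0 := by simp [ENNReal.rpow_eq_zero_iff, hc, hct]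
    have hc1 : c ^ (4 / p - 2) ≠ ∞ := ENNReal.rpow_ne_top_of_nonneg hγ hct
    rw [e1, e1, e2, ← ENNReal.mul_inv (Or.inl hc0) (Or.inl hc1), ← ENNReal.mul_rpow_of_nonneg _ _ hγ]
    gcongr

lemma zero_mem_box (κ : ℕ) (x : ℝ) : (0 : ℂ) ∈ box κ 0 (cell 0 x) :=
  ⟨0, x, rfl, (pow_le_one₀ (by norm_num) (by norm_num)).trans (by simp), by simp, by simp⟩

lemma enorm_zero_rpow_le (F : ℂ → ℂ) {p : ℝ} (hp : 0 ≤ p) :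
    ENNReal.ofReal (2 * Real.pi) * ‖F 0‖ₑ ^ p ≤ ∫⁻ x, NM 0 0 F x ^ p ∂cm := by
  rw [← cm_univ, mul_comm, ← lintegral_const]
  refine lintegral_mono fun x => ENNReal.rpow_le_rpow ((?_ : _ ≤ _).trans (cs_le_NM 0 0 F 0 x)) hp
  simpa using le_cs (j := 0) (F := F) (zero_mem_box 0 x)

lemma enorm_deriv_le {κ l : ℕ} {F : ℂ → ℂ} {x : ℝ} {w : ℂ} (hw : w ∈ box κ l (cell l x)) :
    ‖deriv F w‖ₑ ≤ cs κ 1 F l x * 2 ^ l := by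
  have h := le_cs (j := 1) (F := F) hw
  rw [iteratedDeriv_one, mul_one] at h
  calc _ = ‖deriv F w‖ₑ * (1 / 2) ^ l * 2 ^ l := by
        rw [mul_assoc, ← mul_pow, one_div, ENNReal.inv_mul_cancel (by norm_num) (by norm_num)]
        simp
    _ ≤ _ := by gcongr

lemma ofReal_sqn_rpow_le (f w : ℂ) {e : ℝ} (he : 0 < e) (he1 : e ≤ 1) :
    ENNReal.ofReal (sqn f w ^ e) ≤ ‖f‖ₑ ^ (2 * e) + ‖w‖ₑ ^ (2 * e) := by
  have hs : ENNReal.ofReal (sqn f w) = ‖f‖ₑ ^ 2 + ‖w‖ₑ ^ 2 := by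
    rw [sqn, ENNReal.ofReal_add (by positivity) (by positivity), ENNReal.ofReal_pow (norm_nonneg _),
      ENNReal.ofReal_pow (norm_nonneg _), ofReal_norm, ofReal_norm]
  rw [← ENNReal.ofReal_rpow_of_nonneg (by unfold sqn; positivity) he.le, hs]
  refine (ENNReal.rpow_add_le_add_rpow _ _ he.le he1).trans_eq ?_
  rw [← ENNReal.rpow_natCast, ← ENNReal.rpow_natCast, ← ENNReal.rpow_mul, ← ENNReal.rpow_mul,
    Nat.cast_ofNat]

lemma enorm_rpow_le_ofReal_sqn (f w : ℂ) {e : ℝ} (he : 0 ≤ e) :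
    ‖f‖ₑ ^ (2 * e) ≤ ENNReal.ofReal (sqn f w ^ e) := by
  rw [← ENNReal.ofReal_rpow_of_nonneg (by unfold sqn; positivity) he, ENNReal.rpow_mul]
  gcongr
  rw [ENNReal.rpow_two, ← ofReal_norm, ← ENNReal.ofReal_pow (norm_nonneg _)]
  exact ENNReal.ofReal_le_ofReal (by unfold sqn; nlinarith [sq_nonneg ‖w‖])

/-- Green-type inequality for a pair `(F, exp ((2 / p) ψ))`. -/
lemma lintegral_le_of_le_exp {κ : ℕ} (hκ : 1 ≤ κ) {p : ℝ} (hp : 0 < p) (hp2 : p ≤ 2) {F ψ : ℂ → ℂ}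
    (hF : DifferentiableOn ℂ F (ball 0 1)) (hψ : DifferentiableOn ℂ ψ (ball 0 1)) (L : ℕ) {c : ℝ≥0∞}
    (hc : c ≠ 0) (hct : c ≠ ∞)
    (hlow : ∀ l < L, ∀ x ∈ Ioc 0 (2 * Real.pi), ∀ w ∈ box κ l (cell l x),
      c * XS κ 1 F (l + 1) x ^ (p / 4) ≤ ‖Complex.exp (ψ w)‖ₑ)
    {u : ℕ → ℝ → ℝ≥0∞} (hu : ∀ l x, u l x = c ^ (2 - 4 / p) * (XS κ 1 F (l + 1) x ^ (p / 2 - 1)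
      * cs κ 1 F l x ^ 2) + ENNReal.ofReal (4 / p ^ 2) * cs κ 1 (fun w => Complex.exp (ψ w)) l x ^ 2)
    (hut : ∀ l < L, ∫⁻ x, u l x ∂cm ≠ ∞) :
    ∫⁻ x, ‖F ((1 - (1 / 2) ^ L : ℝ) * circlePt x)‖ₑ ^ p ∂cm
      ≤ ENNReal.ofReal (2 * Real.pi) * (‖F 0‖ₑ ^ p + ‖Complex.exp (ψ 0)‖ₑ ^ (2 : ℝ))
        + ENNReal.ofReal (2 * p) * ∑ l ∈ Finset.range L, ∫⁻ x, u l x ∂cm := by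
  set W : ℂ → ℂ := fun w => Complex.exp ((2 / p : ℝ) * ψ w) with hW
  have hWd : DifferentiableOn ℂ W (ball 0 1) := (hψ.const_mul _).cexp
  have hpow1 : ((1 : ℝ) / 2) ^ L ≤ 1 := pow_le_one₀ (by norm_num) (by norm_num)
  have hpow0 : (0 : ℝ) < (1 / 2) ^ L := by positivity
  have hum : ∀ l, Measurable (u l) := fun l => by
    rw [funext (hu l)]
    exact ((((measurable_XS κ 1 F (l + 1)).pow_const _).fun_mul
      ((measurable_cs κ 1 F l).pow_const 2)).const_mul _).fun_add
      (((measurable_cs κ 1 _ l).pow_const 2).const_mul _)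
  set b : ℕ → ℝ := fun l => (ENNReal.ofReal (2 * p) * (4 ^ l * ∫⁻ x, u l x ∂cm)).toReal with hb
  have hbt : ∀ l < L, ENNReal.ofReal (2 * p) * (4 ^ l * ∫⁻ x, u l x ∂cm) ≠ ∞ := fun l hl => by
    have := hut l hl
    finiteness
  have key := integral_sqn_rpow_le hF hWd (fun z _ => Complex.exp_ne_zero _) (e := p / 2)
    (by positivity) (by linarith) (b := b) (fun l => ENNReal.toReal_nonneg) L fun l hl r hr => by
      refine intervalIntegral_le_toReal (hbt l hl) ?_
      rw [← lintegral_const_mul _ (hum l), ← lintegral_const_mul _ ((hum l).const_mul _)]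
      refine lintegral_mono_ae ?_
      filter_upwards [ae_mem_Ioc_cm] with x hx
      have hw := mem_box_of_mem_Ioo hκ hr x
      have hwb := box_subset_ball hw
      set w : ℂ := r * circlePt x
      have hψw := (hψ.differentiableAt (isOpen_ball.mem_nhds hwb))
      have dW : deriv W w = Complex.exp ((2 / p : ℝ) * ψ w) * ((2 / p : ℝ) * deriv ψ w) :=
        (hψw.hasDerivAt.const_mul _).cexp.deriv
      have dV : deriv (fun w => Complex.exp (ψ w)) w = Complex.exp (ψ w) * deriv ψ w :=
        hψw.hasDerivAt.cexp.deriv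
      have hv := enorm_deriv_le (F := fun w => Complex.exp (ψ w)) hw
      rw [dV] at hv
      rw [dW]
      refine (ofReal_sqn_le hp hp2 _ _ _ _ hc hct (hlow l hl x hx w hw) (enorm_deriv_le hw) hv).trans_eq ?_
      rw [hu, mul_pow, mul_pow, ← pow_mul, mul_comm l, pow_mul]
      norm_num
      ring
  have hcont : Continuous fun x : ℝ => sqn (F ((1 - (1 / 2) ^ L : ℝ) * circlePt x))
      (W ((1 - (1 / 2) ^ L : ℝ) * circlePt x)) ^ (p / 2) := by
    rw [← continuousOn_univ]
    exact continuousOn_sqn_rpow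
      (continuous_slice hF.continuousOn (by linarith) (by linarith)).continuousOn
      (continuous_slice hWd.continuousOn (by linarith) (by linarith)).continuousOn
      (fun _ _ => Complex.exp_ne_zero _) _
  have e2 : 2 * (p / 2) = p := by ring
  have hW0 : ‖W 0‖ₑ ^ p = ‖Complex.exp (ψ 0)‖ₑ ^ (2 : ℝ) := by
    rw [enorm_exp_rpow, enorm_exp_rpow, Complex.re_ofReal_mul]
    congr 2
    field_simp
  calc _ ≤ ∫⁻ x, ENNReal.ofReal (sqn (F ((1 - (1 / 2) ^ L : ℝ) * circlePt x))
          (W ((1 - (1 / 2) ^ L : ℝ) * circlePt x)) ^ (p / 2)) ∂cm := by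
        refine lintegral_mono fun x => ?_
        have h := enorm_rpow_le_ofReal_sqn (F ((1 - (1 / 2) ^ L : ℝ) * circlePt x))
          (W ((1 - (1 / 2) ^ L : ℝ) * circlePt x)) (e := p / 2) (by positivity)
        rwa [e2] at h
    _ = ENNReal.ofReal (∫ x in 0..2 * Real.pi, sqn (F ((1 - (1 / 2) ^ L : ℝ) * circlePt x))
          (W ((1 - (1 / 2) ^ L : ℝ) * circlePt x)) ^ (p / 2)) := by
        rw [intervalIntegral.integral_of_le Real.two_pi_pos.le]
        refine (ofReal_integral_eq_lintegral_ofReal (μ := cm) (integrable_of_continuous hcont)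
          (ae_of_all _ fun x => ?_)).symm
        unfold sqn; positivity
    _ ≤ ENNReal.ofReal (2 * Real.pi * sqn (F 0) (W 0) ^ (p / 2)
          + ∑ l ∈ Finset.range L, (1 / 4) ^ l * b l) := ENNReal.ofReal_le_ofReal key
    _ ≤ _ := by
        refine ENNReal.ofReal_add_le.trans (add_le_add ?_ ?_)
        · rw [ENNReal.ofReal_mul Real.two_pi_pos.le]
          gcongr
          refine (ofReal_sqn_rpow_le _ _ (by positivity) (by linarith)).trans_eq ?_
          rw [e2, hW0]
        · rw [ENNReal.ofReal_sum_of_nonneg fun l _ => by positivity, Finset.mul_sum]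
          refine Finset.sum_le_sum fun l hl => le_of_eq ?_
          rw [ENNReal.ofReal_mul (by positivity), ENNReal.ofReal_toReal (hbt l (Finset.mem_range.1 hl)),
            ENNReal.ofReal_pow (by norm_num), one_div, ENNReal.ofReal_inv_of_pos (by norm_num),
            ENNReal.ofReal_ofNat]
          calc _ = ENNReal.ofReal (2 * p) * ((4⁻¹ * 4) ^ l * ∫⁻ x, u l x ∂cm) := by
                rw [mul_pow]; ring
            _ = _ := by
                rw [ENNReal.inv_mul_cancel (by norm_num) (by norm_num)]
                simp

lemma exists_slice_le_SQ_of_le_two {κ : ℕ} (hκ : 1 ≤ κ) {p : ℝ} (hp : 0 < p) (hp2 : p ≤ 2) :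
    ∃ C : ℝ≥0∞, C ≠ ∞ ∧ ∀ F : ℂ → ℂ, DifferentiableOn ℂ F (ball 0 1) → ∀ L : ℕ,
      ∫⁻ x, ‖F ((1 - (1 / 2) ^ L : ℝ) * circlePt x)‖ₑ ^ p ∂cm
        ≤ C * (ENNReal.ofReal (2 * Real.pi) * ‖F 0‖ₑ ^ p + ∫⁻ x, SQ κ 1 F x ^ (p / 2) ∂cm) := by
  obtain ⟨C₂, hC₂, h₂⟩ := lintegral_NM_le_of_two_le 0 0 le_rfl
  obtain ⟨C₃, hC₃, h₃⟩ := lintegral_SQ_le_two κ le_rfl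
  set c : ℝ≥0∞ := (1 / 2) ^ κ / 64 with hc
  have hc0 : c ≠ 0 := boxc_ne_zero κ
  have hct : c ≠ ∞ := boxc_ne_top κ
  set A : ℝ≥0∞ := c ^ (2 - 4 / p) * ENNReal.ofReal (2 / p) with hA
  have hAt : A ≠ ∞ := ENNReal.mul_ne_top (by simp [ENNReal.rpow_eq_top_iff, hc0, hct]) (by simp)
  set B : ℝ≥0∞ := ENNReal.ofReal (4 / p ^ 2) * C₃ with hB
  have hBt : B ≠ ∞ := by finiteness
  refine ⟨1 + C₂ * 4 + ENNReal.ofReal (2 * p) * (A + B * 4), by finiteness, fun F hF L => ?_⟩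
  refine le_of_forall_le_mul_add (by finiteness) fun δ hδ hδt => ?_
  obtain ⟨K, hK, hFK⟩ := exists_XS_le κ 1 L hF
  obtain ⟨ψ, hψ, -, hlow, hL2⟩ := exists_stopping κ 1 F L hK hFK (t := p / 2) (by positivity) hδ hδt
  set V : ℂ → ℂ := fun w => Complex.exp (ψ w) with hV
  set Y := ∫⁻ x, XS κ 1 F L x ^ (p / 2) ∂cm with hY
  have hYt : Y ≠ ∞ := by
    refine ((lintegral_mono fun x => ENNReal.rpow_le_rpow (hFK x) (by positivity)).trans_lt
      (b := ∫⁻ x, K ^ (p / 2) ∂cm) ?_).ne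
    rw [lintegral_const, cm_univ]
    exact ENNReal.mul_lt_top (ENNReal.rpow_lt_top_of_nonneg (by positivity) hK) ENNReal.ofReal_lt_top
  have hYS : Y ≤ ∫⁻ x, SQ κ 1 F x ^ (p / 2) ∂cm := lintegral_mono fun x =>
    ENNReal.rpow_le_rpow (XS_le_SQ _ _ _ _ _) (by positivity)
  have hVd : DifferentiableOn ℂ V (ball 0 1) := hψ.cexp
  have hHV : Hl 2 V ≤ 4 * (Y + δ) := Hl_le_of_forall fun r h0 h1 => by
    simp_rw [ENNReal.rpow_two, mul_add]
    exact hL2 r h0 h1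
  set u : ℕ → ℝ → ℝ≥0∞ := fun l x => c ^ (2 - 4 / p) * (XS κ 1 F (l + 1) x ^ (p / 2 - 1)
      * cs κ 1 F l x ^ 2) + ENNReal.ofReal (4 / p ^ 2) * cs κ 1 V l x ^ 2 with hu
  have hum : ∀ l, Measurable (u l) := fun l =>
    ((((measurable_XS κ 1 F (l + 1)).pow_const _).fun_mul
      ((measurable_cs κ 1 F l).pow_const 2)).const_mul _).fun_add
      (((measurable_cs κ 1 _ l).pow_const 2).const_mul _)
  have hsum : ∑ l ∈ Finset.range L, ∫⁻ x, u l x ∂cm ≤ A * Y + B * (4 * (Y + δ)) := by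
    rw [← lintegral_sum_range hum]
    calc _ ≤ ∫⁻ x, A * XS κ 1 F L x ^ (p / 2) + ENNReal.ofReal (4 / p ^ 2) * SQ κ 1 V x ∂cm := by
          refine lintegral_mono fun x => ?_
          simp only [hu, Finset.sum_add_distrib, ← Finset.mul_sum]
          gcongr ?_ + _ * ?_
          · rw [hA, mul_assoc]
            gcongr
            have h := sum_mul_rpow_le (fun l => cs κ 1 F l x ^ 2) (θ := p / 2) (by positivity)
              (by linarith) L fun l hl => ne_top_of_le_ne_top hK ((hFK x).trans' (by
                exact Finset.single_le_sum (f := fun l => cs κ 1 F l x ^ 2) (fun _ _ => zero_le)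
                  (Finset.mem_range.2 hl)))
            calc _ = ENNReal.ofReal (2 / p) * (ENNReal.ofReal (p / 2) * ∑ l ∈ Finset.range L,
                  XS κ 1 F (l + 1) x ^ (p / 2 - 1) * cs κ 1 F l x ^ 2) := by
                  rw [← mul_assoc, ← ENNReal.ofReal_mul (by positivity)]
                  field_simp
                  simp
              _ ≤ _ := by
                  gcongr
                  refine (le_of_eq ?_).trans h
                  congr 1
                  exact Finset.sum_congr rfl fun l _ => mul_comm _ _
          · exact XS_le_SQ κ 1 V L x
      _ = A * Y + ENNReal.ofReal (4 / p ^ 2) * ∫⁻ x, SQ κ 1 V x ∂cm := by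
          rw [lintegral_add_left (((measurable_XS κ 1 F L).pow_const _).const_mul _),
            lintegral_const_mul _ ((measurable_XS κ 1 F L).pow_const _),
            lintegral_const_mul _ (measurable_SQ κ 1 V)]
      _ ≤ _ := by
          rw [hB, mul_assoc (ENNReal.ofReal _) C₃]
          gcongr
          exact (h₃ V hVd).trans (by gcongr)
  have hut : ∀ l < L, ∫⁻ x, u l x ∂cm ≠ ∞ := fun l hl => by
    refine ne_top_of_le_ne_top (b := A * Y + B * (4 * (Y + δ))) (by finiteness) (hsum.trans' ?_)
    exact Finset.single_le_sum (f := fun l => ∫⁻ x, u l x ∂cm) (fun _ _ => zero_le)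
      (Finset.mem_range.2 hl)
  have hp4 : p / 2 / 2 = p / 4 := by ring
  rw [hp4] at hlow
  refine (lintegral_le_of_le_exp hκ hp hp2 hF hψ L hc0 hct hlow (fun l x => rfl) hut).trans ?_
  have hV0 : ENNReal.ofReal (2 * Real.pi) * ‖V 0‖ₑ ^ (2 : ℝ) ≤ C₂ * (4 * (Y + δ)) :=
    (enorm_zero_rpow_le V (by norm_num)).trans ((h₂ V hVd).trans (by gcongr))
  set Z := ENNReal.ofReal (2 * Real.pi) * ‖F 0‖ₑ ^ p
  set S := ∫⁻ x, SQ κ 1 F x ^ (p / 2) ∂cm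
  calc _ ≤ Z + C₂ * (4 * (Y + δ)) + ENNReal.ofReal (2 * p) * (A * Y + B * (4 * (Y + δ))) := by
        rw [mul_add]
        gcongr
    _ ≤ (Z + S + δ) + C₂ * (4 * (Z + S + δ)) + ENNReal.ofReal (2 * p) * (A * (Z + S + δ)
          + B * (4 * (Z + S + δ))) := by
        have h1 : Y + δ ≤ Z + S + δ := by
          gcongr
          exact hYS.trans le_add_self
        have h2 : Y ≤ Z + S + δ := le_self_add.trans h1
        have h3 : Z ≤ Z + S + δ := by rw [add_assoc]; exact le_self_add
        gcongr
    _ = _ := by ring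

lemma tsum_sq_le_of_le_half_add {c d : ℕ → ℝ≥0∞} (h0 : c 0 ≤ d 0)
    (h : ∀ l, c (l + 1) ≤ c l / 2 + d (l + 1)) : ∑' l, c l ^ 2 ≤ 4 * ∑' l, d l ^ 2 := by
  have key : ∀ L, ∑ l ∈ Finset.range (L + 1), c l ^ 2 + c L ^ 2
      ≤ 4 * ∑ l ∈ Finset.range (L + 1), d l ^ 2 := by
    intro L
    induction L with
    | zero =>
      simp only [zero_add, Finset.range_one, Finset.sum_singleton]
      calc c 0 ^ 2 + c 0 ^ 2 = 2 * c 0 ^ 2 := by ring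
        _ ≤ 4 * d 0 ^ 2 := by gcongr; norm_num
    | succ L ih =>
      rw [Finset.sum_range_succ _ (L + 1), Finset.sum_range_succ (fun l => d l ^ 2) (L + 1), mul_add]
      have h2 : c (L + 1) ^ 2 + c (L + 1) ^ 2 ≤ c L ^ 2 + 4 * d (L + 1) ^ 2 := by
        calc _ = 2 * c (L + 1) ^ 2 := by ring
          _ ≤ 2 * (2 * ((c L / 2) ^ 2 + d (L + 1) ^ 2)) := by
              gcongr
              refine (pow_le_pow_left' (h L) 2).trans ?_
              simpa [mul_add] using add_sq_le_two_mul (c L / 2) (d (L + 1))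
          _ = (2 * 2⁻¹) ^ 2 * c L ^ 2 + 4 * d (L + 1) ^ 2 := by
              rw [div_eq_mul_inv]; ring
          _ = _ := by rw [ENNReal.mul_inv_cancel (by norm_num) (by norm_num)]; simp
      calc _ = ∑ l ∈ Finset.range (L + 1), c l ^ 2 + (c (L + 1) ^ 2 + c (L + 1) ^ 2) := by ring
        _ ≤ ∑ l ∈ Finset.range (L + 1), c l ^ 2 + (c L ^ 2 + 4 * d (L + 1) ^ 2) := by gcongr
        _ ≤ _ := by rw [← add_assoc]; gcongr
  rw [ENNReal.tsum_eq_iSup_nat]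
  refine iSup_le fun L => ?_
  rcases L with _ | L
  · simp
  · exact (le_self_add.trans (key L)).trans (by gcongr; exact ENNReal.sum_le_tsum _)

/-- Exponentially weighted averages of a sequence. -/
noncomputable def expAvg (d : ℕ → ℝ≥0∞) : ℕ → ℝ≥0∞
  | 0 => d 0
  | l + 1 => expAvg d l / 2 + d (l + 1)

lemma half_pow_mul_succ_le {j l : ℕ} (hj : 1 ≤ j) :
    ((1 / 2 : ℝ≥0∞)) ^ ((l + 1) * j) ≤ (1 / 2) ^ (l * j) / 2 := by
  calc ((1 / 2 : ℝ≥0∞)) ^ ((l + 1) * j) ≤ (1 / 2) ^ (l * j + 1) :=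
        pow_le_pow_right_of_le_one' (by norm_num) (by nlinarith)
    _ = _ := by rw [pow_succ, one_div, div_eq_mul_inv]

lemma half_pow_le_of_le {κ l : ℕ} (hκ : 1 ≤ κ) : ((1 : ℝ) / 2) ^ (l + κ) ≤ (1 / 2) ^ (l + 1) :=
  pow_le_pow_of_le_one (by norm_num) (by norm_num) (by omega)

lemma enorm_iteratedDeriv_le_expAvg {κ j : ℕ} (hκ : 1 ≤ κ) (hj : 1 ≤ j) (F : ℂ → ℂ) {φ x : ℝ} :
    ∀ l (r : ℝ), cell l φ = cell l x → 0 ≤ r → r ≤ 1 - (1 / 2) ^ (l + κ) →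
      ‖iteratedDeriv j F (r * circlePt φ)‖ₑ * (1 / 2) ^ (l * j)
        ≤ expAvg (fun m => cs κ j F m x) l := by
  intro l
  induction l with
  | zero =>
    intro r hφ h0 h1
    exact le_cs ⟨r, φ, hφ, by linarith, by simpa using h0, rfl⟩
  | succ l ih =>
    intro r hφ h0 h1
    rcases le_or_gt (1 - (1 / 2 : ℝ) ^ (l + 1)) r with h | h
    · exact (le_cs ⟨r, φ, hφ, by linarith, by linarith, rfl⟩).trans le_add_self
    · refine (?_ : _ ≤ _).trans (le_self_add)
      calc _ ≤ ‖iteratedDeriv j F (r * circlePt φ)‖ₑ * ((1 / 2) ^ (l * j) / 2) := by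
            gcongr
            exact half_pow_mul_succ_le hj
        _ = ‖iteratedDeriv j F (r * circlePt φ)‖ₑ * (1 / 2) ^ (l * j) / 2 := by rw [mul_div_assoc]
        _ ≤ _ := by
            gcongr
            exact ih r (cell_eq_of_le (Nat.le_succ l) hφ) h0
              (by linarith [half_pow_le_of_le (l := l) hκ])

lemma SQ_dilate_le {κ j : ℕ} (hκ : 1 ≤ κ) (hj : 1 ≤ j) (F : ℂ → ℂ) {ρ : ℝ} (h0 : 0 ≤ ρ)
    (h1 : ρ ≤ 1) (x : ℝ) : SQ κ j (fun z => F (ρ * z)) x ≤ 4 * SQ κ j F x := by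
  refine (ENNReal.tsum_le_tsum fun l => ?_).trans
    (tsum_sq_le_of_le_half_add (c := expAvg fun m => cs κ j F m x) le_rfl fun l => le_rfl)
  gcongr
  refine cs_le ?_
  rintro w ⟨r, φ, hφ, hr1, hr2, rfl⟩
  have hp : ((1 : ℝ) / 2) ^ l ≤ 1 := pow_le_one₀ (by norm_num) (by norm_num)
  have hr0 : 0 ≤ r := by linarith
  have h := enorm_iteratedDeriv_le_expAvg hκ hj F (x := x) l (ρ * r) hφ (by positivity)
    (by nlinarith)
  refine h.trans' ?_
  rw [iteratedDeriv_dilate]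
  dsimp only
  rw [enorm_mul, Complex.ofReal_mul, mul_assoc (ρ : ℂ)]
  gcongr
  refine mul_le_of_le_one_left' ?_
  rw [enorm_pow]
  refine pow_le_one₀ (zero_le) ?_
  rw [← ofReal_norm, Complex.norm_real, Real.norm_of_nonneg h0]
  simpa using h1

lemma norm_radial_sub_le {G : ℂ → ℂ} (hG : DifferentiableOn ℂ G (ball 0 1)) {a b : ℝ} (ha : 0 ≤ a)
    (hab : a ≤ b) (hb : b < 1) (φ : ℝ) {C : ℝ}
    (hC : ∀ r ∈ Icc a b, ‖deriv G (r * circlePt φ)‖ ≤ C) :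
    ‖G (b * circlePt φ) - G (a * circlePt φ)‖ ≤ C * (b - a) := by
  refine norm_image_sub_le_of_norm_deriv_le_segment' (f := fun r : ℝ => G (r * circlePt φ))
    (f' := fun r => deriv G (r * circlePt φ) * circlePt φ) (fun r hr => ?_) (fun r hr => ?_) b
    ⟨hab, le_rfl⟩
  · have hr' : (r * circlePt φ : ℂ) ∈ ball (0 : ℂ) 1 :=
      smul_circlePt_mem_ball (ha.trans hr.1) (hr.2.trans_lt hb) φ
    have h1 := (hG.differentiableAt (isOpen_ball.mem_nhds hr')).hasDerivAt
    have h2 : HasDerivAt (fun r : ℝ => (r * circlePt φ : ℂ)) (circlePt φ) r := by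
      simpa using (Complex.ofRealCLM.hasDerivAt (x := r)).mul_const (circlePt φ)
    exact (h1.comp r h2).hasDerivWithinAt
  · rw [norm_mul, norm_circlePt, mul_one]
    exact hC r ⟨hr.1, hr.2.le⟩

lemma enorm_radial_le {G : ℂ → ℂ} (hG : DifferentiableOn ℂ G (ball 0 1)) {a b : ℝ} (ha : 0 ≤ a)
    (hab : a ≤ b) (hb : b < 1) (φ : ℝ) {C : ℝ≥0∞}
    (hC : ∀ r ∈ Icc a b, ‖deriv G (r * circlePt φ)‖ₑ ≤ C) {l : ℕ} (hl : b - a ≤ (1 / 2) ^ l) :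
    ‖G (b * circlePt φ)‖ₑ ≤ ‖G (a * circlePt φ)‖ₑ + C * (1 / 2) ^ l := by
  rcases eq_or_ne C ∞ with rfl | hCt
  · rw [ENNReal.top_mul (pow_ne_zero _ (by norm_num))]
    simp
  lift C to NNReal using hCt
  have h := norm_radial_sub_le hG ha hab hb φ (C := C) fun r hr => by
    have := hC r hr
    rw [enorm_le_coe] at this
    exact_mod_cast this
  have h2 : ‖G (b * circlePt φ) - G (a * circlePt φ)‖ₑ ≤ C * (1 / 2) ^ l := by
    rw [← ofReal_norm]
    refine (ENNReal.ofReal_le_ofReal (h.trans (mul_le_mul_of_nonneg_left hl C.2))).trans_eq ?_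
    rw [ENNReal.ofReal_mul (NNReal.coe_nonneg C), ENNReal.ofReal_coe_nnreal, ENNReal.ofReal_pow (by norm_num)]
    simp [ENNReal.ofReal_inv_of_pos]
  calc ‖G (b * circlePt φ)‖ₑ = ‖G (a * circlePt φ) + (G (b * circlePt φ) - G (a * circlePt φ))‖ₑ := by
        rw [add_sub_cancel]
    _ ≤ _ := (enorm_add_le _ _).trans (by gcongr)

lemma cs_zero_le {κ j : ℕ} {F : ℂ → ℂ} (hF : DifferentiableOn ℂ F (ball 0 1))
    (h0 : iteratedDeriv j F 0 = 0) (x : ℝ) : cs κ j F 0 x ≤ cs κ (j + 1) F 0 x := by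
  refine cs_le ?_
  rintro w ⟨r, φ, hφ, hr1, hr2, rfl⟩
  have hp : (0 : ℝ) < (1 / 2) ^ (0 + κ) := by positivity
  have hr0 : 0 ≤ r := by simpa using hr2
  have h := enorm_radial_le (differentiableOn_iteratedDeriv isOpen_ball hF j) le_rfl hr0
    (by linarith) φ (C := cs κ (j + 1) F 0 x) (fun t ht => by
      rw [← iteratedDeriv_succ]
      simpa using le_cs (j := j + 1) (F := F) (show (t * circlePt φ : ℂ) ∈ box κ 0 (cell 0 x) from
        ⟨t, φ, hφ, by linarith [ht.2], by simpa using ht.1, rfl⟩)) (l := 0) (by simp; linarith)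
  simpa [h0] using h

lemma cs_succ_le {κ j : ℕ} (hκ : 1 ≤ κ) (hj : 1 ≤ j) {F : ℂ → ℂ}
    (hF : DifferentiableOn ℂ F (ball 0 1)) (l : ℕ) (x : ℝ) :
    cs κ j F (l + 1) x ≤ cs κ j F l x / 2 + cs κ (j + 1) F (l + 1) x := by
  refine cs_le ?_
  rintro w ⟨r, φ, hφ, hr1, hr2, rfl⟩
  have hp : (0 : ℝ) < (1 / 2) ^ (l + 1 + κ) := by positivity
  have hp1 : ((1 : ℝ) / 2) ^ (l + 1) ≤ 1 := pow_le_one₀ (by norm_num) (by norm_num)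
  have hpp : ((1 : ℝ) / 2) ^ (l + 1) ≤ (1 / 2) ^ l :=
    pow_le_pow_of_le_one (by norm_num) (by norm_num) (by omega)
  set H : ℝ≥0∞ := cs κ (j + 1) F (l + 1) x
  have e2 : ∀ n : ℕ, (2 : ℝ≥0∞) ^ n * (1 / 2) ^ n = 1 := fun n => by
    rw [← mul_pow, one_div, ENNReal.mul_inv_cancel (by norm_num) (by norm_num), one_pow]
  have h := enorm_radial_le (differentiableOn_iteratedDeriv isOpen_ball hF j)
    (a := 1 - (1 / 2) ^ (l + 1)) (b := r) (by linarith) (by linarith)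
    (by linarith) φ (C := H * 2 ^ ((l + 1) * (j + 1))) (fun t ht => by
      rw [← iteratedDeriv_succ]
      have hb := le_cs (j := j + 1) (F := F)
        (show (t * circlePt φ : ℂ) ∈ box κ (l + 1) (cell (l + 1) x) from
        ⟨t, φ, hφ, by linarith [ht.2], by linarith [ht.1], rfl⟩)
      calc _ = ‖iteratedDeriv (j + 1) F (t * circlePt φ)‖ₑ * (1 / 2) ^ ((l + 1) * (j + 1))
            * 2 ^ ((l + 1) * (j + 1)) := by rw [mul_assoc, mul_comm ((1 / 2) ^ _), e2, mul_one]
        _ ≤ _ := by gcongr) (l := l + 1) (by linarith)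
  have hb := le_cs (κ := κ) (j := j) (F := F)
        (show (((1 - (1 / 2) ^ (l + 1) : ℝ)) * circlePt φ : ℂ) ∈ box κ l (cell l x) from
        ⟨_, φ, cell_eq_of_le (Nat.le_succ l) hφ, by linarith [half_pow_le_of_le (l := l) hκ],
          by linarith, rfl⟩)
  calc _ ≤ (‖iteratedDeriv j F ((1 - (1 / 2) ^ (l + 1) : ℝ) * circlePt φ)‖ₑ
        + H * 2 ^ ((l + 1) * (j + 1)) * (1 / 2) ^ (l + 1)) * (1 / 2) ^ ((l + 1) * j) := by gcongr
    _ = ‖iteratedDeriv j F ((1 - (1 / 2) ^ (l + 1) : ℝ) * circlePt φ)‖ₑ * (1 / 2) ^ ((l + 1) * j)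
        + H * (2 ^ ((l + 1) * (j + 1)) * (1 / 2) ^ ((l + 1) * (j + 1))) := by ring
    _ ≤ ‖iteratedDeriv j F ((1 - (1 / 2) ^ (l + 1) : ℝ) * circlePt φ)‖ₑ * ((1 / 2) ^ (l * j) / 2)
        + H * 1 := by
        rw [e2]
        gcongr
        exact half_pow_mul_succ_le hj
    _ ≤ _ := by
        rw [← mul_div_assoc, mul_one]
        gcongr

/-- A square function is dominated by the square function of the next derivative. -/
lemma SQ_le_succ {κ j : ℕ} (hκ : 1 ≤ κ) (hj : 1 ≤ j) {F : ℂ → ℂ}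
    (hF : DifferentiableOn ℂ F (ball 0 1)) (h0 : iteratedDeriv j F 0 = 0) (x : ℝ) :
    SQ κ j F x ≤ 4 * SQ κ (j + 1) F x :=
  tsum_sq_le_of_le_half_add (cs_zero_le hF h0 x) fun l => cs_succ_le hκ hj hF l x

lemma SQ_one_le {κ n : ℕ} (hκ : 1 ≤ κ) (hn : 1 ≤ n) {F : ℂ → ℂ}
    (hF : DifferentiableOn ℂ F (ball 0 1)) (h0 : ∀ j < n, iteratedDeriv j F 0 = 0) (x : ℝ) :
    SQ κ 1 F x ≤ 4 ^ (n - 1) * SQ κ n F x := by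
  induction n, hn using Nat.le_induction with
  | base => simp
  | succ n hn ih =>
    refine (ih fun j hj => h0 j (by omega)).trans ?_
    rw [show n + 1 - 1 = n - 1 + 1 by omega, pow_succ, mul_assoc]
    gcongr
    exact SQ_le_succ hκ hn hF (h0 n (by omega)) x

lemma dilate_slice {r ρ : ℝ} (hρ : ρ ≠ 0) (F : ℂ → ℂ) (x : ℝ) :
    F (ρ * (((r / ρ : ℝ) : ℂ) * circlePt x)) = F (r * circlePt x) := by
  have : (ρ : ℂ) ≠ 0 := by exact_mod_cast hρ
  congr 1
  push_cast
  field_simp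

lemma lintegral_SQ_dilate_le {κ : ℕ} (hκ : 1 ≤ κ) {p : ℝ} (hp : 0 < p) (F : ℂ → ℂ) {ρ : ℝ}
    (h0 : 0 ≤ ρ) (h1 : ρ ≤ 1) : ∫⁻ x, SQ κ 1 (fun z => F (ρ * z)) x ^ (p / 2) ∂cm
      ≤ 4 ^ (p / 2) * ∫⁻ x, SQ κ 1 F x ^ (p / 2) ∂cm := by
  rw [← lintegral_const_mul _ ((measurable_SQ κ 1 F).pow_const _)]
  refine lintegral_mono fun x => ?_
  rw [← ENNReal.mul_rpow_of_nonneg _ _ (by positivity : 0 ≤ p / 2)]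
  exact ENNReal.rpow_le_rpow (SQ_dilate_le hκ le_rfl F h0 h1 x) (by positivity)

lemma exists_slice_le_SQ_one_of_le_two {κ : ℕ} (hκ : 1 ≤ κ) {p : ℝ} (hp : 0 < p) (hp2 : p ≤ 2) :
    ∃ C : ℝ≥0∞, C ≠ ∞ ∧ ∀ F : ℂ → ℂ, DifferentiableOn ℂ F (ball 0 1) → ∀ r : ℝ, 0 ≤ r → r < 1 →
      ∫⁻ x, ‖F (r * circlePt x)‖ₑ ^ p ∂cm
        ≤ C * (ENNReal.ofReal (2 * Real.pi) * ‖F 0‖ₑ ^ p + ∫⁻ x, SQ κ 1 F x ^ (p / 2) ∂cm) := by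
  obtain ⟨C, hC, h⟩ := exists_slice_le_SQ_of_le_two hκ hp hp2
  have h4 : (4 : ℝ≥0∞) ^ (p / 2) ≠ ∞ := ENNReal.rpow_ne_top_of_nonneg (by positivity) (by norm_num)
  refine ⟨C * 4 ^ (p / 2), by finiteness, fun F hF r h0 h1 => ?_⟩
  obtain ⟨L, hL⟩ := exists_pow_lt_of_lt_one (show 0 < 1 - r by linarith)
    (show (1 / 2 : ℝ) < 1 by norm_num)
  have hpos : (0 : ℝ) < (1 / 2) ^ L := by positivity
  set s : ℝ := 1 - (1 / 2) ^ L with hs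
  have hs0 : 0 < s := by linarith
  have hρ0 : 0 ≤ r / s := by positivity
  have hρ1 : r / s < 1 := (div_lt_one hs0).2 (by linarith)
  have hd : DifferentiableOn ℂ (fun z => F ((r / s : ℝ) * z)) (ball 0 1) :=
    hF.comp (by fun_prop) fun z hz => by
      rw [mem_ball_zero_iff] at hz ⊢
      rw [norm_mul, Complex.norm_real, Real.norm_of_nonneg hρ0]
      nlinarith [norm_nonneg z]
  have key := h _ hd L
  rw [← hs] at key
  have e : ∀ x, F ((r / s : ℝ) * ((s : ℂ) * circlePt x)) = F (r * circlePt x) := fun x => by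
    have : (s : ℂ) ≠ 0 := by exact_mod_cast hs0.ne'
    congr 1
    push_cast
    field_simp
  simp only [e, mul_zero] at key
  refine key.trans ?_
  rw [mul_assoc]
  gcongr
  rw [mul_add]
  exact add_le_add (le_mul_of_one_le_left zero_le (ENNReal.one_le_rpow (by norm_num) (by positivity)))
    (lintegral_SQ_dilate_le hκ hp F hρ0 hρ1.le)

lemma SQ_pow_le {F : ℂ → ℂ} (hF : DifferentiableOn ℂ F (ball 0 1)) (κ m : ℕ) (x : ℝ) :
    SQ κ 1 (fun z => F z ^ m) x ≤ (m * NM κ 0 F x ^ (m - 1)) ^ 2 * SQ κ 1 F x := by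
  rw [SQ, SQ, ← ENNReal.tsum_mul_left]
  refine ENNReal.tsum_le_tsum fun l => ?_
  rw [← mul_pow]
  gcongr
  refine cs_le fun w hw => ?_
  have hd := hF.differentiableAt (isOpen_ball.mem_nhds (box_subset_ball hw))
  have h0 : ‖F w‖ₑ ≤ NM κ 0 F x := by
    simpa using (le_cs (j := 0) (F := F) hw).trans (cs_le_NM κ 0 F l x)
  rw [iteratedDeriv_one, (hd.hasDerivAt.fun_pow m).deriv, enorm_mul, enorm_mul, enorm_pow]
  have h1 := le_cs (j := 1) (F := F) hw
  rw [iteratedDeriv_one] at h1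
  have hm : ‖(m : ℂ)‖ₑ = m := by
    rw [← ofReal_norm]; simp
  rw [hm, mul_assoc _ ‖deriv F w‖ₑ]
  gcongr

lemma le_of_le_add_rpow_mul {J Z S A B : ℝ≥0∞} (hJ : J ≠ ∞) {θ : ℝ} (h0 : 0 < θ)
    (h : J ≤ A * Z + B * (J ^ (1 - θ) * S ^ θ)) :
    J ≤ (2 * A + (2 * B) ^ (1 / θ)) * (Z + S) := by
  rcases eq_or_ne J 0 with rfl | hJ0
  · exact zero_le
  rcases le_total (A * Z) (B * (J ^ (1 - θ) * S ^ θ)) with h' | h'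
  · have h2 : J ^ θ ≤ 2 * B * S ^ θ := by
      have hc0 : J ^ (1 - θ) ≠ 0 := by simp [ENNReal.rpow_eq_zero_iff, hJ, hJ0]
      have hct : J ^ (1 - θ) ≠ ∞ := by simp [ENNReal.rpow_eq_top_iff, hJ, hJ0]
      rw [← ENNReal.mul_le_mul_iff_right hc0 hct, ← ENNReal.rpow_add _ _ hJ0 hJ, sub_add_cancel,
        ENNReal.rpow_one]
      calc J ≤ B * (J ^ (1 - θ) * S ^ θ) + B * (J ^ (1 - θ) * S ^ θ) := h.trans (by gcongr)
        _ = _ := by ring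
    calc J = (J ^ θ) ^ (1 / θ) := by rw [← ENNReal.rpow_mul, mul_one_div_cancel h0.ne', ENNReal.rpow_one]
      _ ≤ (2 * B * S ^ θ) ^ (1 / θ) := by gcongr
      _ = (2 * B) ^ (1 / θ) * S := by
          rw [ENNReal.mul_rpow_of_nonneg (2 * B) _ (by positivity), ← ENNReal.rpow_mul,
            mul_one_div_cancel h0.ne', ENNReal.rpow_one]
      _ ≤ _ := by
          gcongr
          · exact le_add_self
          · exact le_add_self
  · calc J ≤ A * Z + A * Z := h.trans (by gcongr)
      _ = 2 * A * Z := by ring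
      _ ≤ _ := by
          gcongr
          · exact le_self_add
          · exact le_self_add

lemma exists_slice_le_SQ_one {κ : ℕ} (hκ : 1 ≤ κ) {p : ℝ} (hp : 0 < p) :
    ∃ C : ℝ≥0∞, C ≠ ∞ ∧ ∀ F : ℂ → ℂ, DifferentiableOn ℂ F (ball 0 1) → ∀ r : ℝ, 0 ≤ r → r < 1 →
      ∫⁻ x, ‖F (r * circlePt x)‖ₑ ^ p ∂cm
        ≤ C * (ENNReal.ofReal (2 * Real.pi) * ‖F 0‖ₑ ^ p + ∫⁻ x, SQ κ 1 F x ^ (p / 2) ∂cm) := by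
  obtain ⟨m, hm⟩ := exists_nat_ge (max 1 p)
  have hm1 : (1 : ℝ) ≤ m := (le_max_left _ _).trans hm
  have hmp : p ≤ m := (le_max_right _ _).trans hm
  have hm1' : 1 ≤ m := by exact_mod_cast hm1
  have hm0 : (0 : ℝ) < m := by linarith
  obtain ⟨C₁, hC₁, h₁⟩ := exists_slice_le_SQ_one_of_le_two hκ (p := p / m) (by positivity)
    ((div_le_one hm0).2 hmp |>.trans (by norm_num))
  obtain ⟨C₂, hC₂, h₂⟩ := lintegral_NM_le κ 0 hp
  set θ : ℝ := 1 / m with hθ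
  have hθ0 : 0 < θ := by positivity
  have hθ1 : θ ≤ 1 := (div_le_one hm0).2 hm1
  set B : ℝ≥0∞ := C₁ * ((m : ℝ≥0∞) ^ (p * θ) * C₂ ^ (1 - θ)) with hB
  have hBt : B ≠ ∞ := by
    refine ENNReal.mul_ne_top hC₁ (ENNReal.mul_ne_top ?_ ?_)
    · exact ENNReal.rpow_ne_top_of_nonneg (by positivity) (by simp)
    · exact ENNReal.rpow_ne_top_of_nonneg (by linarith) hC₂
  set D : ℝ≥0∞ := 2 * C₁ + (2 * B) ^ (1 / θ) with hD
  have hDt : D ≠ ∞ := by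
    have : (2 * B) ^ (1 / θ) ≠ ∞ := ENNReal.rpow_ne_top_of_nonneg (by positivity) (by finiteness)
    finiteness
  have key : ∀ G, AN G → ∀ r : ℝ, 0 ≤ r → r < 1 → ∫⁻ x, ‖G (r * circlePt x)‖ₑ ^ p ∂cm
      ≤ D * (ENNReal.ofReal (2 * Real.pi) * ‖G 0‖ₑ ^ p + ∫⁻ x, SQ κ 1 G x ^ (p / 2) ∂cm) := by
    intro G hG
    set J : ℝ≥0∞ := ⨆ (r : ℝ) (_ : 0 ≤ r ∧ r < 1), ∫⁻ x, ‖G (r * circlePt x)‖ₑ ^ p ∂cm with hJ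
    have hle : ∀ r : ℝ, 0 ≤ r → r < 1 → ∫⁻ x, ‖G (r * circlePt x)‖ₑ ^ p ∂cm ≤ J := fun r h0 h1 =>
      le_iSup₂ (f := fun (r : ℝ) (_ : 0 ≤ r ∧ r < 1) => ∫⁻ x, ‖G (r * circlePt x)‖ₑ ^ p ∂cm) r ⟨h0, h1⟩
    have hJt : J ≠ ∞ := by
      obtain ⟨M, hM, hGM⟩ := hG.exists_bound
      have hMp : M ^ p ≠ ∞ := ENNReal.rpow_ne_top_of_nonneg hp.le hM
      refine ne_top_of_le_ne_top (b := M ^ p * ENNReal.ofReal (2 * Real.pi)) (by finiteness)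
        (iSup₂_le fun r hr => ?_)
      rw [← cm_univ, ← lintegral_const]
      exact lintegral_mono fun x => ENNReal.rpow_le_rpow
        (hGM _ (smul_circlePt_mem_ball hr.1 hr.2 x)) hp.le
    suffices h : J ≤ D * (ENNReal.ofReal (2 * Real.pi) * ‖G 0‖ₑ ^ p
        + ∫⁻ x, SQ κ 1 G x ^ (p / 2) ∂cm) from fun r h0 h1 => (hle r h0 h1).trans h
    have hNM : ∫⁻ x, NM κ 0 G x ^ p ∂cm ≤ C₂ * J :=
      (h₂ G hG.diffOn).trans (by gcongr; exact Hl_le_of_forall fun r h0 h1 => hle r h0.le h1)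
    refine le_of_le_add_rpow_mul hJt hθ0 (iSup₂_le fun r hr => ?_)
    have h := h₁ _ (hG.diffOn.fun_pow m) r hr.1 hr.2
    have em : ∀ a : ℝ≥0∞, (a ^ m) ^ (p / m) = a ^ p := fun a => by
      rw [← ENNReal.rpow_natCast, ← ENNReal.rpow_mul, mul_div_cancel₀ _ hm0.ne']
    simp only [enorm_pow, em] at h
    refine h.trans ?_
    rw [mul_add, hB, mul_assoc C₁]
    gcongr
    calc ∫⁻ x, SQ κ 1 (fun z => G z ^ m) x ^ (p / m / 2) ∂cm
        ≤ ∫⁻ x, (m : ℝ≥0∞) ^ (p * θ) * ((NM κ 0 G x ^ p) ^ (1 - θ)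
            * (SQ κ 1 G x ^ (p / 2)) ^ θ) ∂cm := by
          refine lintegral_mono fun x => ?_
          have hpm : 0 ≤ p / m / 2 := by positivity
          refine (ENNReal.rpow_le_rpow (SQ_pow_le hG.diffOn κ m x) hpm).trans_eq ?_
          rw [ENNReal.mul_rpow_of_nonneg _ (SQ κ 1 G x) hpm, ← ENNReal.rpow_natCast (_ * _) 2,
            ← ENNReal.rpow_mul, ENNReal.mul_rpow_of_nonneg _ (NM κ 0 G x ^ (m - 1)) (by positivity),
            ← ENNReal.rpow_natCast (NM κ 0 G x), ← ENNReal.rpow_mul, ← ENNReal.rpow_mul,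
            ← ENNReal.rpow_mul, mul_assoc, Nat.cast_sub hm1']
          have e₁ : ((2 : ℕ) : ℝ) * (p / m / 2) = p * θ := by rw [hθ]; push_cast; ring
          have e₂ : ((m : ℝ) - (1 : ℕ)) * (p * θ) = p * (1 - θ) := by
            rw [hθ]; push_cast; field_simp
          have e₃ : p / m / 2 = p / 2 * θ := by rw [hθ]; ring
          rw [e₁, e₂, e₃]
      _ = (m : ℝ≥0∞) ^ (p * θ) * ∫⁻ x, (NM κ 0 G x ^ p) ^ (1 - θ)
            * (SQ κ 1 G x ^ (p / 2)) ^ θ ∂cm :=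
          lintegral_const_mul _ ((((measurable_NM κ 0 G).pow_const _).pow_const _).fun_mul
            (((measurable_SQ κ 1 G).pow_const _).pow_const _))
      _ ≤ (m : ℝ≥0∞) ^ (p * θ) * ((∫⁻ x, NM κ 0 G x ^ p ∂cm) ^ (1 - θ)
            * (∫⁻ x, SQ κ 1 G x ^ (p / 2) ∂cm) ^ θ) := by
          gcongr
          exact ENNReal.lintegral_mul_norm_pow_le ((measurable_NM κ 0 G).pow_const _).aemeasurable
            ((measurable_SQ κ 1 G).pow_const _).aemeasurable (by linarith) hθ0.le (by ring)
      _ ≤ (m : ℝ≥0∞) ^ (p * θ) * ((C₂ * J) ^ (1 - θ)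
            * (∫⁻ x, SQ κ 1 G x ^ (p / 2) ∂cm) ^ θ) := by
          gcongr
      _ = _ := by
          rw [ENNReal.mul_rpow_of_nonneg C₂ J (by linarith)]
          ring
  have h4 : (4 : ℝ≥0∞) ^ (p / 2) ≠ ∞ := ENNReal.rpow_ne_top_of_nonneg (by positivity) (by norm_num)
  refine ⟨D * 4 ^ (p / 2), by finiteness, fun F hF r h0 h1 => ?_⟩
  have hρ0 : 0 < (1 + r) / 2 := by linarith
  have hρ1 : (1 + r) / 2 < 1 := by linarith
  have h := key _ (AN_dilate hF hρ0 hρ1) (r / ((1 + r) / 2)) (by positivity)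
    ((div_lt_one hρ0).2 (by linarith))
  simp only [dilate_slice hρ0.ne', mul_zero] at h
  refine h.trans ?_
  rw [mul_assoc]
  gcongr
  rw [mul_add]
  exact add_le_add (le_mul_of_one_le_left zero_le (ENNReal.one_le_rpow (by norm_num) (by positivity)))
    (lintegral_SQ_dilate_le hκ hp F hρ0.le hρ1.le)

/-- The `H^p` norm is controlled by the square function of the `n`-th derivative for functions
vanishing to order `n` at the origin. -/
theorem exists_slice_le_SQ {κ n : ℕ} (hκ : 1 ≤ κ) (hn : 1 ≤ n) {p : ℝ} (hp : 0 < p) :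
    ∃ C : ℝ≥0∞, C ≠ ∞ ∧ ∀ F : ℂ → ℂ, DifferentiableOn ℂ F (ball 0 1) →
      (∀ j < n, iteratedDeriv j F 0 = 0) → ∀ r : ℝ, 0 ≤ r → r < 1 →
      ∫⁻ x, ‖F (r * circlePt x)‖ₑ ^ p ∂cm ≤ C * ∫⁻ x, SQ κ n F x ^ (p / 2) ∂cm := by
  obtain ⟨C, hC, h⟩ := exists_slice_le_SQ_one hκ hp
  have h4 : ((4 : ℝ≥0∞) ^ (n - 1)) ^ (p / 2) ≠ ∞ :=
    ENNReal.rpow_ne_top_of_nonneg (by positivity) (by finiteness)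
  refine ⟨C * (4 ^ (n - 1)) ^ (p / 2), by finiteness, fun F hF hF0 r h0 h1 => ?_⟩
  refine (h F hF r h0 h1).trans ?_
  have hz : F 0 = 0 := by simpa using hF0 0 (by omega)
  rw [hz, enorm_zero, ENNReal.zero_rpow_of_pos hp, mul_zero, zero_add, mul_assoc]
  gcongr
  rw [← lintegral_const_mul _ ((measurable_SQ κ n F).pow_const _)]
  refine lintegral_mono fun x => ?_
  rw [← ENNReal.mul_rpow_of_nonneg _ _ (by positivity : 0 ≤ p / 2)]
  exact ENNReal.rpow_le_rpow (SQ_one_le hκ hn hF hF0 x) (by positivity)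

lemma Iop_zero (h : ℂ → ℂ) : Iop h 0 = 0 := by simp [Iop]

lemma Iop_const_mul (c : ℂ) (h : ℂ → ℂ) : Iop (fun z => c * h z) = fun z => c * Iop h z := by
  funext z
  simp only [Iop, intervalIntegral.integral_const_mul]
  ring

lemma hasDerivAt_Iop {h : ℂ → ℂ} (hh : DifferentiableOn ℂ h (ball 0 1)) {z : ℂ}
    (hz : z ∈ ball (0 : ℂ) 1) : HasDerivAt (Iop h) (h z) z := by
  obtain ⟨H, hH⟩ := hh.isExactOn_ball
  have hseg : ∀ w ∈ ball (0 : ℂ) 1, ∀ t ∈ Icc (0 : ℝ) 1, t • w ∈ ball (0 : ℂ) 1 := fun w hw t ht => by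
    rw [mem_ball_zero_iff] at hw ⊢
    rw [norm_smul, Real.norm_of_nonneg ht.1]
    exact (mul_le_of_le_one_left (norm_nonneg _) ht.2).trans_lt hw
  have key : ∀ w ∈ ball (0 : ℂ) 1, Iop h w = H w - H 0 := fun w hw => by
    have hd : ∀ t ∈ uIcc (0 : ℝ) 1, HasDerivAt (fun t : ℝ => H (t • w)) (w * h (t • w)) t := by
      intro t ht
      rw [uIcc_of_le zero_le_one] at ht
      have h1 : HasDerivAt (fun t : ℝ => t • w) w t := by
        simpa using (hasDerivAt_id t).smul_const w
      simpa [Function.comp_def, mul_comm] using (hH _ (hseg w hw t ht)).scomp t h1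
    have hc : ContinuousOn (fun t : ℝ => w * h (t • w)) (uIcc 0 1) := by
      rw [uIcc_of_le zero_le_one]
      exact continuousOn_const.mul (hh.continuousOn.comp (by fun_prop) fun t ht => hseg w hw t ht)
    have := intervalIntegral.integral_eq_sub_of_hasDerivAt hd hc.intervalIntegrable
    rw [intervalIntegral.integral_const_mul] at this
    simpa [Iop] using this
  refine ((hH z hz).sub_const (H 0)).congr_of_eventuallyEq ?_
  filter_upwards [isOpen_ball.mem_nhds hz] with w hw using key w hw

lemma differentiableOn_Iop {h : ℂ → ℂ} (hh : DifferentiableOn ℂ h (ball 0 1)) :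
    DifferentiableOn ℂ (Iop h) (ball 0 1) :=
  fun _ hz => (hasDerivAt_Iop hh hz).differentiableAt.differentiableWithinAt

lemma differentiableOn_iterate_Iop {h : ℂ → ℂ} (hh : DifferentiableOn ℂ h (ball 0 1)) (m : ℕ) :
    DifferentiableOn ℂ (Iop^[m] h) (ball 0 1) := by
  induction m with
  | zero => exact hh
  | succ m ih =>
    rw [Function.iterate_succ_apply']
    exact differentiableOn_Iop ih

lemma iteratedDeriv_iterate_Iop {h : ℂ → ℂ} (hh : DifferentiableOn ℂ h (ball 0 1)) (j m : ℕ) :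
    EqOn (iteratedDeriv j (Iop^[m + j] h)) (Iop^[m] h) (ball 0 1) := by
  induction j generalizing m with
  | zero => intro z _; simp
  | succ j ih =>
    intro z hz
    have e : iteratedDeriv j (Iop^[m + (j + 1)] h) =ᶠ[𝓝 z] Iop (Iop^[m] h) := by
      filter_upwards [isOpen_ball.mem_nhds hz] with w hw
      rw [← Function.iterate_succ_apply' Iop m, show m + (j + 1) = m + 1 + j by ring]
      exact ih (m + 1) hw
    rw [iteratedDeriv_succ, e.deriv_eq]
    exact (hasDerivAt_Iop (differentiableOn_iterate_Iop hh m) hz).deriv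

lemma iteratedDeriv_iterate_Iop_zero {h : ℂ → ℂ} (hh : DifferentiableOn ℂ h (ball 0 1)) {j n : ℕ}
    (hj : j < n) : iteratedDeriv j (Iop^[n] h) 0 = 0 := by
  obtain ⟨m, rfl⟩ := Nat.exists_eq_add_of_lt hj
  rw [show j + m + 1 = m + 1 + j by ring, iteratedDeriv_iterate_Iop hh j (m + 1) (by simp),
    Function.iterate_succ_apply', Iop_zero]

lemma contDiffAt_of_differentiableOn {h : ℂ → ℂ} (hh : DifferentiableOn ℂ h (ball 0 1)) {z : ℂ}
    (hz : z ∈ ball (0 : ℂ) 1) (j : ℕ) : ContDiffAt ℂ j h z :=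
  (hh.analyticAt (isOpen_ball.mem_nhds hz)).contDiffAt

lemma differentiableOn_Tgnk {f g : ℂ → ℂ} (hf : DifferentiableOn ℂ f (ball 0 1))
    (hg : DifferentiableOn ℂ g (ball 0 1)) (n k : ℕ) :
    DifferentiableOn ℂ (fun z => iteratedDeriv k f z * iteratedDeriv (n - k) g z) (ball 0 1) :=
  (differentiableOn_iteratedDeriv isOpen_ball hf k).fun_mul
    (differentiableOn_iteratedDeriv isOpen_ball hg (n - k))

lemma iteratedDeriv_Tga {f g : ℂ → ℂ} (hf : DifferentiableOn ℂ f (ball 0 1))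
    (hg : DifferentiableOn ℂ g (ball 0 1)) (n : ℕ) (a : ℕ → ℂ) (j : ℕ) {z : ℂ}
    (hz : z ∈ ball (0 : ℂ) 1) : iteratedDeriv j (Tga g n a f) z
      = iteratedDeriv j (Tgnk g n 0 f) z
        + ∑ k ∈ Finset.Icc 1 (n - 1), a k * iteratedDeriv j (Tgnk g n k f) z := by
  have hd : ∀ k, ContDiffAt ℂ j (Tgnk g n k f) z := fun k =>
    contDiffAt_of_differentiableOn (differentiableOn_iterate_Iop (differentiableOn_Tgnk hf hg n k) n)
      hz j
  change iteratedDeriv j (fun z => Tgnk g n 0 f z + ∑ k ∈ Finset.Icc 1 (n - 1), a k * Tgnk g n k f z) z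
    = _
  rw [iteratedDeriv_fun_add (hd 0) (ContDiffAt.sum fun k _ => contDiffAt_const.mul (hd k)),
    iteratedDeriv_fun_sum fun k _ => contDiffAt_const.mul (hd k)]
  simp only [iteratedDeriv_const_mul_field]

/-- The three properties of `F = T_{g,a} f` used below: it is holomorphic, it vanishes to order `n`
at the origin, and its `n`-th derivative is `∑ k, c k f⁽ᵏ⁾ g⁽ⁿ⁻ᵏ⁾`. -/
structure IsSol (c : ℕ → ℂ) (n : ℕ) (g f F : ℂ → ℂ) : Prop where
  diffOn : DifferentiableOn ℂ F (ball 0 1)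
  zero : ∀ j < n, iteratedDeriv j F 0 = 0
  eq : ∀ z ∈ ball (0 : ℂ) 1, iteratedDeriv n F z
    = ∑ k ∈ Finset.range n, c k * (iteratedDeriv k f z * iteratedDeriv (n - k) g z)

lemma isSol_Tga {f g : ℂ → ℂ} (hf : DifferentiableOn ℂ f (ball 0 1))
    (hg : DifferentiableOn ℂ g (ball 0 1)) {n : ℕ} (hn : 1 ≤ n) (a : ℕ → ℂ) :
    IsSol (Function.update a 0 1) n g f (Tga g n a f) where
  diffOn := by
    have hd : ∀ k, DifferentiableOn ℂ (Tgnk g n k f) (ball 0 1) := fun k =>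
      differentiableOn_iterate_Iop (differentiableOn_Tgnk hf hg n k) n
    exact (hd 0).fun_add (DifferentiableOn.fun_sum fun k _ => (hd k).const_mul (a k))
  zero j hj := by
    have h0 : ∀ k, iteratedDeriv j (Tgnk g n k f) 0 = 0 := fun k =>
      iteratedDeriv_iterate_Iop_zero (differentiableOn_Tgnk hf hg n k) hj
    rw [iteratedDeriv_Tga hf hg n a j (by simp)]
    simp [h0]
  eq z hz := by
    have h0 : ∀ k, iteratedDeriv n (Tgnk g n k f) z
        = iteratedDeriv k f z * iteratedDeriv (n - k) g z := fun k => by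
      have := iteratedDeriv_iterate_Iop (differentiableOn_Tgnk hf hg n k) n 0 hz
      rwa [zero_add] at this
    have hr : Finset.range n = insert 0 (Finset.Icc 1 (n - 1)) := by
      ext k; simp; omega
    rw [iteratedDeriv_Tga hf hg n a n hz, hr, Finset.sum_insert (by simp)]
    simp only [h0, Function.update_self, one_mul]
    congr 1
    refine Finset.sum_congr rfl fun k hk => ?_
    rw [Function.update_of_ne (by have := (Finset.mem_Icc.1 hk).1; omega)]

lemma Tga_const_mul (g : ℂ → ℂ) (n : ℕ) (a : ℕ → ℂ) (c : ℂ) (f : ℂ → ℂ) :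
    Tga g n a (fun z => c * f z) = fun z => c * Tga g n a f z := by
  have hit : ∀ (m : ℕ) (h : ℂ → ℂ), Iop^[m] (fun z => c * h z) = fun z => c * Iop^[m] h z := by
    intro m h
    induction m with
    | zero => rfl
    | succ m ih => rw [Function.iterate_succ_apply', ih, Iop_const_mul, Function.iterate_succ_apply']
  have hT : ∀ k, Tgnk g n k (fun z => c * f z) = fun z => c * Tgnk g n k f z := fun k => by
    simp only [Tgnk, iteratedDeriv_const_mul_field, mul_assoc]
    exact hit n _
  funext z
  simp only [Tga, hT, mul_add, Finset.mul_sum]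
  congr 1
  exact Finset.sum_congr rfl fun k _ => by ring

lemma iSup_slice_eq {p : ℝ} (hp : 0 < p) (f : ℂ → ℂ) :
    ⨆ r ∈ Ico (0 : ℝ) 1, ∫⁻ x, ‖f (r * circlePt x)‖ₑ ^ p ∂cm
      = ENNReal.ofReal (2 * Real.pi) * hardyNorm p f ^ p := by
  have h0 : ENNReal.ofReal (2 * Real.pi) ≠ 0 := by simp [Real.pi_pos]
  rw [hardyNorm, ← ENNReal.rpow_mul, one_div_mul_cancel hp.ne', ENNReal.rpow_one]
  simp only [ENNReal.mul_iSup]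
  refine iSup_congr fun r => iSup_congr fun _ => ?_
  rw [ENNReal.mul_div_cancel h0 ofReal_ne_top]
  rfl

lemma lintegral_slice_le_hardyNorm {p : ℝ} (hp : 0 < p) (f : ℂ → ℂ) {r : ℝ} (h0 : 0 ≤ r)
    (h1 : r < 1) : ∫⁻ x, ‖f (r * circlePt x)‖ₑ ^ p ∂cm
      ≤ ENNReal.ofReal (2 * Real.pi) * hardyNorm p f ^ p := by
  rw [← iSup_slice_eq hp]
  exact le_iSup₂ (f := fun (r : ℝ) (_ : r ∈ Ico (0 : ℝ) 1) =>
    ∫⁻ x, ‖f (r * circlePt x)‖ₑ ^ p ∂cm) r ⟨h0, h1⟩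

lemma Hl_le_hardyNorm {p : ℝ} (hp : 0 < p) (f : ℂ → ℂ) :
    Hl p f ≤ ENNReal.ofReal (2 * Real.pi) * hardyNorm p f ^ p :=
  Hl_le_of_forall fun _ h0 h1 => lintegral_slice_le_hardyNorm hp f h0.le h1

lemma hardyNorm_rpow_le {p : ℝ} (hp : 0 < p) {f : ℂ → ℂ} {B : ℝ≥0∞}
    (h : ∀ r : ℝ, 0 ≤ r → r < 1 → ∫⁻ x, ‖f (r * circlePt x)‖ₑ ^ p ∂cm ≤ B) :
    hardyNorm p f ^ p ≤ B := by
  calc hardyNorm p f ^ p ≤ ENNReal.ofReal (2 * Real.pi) * hardyNorm p f ^ p := by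
        refine le_mul_of_one_le_left zero_le ?_
        rw [ENNReal.one_le_ofReal]
        linarith [Real.two_le_pi]
    _ = _ := (iSup_slice_eq hp f).symm
    _ ≤ B := iSup₂_le fun r hr => h r hr.1 hr.2

lemma hardyNorm_const_mul {p : ℝ} (hp : 0 < p) (c : ℂ) (f : ℂ → ℂ) :
    hardyNorm p (fun z => c * f z) = ‖c‖ₑ * hardyNorm p f := by
  have h0 : ENNReal.ofReal (2 * Real.pi) ≠ 0 := by simp [Real.pi_pos]
  have hct : ‖c‖ₑ ^ p ≠ ∞ := ENNReal.rpow_ne_top_of_nonneg hp.le enorm_ne_top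
  have key : hardyNorm p (fun z => c * f z) ^ p = (‖c‖ₑ * hardyNorm p f) ^ p := by
    rw [← ENNReal.mul_right_inj h0 ofReal_ne_top, ← iSup_slice_eq hp,
      ENNReal.mul_rpow_of_nonneg _ _ hp.le, mul_left_comm, ← iSup_slice_eq hp]
    simp only [enorm_mul, ENNReal.mul_rpow_of_nonneg _ _ hp.le, ENNReal.mul_iSup,
      lintegral_const_mul' _ _ hct]
  exact (ENNReal.rpow_left_injective hp.ne') key

lemma rpow_sum_range_le (N : ℕ) (a : ℕ → ℝ≥0∞) {e : ℝ} (he : 0 < e) :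
    (∑ i ∈ Finset.range N, a i) ^ e ≤ (N : ℝ≥0∞) ^ e * ∑ i ∈ Finset.range N, a i ^ e := by
  rcases Nat.eq_zero_or_pos N with rfl | hN
  · simp [ENNReal.zero_rpow_of_pos he]
  obtain ⟨m, hm, h⟩ := Finset.exists_max_image (Finset.range N) a ⟨0, Finset.mem_range.2 hN⟩
  calc (∑ i ∈ Finset.range N, a i) ^ e ≤ ((N : ℝ≥0∞) * a m) ^ e := by
        refine ENNReal.rpow_le_rpow ?_ he.le
        simpa using Finset.sum_le_card_nsmul _ _ _ h
    _ = (N : ℝ≥0∞) ^ e * a m ^ e := ENNReal.mul_rpow_of_nonneg _ _ he.le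
    _ ≤ _ := by
        gcongr
        exact Finset.single_le_sum (f := fun i => a i ^ e) (fun _ _ => zero_le) hm

lemma add_rpow_le_two_rpow (u v : ℝ≥0∞) {e : ℝ} (he : 0 < e) : (u + v) ^ e ≤ 2 ^ e * (u ^ e + v ^ e) := by
  simpa [Finset.sum_range_succ] using rpow_sum_range_le 2 (fun i => if i = 0 then u else v) he

/-- Tail of the square function. -/
noncomputable def TL (κ j : ℕ) (F : ℂ → ℂ) (L : ℕ) (x : ℝ) : ℝ≥0∞ := ∑' l, cs κ j F (l + L) x ^ 2

lemma measurable_TL (κ j : ℕ) (F : ℂ → ℂ) (L : ℕ) : Measurable (TL κ j F L) :=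
  Measurable.tsum fun l => (measurable_cs κ j F (l + L)).pow_const 2

lemma XS_add_TL (κ j : ℕ) (F : ℂ → ℂ) (L : ℕ) (x : ℝ) : XS κ j F L x + TL κ j F L x = SQ κ j F x :=
  ENNReal.summable.sum_add_tsum_nat_add'

lemma TL_le_SQ (κ j : ℕ) (F : ℂ → ℂ) (L : ℕ) (x : ℝ) : TL κ j F L x ≤ SQ κ j F x :=
  XS_add_TL κ j F L x ▸ le_add_self

lemma IsSol.cs_le {c : ℕ → ℂ} {n : ℕ} {g f F : ℂ → ℂ} (h : IsSol c n g f F) (κ l : ℕ) (x : ℝ) :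
    cs κ n F l x ≤ ∑ k ∈ Finset.range n, ‖c k‖ₑ * (cs κ k f l x * cs κ (n - k) g l x) := by
  refine HardyArea.cs_le fun w hw => ?_
  rw [h.eq w (box_subset_ball hw)]
  refine (mul_le_mul_left (enorm_sum_le _ _) _).trans ?_
  rw [Finset.sum_mul]
  refine Finset.sum_le_sum fun k hk => ?_
  have hk' : l * n = l * k + l * (n - k) := by
    rw [← mul_add, Nat.add_sub_cancel' (Finset.mem_range.1 hk).le]
  calc ‖c k * (iteratedDeriv k f w * iteratedDeriv (n - k) g w)‖ₑ * (1 / 2) ^ (l * n)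
      = ‖c k‖ₑ * ((‖iteratedDeriv k f w‖ₑ * (1 / 2) ^ (l * k))
          * (‖iteratedDeriv (n - k) g w‖ₑ * (1 / 2) ^ (l * (n - k)))) := by
        rw [hk', pow_add, enorm_mul, enorm_mul]
        ring
    _ ≤ _ := by
        gcongr
        · exact le_cs hw
        · exact le_cs hw

lemma tsum_mul_sq_le {κ k m L : ℕ} {f g : ℂ → ℂ} {x : ℝ} {ε : ℝ≥0∞}
    (h : ∀ l < L, cs κ k f l x ≤ ε) : ∑' l, (cs κ k f l x * cs κ m g l x) ^ 2
      ≤ ε ^ 2 * SQ κ m g x + NM κ k f x ^ 2 * TL κ m g L x := by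
  rw [← ENNReal.summable.sum_add_tsum_nat_add' (k := L)]
  refine add_le_add ?_ ?_
  · calc _ ≤ ∑ l ∈ Finset.range L, ε ^ 2 * cs κ m g l x ^ 2 := by
          refine Finset.sum_le_sum fun l hl => ?_
          rw [mul_pow]
          gcongr
          exact h l (Finset.mem_range.1 hl)
      _ ≤ _ := by
          rw [← Finset.mul_sum]
          gcongr
          exact XS_le_SQ κ m g L x
  · rw [TL, ← ENNReal.tsum_mul_left]
    refine ENNReal.tsum_le_tsum fun l => ?_
    rw [mul_pow]
    gcongr
    exact cs_le_NM κ k f _ x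

lemma IsSol.SQ_le {c : ℕ → ℂ} {n : ℕ} {g f F : ℂ → ℂ} (h : IsSol c n g f F) {κ L : ℕ} {x : ℝ}
    {ε : ℝ≥0∞} (hε : ∀ k < n, ∀ l < L, cs κ k f l x ≤ ε) :
    SQ κ n F x ≤ n * (∑ k ∈ Finset.range n, ‖c k‖ₑ) ^ 2 * ∑ k ∈ Finset.range n,
      (ε ^ 2 * SQ κ (n - k) g x + NM κ k f x ^ 2 * TL κ (n - k) g L x) := by
  set K := ∑ k ∈ Finset.range n, ‖c k‖ₑ
  calc SQ κ n F x
      ≤ ∑' l, n * K ^ 2 * ∑ k ∈ Finset.range n, (cs κ k f l x * cs κ (n - k) g l x) ^ 2 := by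
        refine ENNReal.tsum_le_tsum fun l => ?_
        calc cs κ n F l x ^ 2
            ≤ (K * ∑ k ∈ Finset.range n, cs κ k f l x * cs κ (n - k) g l x) ^ 2 := by
              refine pow_le_pow_left' ((h.cs_le κ l x).trans ?_) 2
              rw [Finset.mul_sum]
              refine Finset.sum_le_sum fun k hk => mul_le_mul_left ?_ _
              exact Finset.single_le_sum (f := fun k => ‖c k‖ₑ) (fun _ _ => zero_le) hk
          _ ≤ K ^ 2 * (n * ∑ k ∈ Finset.range n, (cs κ k f l x * cs κ (n - k) g l x) ^ 2) := by
              rw [mul_pow]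
              gcongr
              exact sq_sum_range_le n _
          _ = _ := by ring
    _ = n * K ^ 2 * ∑ k ∈ Finset.range n, ∑' l, (cs κ k f l x * cs κ (n - k) g l x) ^ 2 := by
        rw [ENNReal.tsum_mul_left, Summable.tsum_finsetSum fun _ _ => ENNReal.summable]
    _ ≤ _ := by
        gcongr with k hk
        exact tsum_mul_sq_le (hε k (Finset.mem_range.1 hk))

lemma lintegral_NM_TL_le {p q s : ℝ} (hq : 0 < q) (hp : 0 < p) (hs0 : 0 < s)
    (hs : 1 / s = 1 / q - 1 / p) (κ k m L : ℕ) (f g : ℂ → ℂ) :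
    ∫⁻ x, (NM κ k f x ^ 2 * TL κ m g L x) ^ (q / 2) ∂cm
      ≤ (∫⁻ x, NM κ k f x ^ p ∂cm) ^ (q / p) * (∫⁻ x, TL κ m g L x ^ (s / 2) ∂cm) ^ (q / s) := by
  have hsum : q / p + q / s = 1 := by
    rw [div_eq_mul_one_div q s, hs]
    field_simp
    ring
  refine le_trans (le_of_eq (lintegral_congr fun x => ?_)) (ENNReal.lintegral_mul_norm_pow_le
    ((measurable_NM κ k f).pow_const p).aemeasurable
    ((measurable_TL κ m g L).pow_const (s / 2)).aemeasurable (by positivity) (by positivity) hsum)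
  rw [ENNReal.mul_rpow_of_nonneg _ _ (by positivity), ← ENNReal.rpow_natCast, ← ENNReal.rpow_mul,
    ← ENNReal.rpow_mul, ← ENNReal.rpow_mul]
  congr 2
  · push_cast
    field_simp
  · field_simp

lemma exists_lintegral_SQ_le_of_isSol {p q s : ℝ} (hq : 0 < q) (hp : 0 < p) (hs0 : 0 < s)
    (hs : 1 / s = 1 / q - 1 / p) (κ n : ℕ) (c : ℕ → ℂ) : ∃ A : ℝ≥0∞, A ≠ ∞ ∧
    ∀ (g f F : ℂ → ℂ), IsSol c n g f F → ∀ (L : ℕ) (ε : ℝ≥0∞),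
      (∀ k < n, ∀ l < L, ∀ x, cs κ k f l x ≤ ε) → ∫⁻ x, SQ κ n F x ^ (q / 2) ∂cm
        ≤ A * ∑ k ∈ Finset.range n, (ε ^ q * ∫⁻ x, SQ κ (n - k) g x ^ (q / 2) ∂cm
          + (∫⁻ x, NM κ k f x ^ p ∂cm) ^ (q / p)
            * (∫⁻ x, TL κ (n - k) g L x ^ (s / 2) ∂cm) ^ (q / s)) := by
  have hq2 : 0 < q / 2 := by positivity
  set K : ℝ≥0∞ := n * (∑ k ∈ Finset.range n, ‖c k‖ₑ) ^ 2
  have hK : K ^ (q / 2) ≠ ∞ := by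
    refine ENNReal.rpow_ne_top_of_nonneg hq2.le (ENNReal.mul_ne_top (by simp) ?_)
    exact ENNReal.pow_ne_top (ENNReal.sum_ne_top.2 fun _ _ => enorm_ne_top)
  have hn : (n : ℝ≥0∞) ^ (q / 2) ≠ ∞ := ENNReal.rpow_ne_top_of_nonneg hq2.le (by simp)
  have h2 : (2 : ℝ≥0∞) ^ (q / 2) ≠ ∞ := ENNReal.rpow_ne_top_of_nonneg hq2.le (by simp)
  refine ⟨K ^ (q / 2) * n ^ (q / 2) * 2 ^ (q / 2), by finiteness, fun g f F h L ε hε => ?_⟩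
  have hε2 : ∀ y : ℝ≥0∞, (ε ^ 2 * y) ^ (q / 2) = ε ^ q * y ^ (q / 2) := fun y => by
    rw [ENNReal.mul_rpow_of_nonneg _ _ hq2.le, ← ENNReal.rpow_natCast, ← ENNReal.rpow_mul]
    congr 2
    push_cast
    ring
  have m1 : ∀ k, Measurable fun x => ε ^ q * SQ κ (n - k) g x ^ (q / 2) := fun k =>
    ((measurable_SQ κ (n - k) g).pow_const _).const_mul _
  have m2 : ∀ k, Measurable fun x => (NM κ k f x ^ 2 * TL κ (n - k) g L x) ^ (q / 2) := fun k =>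
    (((measurable_NM κ k f).pow_const 2).fun_mul (measurable_TL κ (n - k) g L)).pow_const _
  calc ∫⁻ x, SQ κ n F x ^ (q / 2) ∂cm
      ≤ ∫⁻ x, K ^ (q / 2) * n ^ (q / 2) * 2 ^ (q / 2) * ∑ k ∈ Finset.range n,
          (ε ^ q * SQ κ (n - k) g x ^ (q / 2)
            + (NM κ k f x ^ 2 * TL κ (n - k) g L x) ^ (q / 2)) ∂cm := by
        refine lintegral_mono fun x => ?_
        refine (ENNReal.rpow_le_rpow (h.SQ_le fun k hk l hl => hε k hk l hl x) hq2.le).trans ?_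
        rw [ENNReal.mul_rpow_of_nonneg K _ hq2.le, mul_assoc, mul_assoc (K ^ (q / 2))]
        gcongr
        refine (rpow_sum_range_le n _ hq2).trans ?_
        gcongr
        rw [Finset.mul_sum]
        refine Finset.sum_le_sum fun k _ => (add_rpow_le_two_rpow _ _ hq2).trans_eq ?_
        rw [hε2]
    _ = K ^ (q / 2) * n ^ (q / 2) * 2 ^ (q / 2) * ∑ k ∈ Finset.range n,
          (ε ^ q * ∫⁻ x, SQ κ (n - k) g x ^ (q / 2) ∂cm
            + ∫⁻ x, (NM κ k f x ^ 2 * TL κ (n - k) g L x) ^ (q / 2) ∂cm) := by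
        rw [lintegral_const_mul _ (Finset.measurable_sum _ fun k _ => (m1 k).fun_add (m2 k)),
          lintegral_sum_range fun k => (m1 k).fun_add (m2 k)]
        congr 1
        refine Finset.sum_congr rfl fun k _ => ?_
        rw [lintegral_add_left (m1 k),
          lintegral_const_mul _ ((measurable_SQ κ (n - k) g).pow_const _)]
    _ ≤ _ := by
        gcongr with k hk
        exact lintegral_NM_TL_le hq hp hs0 hs κ k (n - k) L f g

lemma tendsto_lintegral_TL (κ j : ℕ) (F : ℂ → ℂ) {e : ℝ} (he : 0 < e)
    (h : ∫⁻ x, SQ κ j F x ^ e ∂cm ≠ ∞) :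
    Tendsto (fun L => ∫⁻ x, TL κ j F L x ^ e ∂cm) atTop (𝓝 0) := by
  have := tendsto_lintegral_of_dominated_convergence (f := fun _ => 0) (fun x => SQ κ j F x ^ e)
    (fun L => (measurable_TL κ j F L).pow_const e)
    (fun L => ae_of_all _ fun x => ENNReal.rpow_le_rpow (TL_le_SQ κ j F L x) he.le) h ?_
  · simpa using this
  · filter_upwards [ae_lt_top ((measurable_SQ κ j F).pow_const e) h] with x hx
    have hS : SQ κ j F x ≠ ∞ := fun h => by simp [h, ENNReal.top_rpow_of_pos he] at hx
    have := (ENNReal.continuous_rpow_const (y := e)).tendsto 0 |>.comp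
      (ENNReal.tendsto_sum_nat_add (fun l => cs κ j F l x ^ 2) hS)
    rwa [ENNReal.zero_rpow_of_pos he] at this

lemma tendstoLocallyUniformlyOn_iteratedDeriv {f : ℕ → ℂ → ℂ}
    (hf : ∀ j, DifferentiableOn ℂ (f j) (ball 0 1))
    (h : TendstoLocallyUniformlyOn f 0 atTop (ball 0 1)) (k : ℕ) :
    TendstoLocallyUniformlyOn (fun j => iteratedDeriv k (f j)) 0 atTop (ball 0 1) := by
  induction k with
  | zero => simpa using h
  | succ k ih =>
    have := ih.deriv (Eventually.of_forall fun j =>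
      differentiableOn_iteratedDeriv isOpen_ball (hf j) k) isOpen_ball
    rw [show deriv (0 : ℂ → ℂ) = 0 from deriv_zero] at this
    simpa only [Function.comp_def, ← iteratedDeriv_succ] using this

lemma eventually_cs_le {f : ℕ → ℂ → ℂ} (hf : ∀ j, DifferentiableOn ℂ (f j) (ball 0 1))
    (h : ∀ K ⊆ ball (0 : ℂ) 1, IsCompact K → TendstoUniformlyOn f 0 atTop K) (κ k L : ℕ) {ε : ℝ≥0∞}
    (hε : 0 < ε) : ∀ᶠ j in atTop, ∀ l < L, ∀ x, cs κ k (f j) l x ≤ ε := by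
  have hpos : (0 : ℝ) < (1 / 2) ^ (L + κ) := by positivity
  have hsub : closedBall (0 : ℂ) (1 - (1 / 2) ^ (L + κ)) ⊆ ball 0 1 :=
    closedBall_subset_ball (by linarith)
  have hk := (tendstoLocallyUniformlyOn_iff_forall_isCompact isOpen_ball).1
    (tendstoLocallyUniformlyOn_iteratedDeriv hf
      ((tendstoLocallyUniformlyOn_iff_forall_isCompact isOpen_ball).2 h) k) _ hsub
      (isCompact_closedBall _ _)
  filter_upwards [EMetric.tendstoUniformlyOn_iff.1 hk ε hε] with j hj l hl x
  refine cs_le fun w hw => ?_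
  have h1 := (norm_of_mem_box hw).1
  have h2 : ((1 : ℝ) / 2) ^ (L + κ) ≤ (1 / 2) ^ (l + κ) :=
    pow_le_pow_of_le_one (by norm_num) (by norm_num) (by omega)
  have h3 := hj w (by rw [mem_closedBall_zero_iff]; linarith)
  rw [Pi.zero_apply, edist_comm, edist_zero_right] at h3
  calc _ ≤ ‖iteratedDeriv k (f j) w‖ₑ * 1 := by
        gcongr
        exact pow_le_one₀ zero_le (by norm_num)
    _ ≤ ε := by rw [mul_one]; exact h3.le

lemma lintegral_SQ_ne_top (κ : ℕ) {j : ℕ} (hj : 1 ≤ j) {s : ℝ} (hs : 0 < s) {g : ℂ → ℂ}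
    (hg : DifferentiableOn ℂ g (ball 0 1)) (hgs : hardyNorm s g ≠ ∞) :
    ∫⁻ x, SQ κ j g x ^ (s / 2) ∂cm ≠ ∞ := by
  obtain ⟨C, hC, h⟩ := lintegral_SQ_le κ hj hs
  have h1 : hardyNorm s g ^ s ≠ ∞ := ENNReal.rpow_ne_top_of_nonneg hs.le hgs
  exact ne_top_of_le_ne_top (by finiteness) ((h g hg).trans (mul_le_mul_right (Hl_le_hardyNorm hs g) C))

lemma lintegral_rpow_ne_top_of_le {φ : ℝ → ℝ≥0∞} {a b : ℝ} (ha : 0 ≤ a) (hab : a ≤ b)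
    (h : ∫⁻ x, φ x ^ b ∂cm ≠ ∞) : ∫⁻ x, φ x ^ a ∂cm ≠ ∞ := by
  refine ne_top_of_le_ne_top (b := ENNReal.ofReal (2 * Real.pi) + ∫⁻ x, φ x ^ b ∂cm) (by finiteness) ?_
  calc ∫⁻ x, φ x ^ a ∂cm ≤ ∫⁻ x, 1 + φ x ^ b ∂cm := by
        refine lintegral_mono fun x => ?_
        rcases le_total (φ x) 1 with h1 | h1
        · exact (ENNReal.rpow_le_one h1 ha).trans le_self_add
        · exact (ENNReal.rpow_le_rpow_of_exponent_le h1 hab).trans le_add_self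
    _ = _ := by rw [lintegral_add_left measurable_const, lintegral_one, cm_univ]

/-- If the symbol lies in `H^s`, bounded sequences in `H^p` that converge to zero locally uniformly
are mapped to null sequences in `H^q`. -/
theorem tendsto_hardyNorm_of_isSol {p q s : ℝ} (hq : 0 < q) (hqp : q < p) (hs0 : 0 < s)
    (hs : 1 / s = 1 / q - 1 / p) {n : ℕ} (hn : 1 ≤ n) {c : ℕ → ℂ} {g : ℂ → ℂ}
    (hg : DifferentiableOn ℂ g (ball 0 1)) (hgs : hardyNorm s g ≠ ∞) {f F : ℕ → ℂ → ℂ}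
    (hf : ∀ j, DifferentiableOn ℂ (f j) (ball 0 1)) (hF : ∀ j, IsSol c n g (f j) (F j))
    {M : ℝ≥0∞} (hM : M ≠ ∞) (hfM : ∀ j, hardyNorm p (f j) ≤ M)
    (hconv : ∀ K ⊆ ball (0 : ℂ) 1, IsCompact K → TendstoUniformlyOn f 0 atTop K) :
    Tendsto (fun j => hardyNorm q (F j)) atTop (𝓝 0) := by
  have hp : 0 < p := hq.trans hqp
  have hqs : q ≤ s := by
    have : 1 / s ≤ 1 / q := by rw [hs]; linarith [one_div_pos.2 hp]
    exact (one_div_le_one_div hs0 hq).1 this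
  obtain ⟨C, hC, h5⟩ := exists_slice_le_SQ (κ := 1) le_rfl hn hq
  obtain ⟨A, hA, hSQ⟩ := exists_lintegral_SQ_le_of_isSol hq hp hs0 hs 1 n c
  choose D hD hNM using fun k => lintegral_NM_le 1 k hp
  have hMp : M ^ p ≠ ∞ := ENNReal.rpow_ne_top_of_nonneg hp.le hM
  set B : ℕ → ℝ≥0∞ := fun k => (D k * (ENNReal.ofReal (2 * Real.pi) * M ^ p)) ^ (q / p)
  have hB : ∀ k, B k ≠ ∞ := fun k => ENNReal.rpow_ne_top_of_nonneg (by positivity)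
    (by have := hD k; finiteness)
  have hNMB : ∀ k j, (∫⁻ x, NM 1 k (f j) x ^ p ∂cm) ^ (q / p) ≤ B k := fun k j => by
    refine ENNReal.rpow_le_rpow ((hNM k (f j) (hf j)).trans ?_) (by positivity)
    gcongr
    refine (Hl_le_hardyNorm hp _).trans ?_
    gcongr
    exact hfM j
  have hgk : ∀ k < n, ∫⁻ x, SQ 1 (n - k) g x ^ (s / 2) ∂cm ≠ ∞ := fun k hk =>
    lintegral_SQ_ne_top 1 (by omega) hs0 hg hgs
  set G : ℝ≥0∞ := ∑ k ∈ Finset.range n, ∫⁻ x, SQ 1 (n - k) g x ^ (q / 2) ∂cm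
  have hG : G ≠ ∞ := ENNReal.sum_ne_top.2 fun k hk => lintegral_rpow_ne_top_of_le
    (by positivity) (by linarith) (hgk k (Finset.mem_range.1 hk))
  set W : ℕ → ℝ≥0∞ := fun L =>
    ∑ k ∈ Finset.range n, B k * (∫⁻ x, TL 1 (n - k) g L x ^ (s / 2) ∂cm) ^ (q / s)
  have hW : Tendsto (fun L => C * A * W L) atTop (𝓝 0) := by
    have : Tendsto W atTop (𝓝 (∑ k ∈ Finset.range n, B k * 0)) := by
      refine tendsto_finsetSum _ fun k hk => ENNReal.Tendsto.const_mul ?_ (Or.inr (hB k))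
      have := (ENNReal.continuous_rpow_const (y := q / s)).tendsto 0 |>.comp
        (tendsto_lintegral_TL 1 (n - k) g (by positivity) (hgk k (Finset.mem_range.1 hk)))
      rwa [ENNReal.zero_rpow_of_pos (by positivity)] at this
    have := ENNReal.Tendsto.const_mul (a := C * A) this (Or.inr (by finiteness))
    simpa using this
  have hE : Tendsto (fun ε : ℝ≥0∞ => C * A * (ε ^ q * G)) (𝓝 0) (𝓝 0) := by
    have h1 : Tendsto (fun ε : ℝ≥0∞ => ε ^ q) (𝓝 0) (𝓝 0) := by
      have := (ENNReal.continuous_rpow_const (y := q)).tendsto 0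
      rwa [ENNReal.zero_rpow_of_pos hq] at this
    have h2 := ENNReal.Tendsto.const_mul (a := C * A)
      (ENNReal.Tendsto.mul_const (b := G) h1 (Or.inr hG)) (Or.inr (by finiteness))
    simpa using h2
  have hle : ∀ (L : ℕ) (ε : ℝ≥0∞), 0 < ε →
      ∀ᶠ j in atTop, hardyNorm q (F j) ^ q ≤ C * A * (ε ^ q * G) + C * A * W L := by
    intro L ε hε
    have hev : ∀ᶠ j in atTop, ∀ k ∈ Finset.range n, ∀ l < L, ∀ x, cs 1 k (f j) l x ≤ ε := by
      rw [Filter.eventually_all_finset]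
      exact fun k _ => eventually_cs_le hf hconv 1 k L hε
    filter_upwards [hev] with j hj
    refine (hardyNorm_rpow_le hq (h5 (F j) (hF j).diffOn (hF j).zero)).trans ?_
    refine (mul_le_mul_right (hSQ g (f j) (F j) (hF j) L ε
      fun k hk => hj k (Finset.mem_range.2 hk)) C).trans ?_
    have hsum : ε ^ q * G + W L = ∑ k ∈ Finset.range n,
        (ε ^ q * ∫⁻ x, SQ 1 (n - k) g x ^ (q / 2) ∂cm
          + B k * (∫⁻ x, TL 1 (n - k) g L x ^ (s / 2) ∂cm) ^ (q / s)) := by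
      rw [Finset.mul_sum, ← Finset.sum_add_distrib]
    rw [← mul_add, mul_assoc, hsum]
    gcongr with k hk
    exact hNMB k j
  have hpow : Tendsto (fun j => hardyNorm q (F j) ^ q) atTop (𝓝 0) := by
    rw [ENNReal.tendsto_nhds_zero]
    intro η hη
    have hη2 : 0 < η / 2 := ENNReal.half_pos hη.ne'
    obtain ⟨L, hL⟩ := ((ENNReal.tendsto_nhds_zero.1 hW) (η / 2) hη2).exists
    obtain ⟨ε, hε, hε0⟩ := (((ENNReal.tendsto_nhds_zero.1 hE) (η / 2) hη2).filter_mono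
      (nhdsWithin_le_nhds (s := Ioi 0)) |>.and self_mem_nhdsWithin).exists
    filter_upwards [hle L ε hε0] with j hj
    exact hj.trans ((add_le_add hε hL).trans_eq (ENNReal.add_halves η))
  have := (ENNReal.continuous_rpow_const (y := 1 / q)).tendsto 0 |>.comp hpow
  rw [ENNReal.zero_rpow_of_pos (by positivity)] at this
  refine this.congr fun j => ?_
  rw [Function.comp_apply, ← ENNReal.rpow_mul, mul_one_div_cancel hq.ne', ENNReal.rpow_one]

lemma slice_zero_le {F : ℂ → ℂ} (hF : DifferentiableOn ℂ F (ball 0 1)) {p : ℝ} (hp : 1 ≤ p)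
    {B : ℝ≥0∞} (h : ∀ r : ℝ, 0 < r → r < 1 → ∫⁻ x, ‖F (r * circlePt x)‖ₑ ^ p ∂cm ≤ B) {r : ℝ}
    (h0 : 0 ≤ r) (h1 : r < 1) : ∫⁻ x, ‖F (r * circlePt x)‖ₑ ^ p ∂cm ≤ B := by
  have hr0 : 0 < (1 + r) / 2 := by linarith
  have hr1 : (1 + r) / 2 < 1 := by linarith
  have key := lintegral_slice_le (AN_dilate hF hr0 hr1) hp (r := r / ((1 + r) / 2)) (by positivity)
    ((div_lt_one hr0).2 (by linarith))
  simp only [dilate_slice hr0.ne'] at key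
  exact key.trans (h _ hr0 hr1)

/-- Testing on powers of `exp ψ` and interpolating recovers the `n`-th derivative of the symbol. -/
lemma exists_rpow_mul_enorm_iteratedDeriv_le (n : ℕ) (β : ℝ) {c : ℕ → ℂ} (hn : 1 ≤ n) (hc : c 0 = 1) :
    ∃ C : ℝ≥0∞, C ≠ ∞ ∧ ∀ (g ψ : ℂ → ℂ) (F : ℕ → ℂ → ℂ), DifferentiableOn ℂ ψ (ball 0 1) →
      (∀ i, IsSol c n g (fun z => Complex.exp (node β i * ψ z)) (F i)) →
      ∀ z ∈ ball (0 : ℂ) 1, |(ψ z).im| ≤ Real.pi / 2 →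
      ‖Complex.exp (ψ z)‖ₑ ^ β * ‖iteratedDeriv n g z‖ₑ
        ≤ C * ∑ i ∈ Finset.range (n + 1), ‖iteratedDeriv n (F i) z‖ₑ := by
  obtain ⟨C, hC, h⟩ := exists_interpolation n β
  refine ⟨C, hC, fun g ψ F hψ hF z hz him => ?_⟩
  choose u _ hu using fun k => exists_polynomial_iteratedDeriv isOpen_ball
    (differentiableOn_const (1 : ℂ)) hψ k
  simp only [one_mul] at hu
  set Q : ℕ → Polynomial ℂ := fun k => ∑ i ∈ Finset.range (k + 1),
    Polynomial.C (u k i z) * Polynomial.X ^ i with hQ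
  set P : Polynomial ℂ := ∑ k ∈ Finset.range n,
    Polynomial.C (c k * iteratedDeriv (n - k) g z) * Q k with hP
  have hQe : ∀ k b, iteratedDeriv k (fun z => Complex.exp (b * ψ z)) z
      = Complex.exp (b * ψ z) * (Q k).eval b := fun k b => by
    rw [hu k b z hz, hQ]
    simp only [Polynomial.eval_finsetSum, Polynomial.eval_mul, Polynomial.eval_C,
      Polynomial.eval_pow, Polynomial.eval_X, mul_comm]
  have hdeg : P.natDegree ≤ n := by
    refine Polynomial.natDegree_sum_le_of_forall_le _ _ fun k hk => ?_
    refine (Polynomial.natDegree_C_mul_le _ _).trans ?_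
    refine Polynomial.natDegree_sum_le_of_forall_le _ _ fun i hi => ?_
    refine (Polynomial.natDegree_C_mul_X_pow_le _ _).trans ?_
    have := Finset.mem_range.1 hk
    have := Finset.mem_range.1 hi
    omega
  have hP0 : P.eval 0 = iteratedDeriv n g z := by
    have hQ0 : ∀ k, (Q k).eval 0 = if k = 0 then 1 else 0 := fun k => by
      have := hQe k 0
      simp only [zero_mul, Complex.exp_zero, one_mul] at this
      rw [← this, iteratedDeriv_const]
    rw [hP]
    simp only [Polynomial.eval_finsetSum, Polynomial.eval_mul, Polynomial.eval_C, hQ0]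
    rw [Finset.sum_eq_single_of_mem 0 (Finset.mem_range.2 hn) fun k _ hk => by simp [hk]]
    simp [hc]
  have hPe : ∀ i, iteratedDeriv n (F i) z
      = Complex.exp (node β i * ψ z) * P.eval (node β i) := fun i => by
    rw [(hF i).eq z hz, hP]
    simp only [hQe, Polynomial.eval_finsetSum, Polynomial.eval_mul, Polynomial.eval_C,
      Finset.mul_sum]
    exact Finset.sum_congr rfl fun k _ => by ring
  have := h (ψ z) him P hdeg
  simpa only [hP0, hPe] using this

lemma exists_polynomial_iteratedDeriv_zero (n : ℕ) (g : ℂ → ℂ) : ∃ P : Polynomial ℂ,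
    (∀ j < n, iteratedDeriv j (fun z => P.eval z) 0 = iteratedDeriv j g 0) ∧
      iteratedDeriv n (fun z => P.eval z) = 0 := by
  set P : Polynomial ℂ := ∑ i ∈ Finset.range n,
    Polynomial.C (iteratedDeriv i g 0 / (i.factorial : ℂ)) * Polynomial.X ^ i with hP
  have hd : ∀ j, iteratedDeriv j (fun z => P.eval z)
      = fun z => ((Polynomial.derivative^[j]) P).eval z := by
    intro j
    induction j with
    | zero => simp
    | succ j ih =>
      rw [iteratedDeriv_succ, ih, Function.iterate_succ_apply']
      funext z
      exact Polynomial.deriv _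
  have hdeg : (Polynomial.derivative^[n]) P = 0 := by
    rw [hP, Polynomial.iterate_derivative_sum]
    refine Finset.sum_eq_zero fun i hi => ?_
    exact Polynomial.iterate_derivative_eq_zero
      ((Polynomial.natDegree_C_mul_X_pow_le _ _).trans_lt (Finset.mem_range.1 hi))
  refine ⟨P, fun j hj => ?_, by rw [hd, hdeg]; funext z; simp⟩
  have hcoeff : P.coeff j = iteratedDeriv j g 0 / (j.factorial : ℂ) := by
    rw [hP, Polynomial.finsetSum_coeff]
    simp [Polynomial.coeff_C_mul, Polynomial.coeff_X_pow, hj]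
  rw [hd]
  beta_reduce
  rw [← Polynomial.coeff_zero_eq_eval_zero, Polynomial.coeff_iterate_derivative, zero_add,
    hcoeff, Nat.descFactorial_self, nsmul_eq_mul, mul_div_cancel₀]
  exact_mod_cast j.factorial_ne_zero

lemma hardyNorm_ne_top_of_SQ {n : ℕ} (hn : 1 ≤ n) {s : ℝ} (hs : 0 < s) {g : ℂ → ℂ}
    (hg : DifferentiableOn ℂ g (ball 0 1)) (h : ∫⁻ x, SQ 1 n g x ^ (s / 2) ∂cm ≠ ∞) :
    hardyNorm s g ≠ ∞ := by
  obtain ⟨C, hC, h5⟩ := exists_slice_le_SQ (κ := 1) le_rfl hn hs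
  obtain ⟨P, hPj, hPn⟩ := exists_polynomial_iteratedDeriv_zero n g
  have hPd : DifferentiableOn ℂ (fun z => P.eval z) (ball 0 1) := P.differentiable.differentiableOn
  have hGd : DifferentiableOn ℂ (fun z => g z - P.eval z) (ball 0 1) := hg.fun_sub hPd
  have hGj : ∀ j, ∀ z ∈ ball (0 : ℂ) 1, iteratedDeriv j (fun z => g z - P.eval z) z
      = iteratedDeriv j g z - iteratedDeriv j (fun z => P.eval z) z := fun j z hz =>
    iteratedDeriv_fun_sub (contDiffAt_of_differentiableOn hg hz j)
      (contDiffAt_of_differentiableOn hPd hz j)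
  have hSQ : ∀ x, SQ 1 n (fun z => g z - P.eval z) x = SQ 1 n g x := fun x => by
    simp only [SQ, cs]
    refine tsum_congr fun l => ?_
    congr 1
    refine iSup_congr fun w => iSup_congr fun hw => ?_
    rw [hGj n w (box_subset_ball hw), hPn, Pi.zero_apply, sub_zero]
  obtain ⟨K, hK⟩ := (isCompact_closedBall (0 : ℂ) 1).exists_bound_of_continuousOn
    P.differentiable.continuous.continuousOn
  have h2 : (2 : ℝ≥0∞) ^ s ≠ ∞ := ENNReal.rpow_ne_top_of_nonneg hs.le (by simp)
  have hKs : ENNReal.ofReal K ^ s ≠ ∞ := ENNReal.rpow_ne_top_of_nonneg hs.le (by simp)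
  have hle : hardyNorm s g ^ s ≤ 2 ^ s * (C * ∫⁻ x, SQ 1 n g x ^ (s / 2) ∂cm
      + ENNReal.ofReal K ^ s * ENNReal.ofReal (2 * Real.pi)) := by
    refine hardyNorm_rpow_le hs fun r h0 h1 => ?_
    have hm := (continuous_slice hGd.continuousOn h0 h1).enorm.measurable.pow_const s
    calc ∫⁻ x, ‖g (r * circlePt x)‖ₑ ^ s ∂cm
        ≤ ∫⁻ x, 2 ^ s * (‖g (r * circlePt x) - P.eval (r * circlePt x : ℂ)‖ₑ ^ s
            + ENNReal.ofReal K ^ s) ∂cm := by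
          refine lintegral_mono fun x => ?_
          have hx := ball_subset_closedBall (smul_circlePt_mem_ball h0 h1 x)
          have hb : ‖P.eval (r * circlePt x : ℂ)‖ₑ ≤ ENNReal.ofReal K := by
            rw [← ofReal_norm]
            exact ENNReal.ofReal_le_ofReal (hK _ hx)
          calc ‖g (r * circlePt x)‖ₑ ^ s
              ≤ (‖g (r * circlePt x) - P.eval (r * circlePt x : ℂ)‖ₑ + ENNReal.ofReal K) ^ s := by
                refine ENNReal.rpow_le_rpow ?_ hs.le
                calc _ = ‖g (r * circlePt x) - P.eval (r * circlePt x : ℂ)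
                        + P.eval (r * circlePt x : ℂ)‖ₑ := by rw [sub_add_cancel]
                  _ ≤ _ := (enorm_add_le _ _).trans (by gcongr)
            _ ≤ _ := add_rpow_le_two_rpow _ _ hs
      _ = 2 ^ s * (∫⁻ x, ‖g (r * circlePt x) - P.eval (r * circlePt x : ℂ)‖ₑ ^ s ∂cm
            + ENNReal.ofReal K ^ s * ENNReal.ofReal (2 * Real.pi)) := by
          rw [lintegral_const_mul' _ _ h2, lintegral_add_left hm, lintegral_const, cm_univ]
      _ ≤ _ := by
          gcongr
          have := h5 _ hGd (fun j hj => by rw [hGj j 0 (by simp), hPj j hj, sub_self]) r h0 h1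
          simpa only [hSQ] using this
  intro htop
  rw [htop, ENNReal.top_rpow_of_pos hs, top_le_iff] at hle
  exact absurd hle (by finiteness)

lemma hardyNorm_exp_node_rpow_le {p : ℝ} (hp : 0 < p) {ψ : ℂ → ℂ}
    (hψ : DifferentiableOn ℂ ψ (ball 0 1)) (him : ∀ w ∈ ball (0 : ℂ) 1, |(ψ w).im| ≤ Real.pi / 2)
    {B : ℝ≥0∞} (hB : ∀ r : ℝ, 0 < r → r < 1 →
      ∫⁻ x, ‖Complex.exp (ψ (r * circlePt x))‖ₑ ^ 2 ∂cm ≤ B) (i : ℕ) :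
    hardyNorm p (fun z => Complex.exp (node (2 / p) i * ψ z)) ^ p ≤ twist i ^ p * B := by
  have ht : twist i ^ p ≠ ∞ := ENNReal.rpow_ne_top_of_nonneg hp.le (twist_ne_top i)
  refine hardyNorm_rpow_le hp fun r h0 h1 => ?_
  calc ∫⁻ x, ‖Complex.exp (node (2 / p) i * ψ (r * circlePt x))‖ₑ ^ p ∂cm
      ≤ ∫⁻ x, twist i ^ p * ‖Complex.exp (ψ (r * circlePt x))‖ₑ ^ (2 : ℝ) ∂cm := by
        refine lintegral_mono fun x => ?_
        refine (ENNReal.rpow_le_rpow (enorm_exp_node_le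
          (him _ (smul_circlePt_mem_ball h0 h1 x)) _ i) hp.le).trans_eq ?_
        rw [ENNReal.mul_rpow_of_nonneg _ _ hp.le, ← ENNReal.rpow_mul, div_mul_cancel₀ _ hp.ne']
    _ = twist i ^ p * ∫⁻ x, ‖Complex.exp (ψ (r * circlePt x))‖ₑ ^ (2 : ℝ) ∂cm :=
        lintegral_const_mul' _ _ ht
    _ ≤ _ := by
        gcongr
        refine slice_zero_le (F := fun z => Complex.exp (ψ z)) hψ.cexp (by norm_num)
          (fun r h0 h1 => ?_) h0 h1
        simpa only [ENNReal.rpow_two] using hB r h0 h1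

/-- A bounded operator solving `F⁽ⁿ⁾ = ∑ c k f⁽ᵏ⁾ g⁽ⁿ⁻ᵏ⁾` from `H^p` to `H^q` has symbol `g ∈ H^s`. -/
theorem hardyNorm_symbol_ne_top {p q s : ℝ} (hq : 0 < q) (hqp : q < p) (hs0 : 0 < s)
    (hs : 1 / s = 1 / q - 1 / p) {n : ℕ} (hn : 1 ≤ n) {c : ℕ → ℂ} (hc : c 0 = 1) {g : ℂ → ℂ}
    (hg : DifferentiableOn ℂ g (ball 0 1)) {T : (ℂ → ℂ) → ℂ → ℂ}
    (hT : ∀ f, DifferentiableOn ℂ f (ball 0 1) → IsSol c n g f (T f)) {C : ℝ≥0∞} (hC : C ≠ ∞)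
    (hTC : ∀ f, DifferentiableOn ℂ f (ball 0 1) → hardyNorm q (T f) ≤ C * hardyNorm p f) :
    hardyNorm s g ≠ ∞ := by
  have hp : 0 < p := hq.trans hqp
  have hs2 : 0 < s / 2 := by positivity
  have hq2 : 0 < q / 2 := by positivity
  have hβ : 0 ≤ 2 / p := by positivity
  obtain ⟨C₁, hC₁, h₁⟩ := exists_rpow_mul_enorm_iteratedDeriv_le n (2 / p) hn hc
  obtain ⟨C₂, hC₂, h₂⟩ := lintegral_SQ_le 1 hn hq
  set S : ℝ≥0∞ := stopc 1 (s / 2) (2 / p) C₁ (n + 1) with hS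
  have hSt : S ^ (q / 2) ≠ ∞ :=
    ENNReal.rpow_ne_top_of_nonneg hq2.le (stopc_ne_top 1 (s / 2) (2 / p) hC₁ (n + 1))
  have hNt : ((n + 1 : ℕ) : ℝ≥0∞) ^ (q / 2) ≠ ∞ := ENNReal.rpow_ne_top_of_nonneg hq2.le (by simp)
  have hCq : C ^ q ≠ ∞ := ENNReal.rpow_ne_top_of_nonneg hq.le hC
  have htw : ∀ i, twist i ^ q ≠ ∞ := fun i => ENNReal.rpow_ne_top_of_nonneg hq.le (twist_ne_top i)
  set A : ℝ≥0∞ := S ^ (q / 2) * ((n + 1 : ℕ) : ℝ≥0∞) ^ (q / 2) * ∑ i ∈ Finset.range (n + 1),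
    C₂ * (ENNReal.ofReal (2 * Real.pi) * (C ^ q * twist i ^ q)) with hA
  have hAt : A ≠ ∞ := by
    refine ENNReal.mul_ne_top (by finiteness) (ENNReal.sum_ne_top.2 fun i _ => ?_)
    have := htw i
    finiteness
  have hθ : 0 < 1 - q / p := by
    rw [sub_pos, div_lt_one hp]
    exact hqp
  have hexp : (s / 2 * (2 / p) + 1) * (q / 2) = s / 2 := by
    have : s * q / p + q = s := by
      have h1 : 1 / q = 1 / s + 1 / p := by linarith
      field_simp at h1 ⊢
      linarith
    calc _ = (s * q / p + q) / 2 := by field_simp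
      _ = _ := by rw [this]
  have hself : ∀ L, ∀ δ : ℝ≥0∞, δ ≠ 0 → δ ≠ ∞ → ∫⁻ x, XS 1 n g L x ^ (s / 2) ∂cm
      ≤ A * (4 * ∫⁻ x, XS 1 n g L x ^ (s / 2) ∂cm + 4 * δ) ^ (1 - (1 - q / p)) := by
    intro L δ hδ hδt
    obtain ⟨K, hK, hgK⟩ := exists_XS_le 1 n L hg
    obtain ⟨ψ, hψ, him, hlow, hL2⟩ := exists_stopping 1 n g L hK hgK hs2 hδ hδt
    set B : ℝ≥0∞ := 4 * ∫⁻ x, XS 1 n g L x ^ (s / 2) ∂cm + 4 * δ with hB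
    set f : ℕ → ℂ → ℂ := fun i z => Complex.exp (node (2 / p) i * ψ z) with hf
    have hfd : ∀ i, DifferentiableOn ℂ (f i) (ball 0 1) := fun i => (hψ.const_mul _).cexp
    have hpt : ∀ x ∈ Ioc 0 (2 * Real.pi), XS 1 n g L x ^ (s / 2 * (2 / p) + 1)
        ≤ S * ∑ i ∈ Finset.range (n + 1), SQ 1 n (T (f i)) x := by
      intro x hx
      refine XS_rpow_le hs2.le hβ fun l hl => ?_
      rw [cs, ENNReal.mul_iSup]
      refine iSup_le fun w => ?_
      rw [ENNReal.mul_iSup]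
      refine iSup_le fun hw => ?_
      have hwb := box_subset_ball hw
      calc _ ≤ ‖Complex.exp (ψ w)‖ₑ ^ (2 / p) * (‖iteratedDeriv n g w‖ₑ * (1 / 2) ^ (l * n)) := by
            gcongr
            exact hlow l hl x hx w hw
        _ = ‖Complex.exp (ψ w)‖ₑ ^ (2 / p) * ‖iteratedDeriv n g w‖ₑ * (1 / 2) ^ (l * n) :=
            (mul_assoc _ _ _).symm
        _ ≤ C₁ * (∑ i ∈ Finset.range (n + 1), ‖iteratedDeriv n (T (f i)) w‖ₑ)
              * (1 / 2) ^ (l * n) := by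
            refine mul_le_mul_left ?_ _
            exact h₁ g ψ (fun i => T (f i)) hψ (fun i => hT _ (hfd i)) w hwb (him w hwb)
        _ = C₁ * ∑ i ∈ Finset.range (n + 1), ‖iteratedDeriv n (T (f i)) w‖ₑ
              * (1 / 2) ^ (l * n) := by rw [mul_assoc, Finset.sum_mul]
        _ ≤ _ := by
            gcongr
            exact le_cs hw
    have hT4 : ∀ i, ∫⁻ x, SQ 1 n (T (f i)) x ^ (q / 2) ∂cm
        ≤ C₂ * (ENNReal.ofReal (2 * Real.pi) * (C ^ q * twist i ^ q)) * B ^ (q / p) := by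
      intro i
      have hfi : hardyNorm p (f i) ^ q ≤ twist i ^ q * B ^ (q / p) := by
        have h := ENNReal.rpow_le_rpow (hardyNorm_exp_node_rpow_le hp hψ him hL2 i)
          (z := q / p) (by positivity)
        rwa [ENNReal.mul_rpow_of_nonneg _ _ (by positivity), ← ENNReal.rpow_mul,
          ← ENNReal.rpow_mul, mul_div_cancel₀ _ hp.ne'] at h
      calc _ ≤ C₂ * Hl q (T (f i)) := h₂ _ (hT _ (hfd i)).diffOn
        _ ≤ C₂ * (ENNReal.ofReal (2 * Real.pi) * (C * hardyNorm p (f i)) ^ q) := by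
            gcongr
            refine (Hl_le_hardyNorm hq _).trans ?_
            gcongr
            exact hTC _ (hfd i)
        _ ≤ C₂ * (ENNReal.ofReal (2 * Real.pi) * (C ^ q * (twist i ^ q * B ^ (q / p)))) := by
            rw [ENNReal.mul_rpow_of_nonneg _ _ hq.le]
            gcongr
        _ = _ := by ring
    calc ∫⁻ x, XS 1 n g L x ^ (s / 2) ∂cm
        ≤ ∫⁻ x, S ^ (q / 2) * ((n + 1 : ℕ) : ℝ≥0∞) ^ (q / 2)
            * ∑ i ∈ Finset.range (n + 1), SQ 1 n (T (f i)) x ^ (q / 2) ∂cm := by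
          refine lintegral_mono_ae ?_
          filter_upwards [ae_mem_Ioc_cm] with x hx
          have h := ENNReal.rpow_le_rpow (hpt x hx) hq2.le
          rw [← ENNReal.rpow_mul, hexp, ENNReal.mul_rpow_of_nonneg _ _ hq2.le] at h
          refine h.trans ?_
          rw [mul_assoc]
          gcongr
          exact rpow_sum_range_le (n + 1) _ hq2
      _ = S ^ (q / 2) * ((n + 1 : ℕ) : ℝ≥0∞) ^ (q / 2)
            * ∑ i ∈ Finset.range (n + 1), ∫⁻ x, SQ 1 n (T (f i)) x ^ (q / 2) ∂cm := by
          rw [lintegral_const_mul' _ _ (by finiteness),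
            lintegral_sum_range fun i => (measurable_SQ 1 n (T (f i))).pow_const _]
      _ ≤ S ^ (q / 2) * ((n + 1 : ℕ) : ℝ≥0∞) ^ (q / 2) * ∑ i ∈ Finset.range (n + 1),
            C₂ * (ENNReal.ofReal (2 * Real.pi) * (C ^ q * twist i ^ q)) * B ^ (q / p) := by
          gcongr with i hi
          exact hT4 i
      _ = A * B ^ (1 - (1 - q / p)) := by
          rw [hA, mul_assoc _ _ (B ^ _), Finset.sum_mul, _root_.sub_sub_cancel]
  refine hardyNorm_ne_top_of_SQ hn hs0 hg ?_
  have h8 : A * 8 ^ (1 - (1 - q / p)) ≠ ∞ := by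
    have : (8 : ℝ≥0∞) ^ (1 - (1 - q / p)) ≠ ∞ :=
      ENNReal.rpow_ne_top_of_nonneg (by rw [_root_.sub_sub_cancel]; positivity) (by simp)
    finiteness
  have hle : ∫⁻ x, SQ 1 n g x ^ (s / 2) ∂cm ≤ (A * 8 ^ (1 - (1 - q / p))) ^ (1 - q / p)⁻¹ := by
    rw [lintegral_SQ_rpow 1 n g hs2]
    refine iSup_le fun L => ?_
    obtain ⟨K, hK, hgK⟩ := exists_XS_le 1 n L hg
    have hY : ∫⁻ x, XS 1 n g L x ^ (s / 2) ∂cm ≠ ∞ := by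
      refine ne_top_of_le_ne_top ?_ (lintegral_mono fun x => ENNReal.rpow_le_rpow (hgK x) hs2.le)
      rw [lintegral_const, cm_univ]
      exact ENNReal.mul_ne_top (ENNReal.rpow_ne_top_of_nonneg hs2.le hK) ofReal_ne_top
    exact (ENNReal.le_rpow_inv_iff hθ).2 (rpow_le_of_self_improving hY hθ (hself L))
  exact ne_top_of_le_ne_top (ENNReal.rpow_ne_top_of_nonneg (by positivity) h8) hle

lemma exists_enorm_rpow_le {p : ℝ} (hp : 0 < p) {K : Set ℂ} (hK : K ⊆ ball 0 1)
    (hKc : IsCompact K) : ∃ D : ℝ≥0∞, D ≠ ∞ ∧ ∀ F : ℂ → ℂ, DifferentiableOn ℂ F (ball 0 1) →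
      ∀ w ∈ K, ‖F w‖ₑ ^ p ≤ D * hardyNorm p F ^ p := by
  have hpi := Real.pi_pos
  obtain ⟨r, hr, hKr⟩ := exists_lt_subset_ball hKc.isClosed hK
  obtain ⟨κ, hκ⟩ := exists_pow_lt_of_lt_one (sub_pos.2 hr) (by norm_num : (1 / 2 : ℝ) < 1)
  obtain ⟨C, hC, h⟩ := lintegral_NM_le κ 0 hp
  refine ⟨C, hC, fun F hF w hw => ?_⟩
  have hcell : ∀ x ∈ Ioc 0 (2 * Real.pi), cell 0 x = 1 := fun x hx => by
    rw [cell_eq_iff]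
    simpa using hx
  have hwr : ‖w‖ < r := by simpa using hKr hw
  obtain ⟨-, φ, hφ, hwφ, -⟩ := exists_mem_box (hK hw) le_rfl
  have hle : ∀ x ∈ Ioc 0 (2 * Real.pi), ‖F w‖ₑ ≤ NM κ 0 F x := fun x hx => by
    refine le_trans ?_ (cs_le_NM κ 0 F 0 x)
    have hbox : w ∈ box κ 0 (cell 0 x) := by
      refine ⟨‖w‖, φ, by rw [hcell x hx, hcell φ hφ], ?_, ?_, hwφ⟩
      · rw [zero_add]
        linarith
      · simp
    simpa using le_cs (j := 0) (F := F) hbox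
  have h0 : ENNReal.ofReal (2 * Real.pi) ≠ 0 := by simp [hpi]
  refine (ENNReal.mul_le_mul_iff_right h0 ofReal_ne_top).1 ?_
  calc ENNReal.ofReal (2 * Real.pi) * ‖F w‖ₑ ^ p = ∫⁻ _x, ‖F w‖ₑ ^ p ∂cm := by
        rw [lintegral_const, cm_univ, mul_comm]
    _ ≤ ∫⁻ x, NM κ 0 F x ^ p ∂cm := by
        refine lintegral_mono_ae ?_
        filter_upwards [ae_mem_Ioc_cm] with x hx
        exact ENNReal.rpow_le_rpow (hle x hx) hp.le
    _ ≤ C * (ENNReal.ofReal (2 * Real.pi) * hardyNorm p F ^ p) :=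
        (h F hF).trans (by gcongr; exact Hl_le_hardyNorm hp F)
    _ = _ := by ring

lemma tendstoUniformlyOn_zero_of_hardyNorm {p : ℝ} (hp : 0 < p) {f : ℕ → ℂ → ℂ}
    (hf : ∀ j, DifferentiableOn ℂ (f j) (ball 0 1))
    (h : Tendsto (fun j => hardyNorm p (f j)) atTop (𝓝 0)) {K : Set ℂ} (hK : K ⊆ ball 0 1)
    (hKc : IsCompact K) : TendstoUniformlyOn f 0 atTop K := by
  obtain ⟨D, hD, hle⟩ := exists_enorm_rpow_le hp hK hKc
  have h1 : Tendsto (fun j => (D * hardyNorm p (f j) ^ p) ^ p⁻¹) atTop (𝓝 0) := by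
    have h2 := h.ennrpow_const p
    rw [ENNReal.zero_rpow_of_pos hp] at h2
    have h3 := (ENNReal.Tendsto.const_mul h2 (Or.inr hD)).ennrpow_const p⁻¹
    rwa [mul_zero, ENNReal.zero_rpow_of_pos (inv_pos.2 hp)] at h3
  rw [Metric.tendstoUniformlyOn_iff]
  intro ε hε
  filter_upwards [h1.eventually_lt_const (ENNReal.ofReal_pos.2 hε)] with j hj w hw
  have h2 := ((ENNReal.le_rpow_inv_iff hp).2 (hle (f j) (hf j) w hw)).trans_lt hj
  rw [← ofReal_norm, ENNReal.ofReal_lt_ofReal_iff hε] at h2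
  simpa using h2

lemma exists_bound_of_compact {p q : ℝ} (hp : 0 < p) (hq : 0 < q) {T : (ℂ → ℂ) → ℂ → ℂ}
    (hT : ∀ (c : ℂ) f, T (fun z => c * f z) = fun z => c * T f z)
    (h : ∀ f : ℕ → ℂ → ℂ, (∀ j, AnalyticOn ℂ (f j) (ball 0 1)) →
      (∃ M : ℝ≥0∞, M ≠ ∞ ∧ ∀ j, hardyNorm p (f j) ≤ M) →
      (∀ K ⊆ ball (0 : ℂ) 1, IsCompact K → TendstoUniformlyOn f 0 atTop K) →
      Tendsto (fun j => hardyNorm q (T (f j))) atTop (𝓝 0)) :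
    ∃ C : ℝ≥0∞, C ≠ ∞ ∧ ∀ f : ℂ → ℂ, AnalyticOn ℂ f (ball 0 1) →
      hardyNorm q (T f) ≤ C * hardyNorm p f := by
  by_contra! hcon
  choose f hfa hfC using fun j : ℕ => hcon ((j : ℝ≥0∞) + 1) (by finiteness)
  choose t ht1 ht2 using fun j => ENNReal.lt_iff_exists_nnreal_btwn.1 (hfC j)
  have ht0 : ∀ j, t j ≠ 0 := fun j h0 => by simpa [h0] using ht1 j
  have ht0' : ∀ j, (t j : ℝ≥0∞) ≠ 0 := fun j => by exact_mod_cast ht0 j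
  set F : ℕ → ℂ → ℂ := fun j z => ((t j : ℝ)⁻¹ : ℂ) * f j z with hF
  have hFd : ∀ j, DifferentiableOn ℂ (F j) (ball 0 1) := fun j =>
    (hfa j).differentiableOn.const_mul _
  have hc : ∀ j, ‖((t j : ℝ)⁻¹ : ℂ)‖ₑ = (t j : ℝ≥0∞)⁻¹ := fun j => by
    rw [← ENNReal.coe_inv (ht0 j), enorm_eq_nnnorm]
    congr 1
    ext
    simp
  have hFp : ∀ j, hardyNorm p (F j) ≤ ((j : ℝ≥0∞) + 1)⁻¹ := fun j => by
    rw [hF, hardyNorm_const_mul hp, hc, ENNReal.le_inv_iff_mul_le, mul_assoc,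
      ENNReal.inv_mul_le_iff (ht0' j) coe_ne_top, mul_one, mul_comm]
    exact (ht1 j).le
  have hlim : Tendsto (fun j => hardyNorm p (F j)) atTop (𝓝 0) := by
    refine tendsto_of_tendsto_of_tendsto_of_le_of_le tendsto_const_nhds
      (ENNReal.tendsto_inv_nat_nhds_zero.comp (tendsto_add_atTop_nat 1)) (fun _ => zero_le) ?_
    intro j
    simpa using hFp j
  have hTF := h F (fun j => (hFd j).analyticOn isOpen_ball) ⟨1, by simp, fun j =>
    (hFp j).trans (ENNReal.inv_le_one.2 le_add_self)⟩ fun K hK hKc =>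
      tendstoUniformlyOn_zero_of_hardyNorm hp hFd hlim hK hKc
  obtain ⟨j, hj⟩ := (hTF.eventually_lt_const one_pos).exists
  rw [hF, hT, hardyNorm_const_mul hq, hc, mul_comm, ← div_eq_mul_inv] at hj
  refine hj.not_ge ?_
  rw [ENNReal.le_div_iff_mul_le (Or.inl (ht0' j)) (Or.inl coe_ne_top), one_mul]
  exact (ht2 j).le

end HardyArea

theorem stmt11 (p q s : ℝ) (hq : 0 < q) (hqp : q < p) (hs : 1 / s = 1 / q - 1 / p)
    (n : ℕ) (hn : 1 ≤ n) (a : ℕ → ℂ) (g : ℂ → ℂ) (hg : AnalyticOn ℂ g (Metric.ball 0 1)) :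
    ((∃ C : ℝ≥0∞, C ≠ ∞ ∧ ∀ f : ℂ → ℂ, AnalyticOn ℂ f (Metric.ball 0 1) →
        hardyNorm q (Tga g n a f) ≤ C * hardyNorm p f) ↔ hardyNorm s g ≠ ∞) ∧
    ((∃ C : ℝ≥0∞, C ≠ ∞ ∧ ∀ f : ℂ → ℂ, AnalyticOn ℂ f (Metric.ball 0 1) →
        hardyNorm q (Tga g n a f) ≤ C * hardyNorm p f) ↔
      (∀ f : ℕ → ℂ → ℂ, (∀ j, AnalyticOn ℂ (f j) (Metric.ball 0 1)) →
        (∃ M : ℝ≥0∞, M ≠ ∞ ∧ ∀ j, hardyNorm p (f j) ≤ M) →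
        (∀ K ⊆ Metric.ball (0 : ℂ) 1, IsCompact K → TendstoUniformlyOn f 0 Filter.atTop K) →
        Filter.Tendsto (fun j => hardyNorm q (Tga g n a (f j))) Filter.atTop (nhds 0))) := by
  have hp : 0 < p := hq.trans hqp
  have hs0 : 0 < s := one_div_pos.1 (hs ▸ sub_pos.2 (one_div_lt_one_div_of_lt hq hqp))
  have hgd := hg.differentiableOn
  have hcompact : hardyNorm s g ≠ ∞ → ∀ f : ℕ → ℂ → ℂ,
      (∀ j, AnalyticOn ℂ (f j) (Metric.ball 0 1)) →
      (∃ M : ℝ≥0∞, M ≠ ∞ ∧ ∀ j, hardyNorm p (f j) ≤ M) →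
      (∀ K ⊆ Metric.ball (0 : ℂ) 1, IsCompact K → TendstoUniformlyOn f 0 Filter.atTop K) →
      Filter.Tendsto (fun j => hardyNorm q (Tga g n a (f j))) Filter.atTop (nhds 0) :=
    fun h f hf ⟨_, hM, hfM⟩ hconv => HardyArea.tendsto_hardyNorm_of_isSol hq hqp hs0 hs hn hgd h
      (fun j => (hf j).differentiableOn)
      (fun j => HardyArea.isSol_Tga (hf j).differentiableOn hgd hn a) hM hfM hconv
  have hbounded := HardyArea.exists_bound_of_compact hp hq (HardyArea.Tga_const_mul g n a)
  have hsymbol : (∃ C : ℝ≥0∞, C ≠ ∞ ∧ ∀ f : ℂ → ℂ, AnalyticOn ℂ f (Metric.ball 0 1) →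
      hardyNorm q (Tga g n a f) ≤ C * hardyNorm p f) → hardyNorm s g ≠ ∞ :=
    fun ⟨_, hC, hTC⟩ => HardyArea.hardyNorm_symbol_ne_top hq hqp hs0 hs hn
      (Function.update_self 0 1 a) hgd (fun _ hf => HardyArea.isSol_Tga hf hgd hn a) hC
      fun f hf => hTC f (hf.analyticOn Metric.isOpen_ball)
  exact ⟨⟨hsymbol, fun h => hbounded (hcompact h)⟩, fun h => hcompact (hsymbol h), hbounded⟩
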